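/- Let 𝓐(p), 𝓑(p) ⊆ F_p be families of subsets indexed by primes p. Suppose there exist an even positive integer m and reals ℓ, γ, α, ε', ε₁, α₁, α₂, ε, x, y > 0, with c₀ := 1/10430, such that: (a) for all sufficiently large primes p, for every a ∈ 𝓐(p) and a₁,…,a_{2m} ∈ 𝓐(p)∖{a}, if Σ_{j=1}^m (a−a_j)^{−1} = Σ_{j=m+1}^{2m}(a−a_j)^{−1} in F_p then (a₁,…,a_m) and (a_{m+1},…,a_{2m}) are permutations of each other; (b) for every ε̃ > 0 there exists P such that for every prime p ≥ P, every S ⊆ 𝓑(p) with |S| ≥ p^ℓ satisfies E(S,S) ≤ p^{−γ+ε̃}·|S|³; (c) there is a constant c > 0 such that c·p^α ≤ |𝓐(p)| ≤ p^α and |𝓑(p)| ≥ c·p^{1−α+ε'} for all sufficiently large primes p; (d) the inequalities ε₁+ε < α₁−α−(4/3)x−ε, ℓ ≤ 1/2+(4/3)x−α₁+ε/2, ε₁+ε < γ/4−y/4−ε, α₂ ≥ 9x+ε, c₀y/8−(α₁/4+9α₂/8)/m ≤ x/8−α/4, ε₁+ε < c₀y/8−(α₁/4+9α₂/8)/m,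 m·y ≤ min{1/2−α₁, 1/2−α₂}, and 3α₂−2α₁ ≤ (2−c₀)·m·y all hold. Then for every ε'' > 0 and every δ with 0 < δ < √2−1, for all sufficiently large primes p, the p × (|𝓐(p)|·|𝓑(p)|) matrix whose columns are the chirp vectors u_{a,b} for (a,b) ∈ 𝓐(p)×𝓑(p) satisfies the (⌊p^{1/2+ε₁/2−ε''}⌋, δ)-restricted isometry property. -/

import Mathlib

open scoped BigOperators Pointwise

/-- `e_p(t) = e^{2πit/p}` for `t ∈ F_p`. -/
noncomputable def ep (p : ℕ) (t : ZMod p) : ℂ :=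
  Complex.exp (2 * Real.pi * Complex.I * (t.val : ℂ) / (p : ℂ))

/-- The additive energy `E(A,B)`: the number of quadruples `(a₁,a₂,b₁,b₂) ∈ A×A×B×B`
with `a₁+b₁ = a₂+b₂`. -/
def addEnergy {G : Type*} [AddCommGroup G] [DecidableEq G] (A B : Finset G) : ℕ :=
  (((A ×ˢ A) ×ˢ B ×ˢ B).filter fun q => q.1.1 + q.2.1 = q.1.2 + q.2.2).card

/-- `Φ` satisfies the `(K,δ)`-restricted isometry property:
`(1−δ)‖x‖² ≤ ‖Φx‖² ≤ (1+δ)‖x‖²` for every vector `x` with at most `K` nonzero entries. -/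
def RIP {ι κ : Type*} [Fintype ι] [Fintype κ] (Φ : Matrix ι κ ℂ) (K : ℕ) (δ : ℝ) : Prop :=
  ∀ x : κ → ℂ, {i | x i ≠ 0}.ncard ≤ K →
    (1 - δ) * (∑ i, ‖x i‖ ^ 2) ≤ (∑ a, ‖Φ.mulVec x a‖ ^ 2) ∧
    (∑ a, ‖Φ.mulVec x a‖ ^ 2) ≤ (1 + δ) * (∑ i, ‖x i‖ ^ 2)

/-- The `p × (|𝓐|·|𝓑|)` matrix whose columns are the chirp vectors
`u_{a,b} = p^{-1/2}(e_p(ax²+bx))_{x∈F_p}` for `(a,b) ∈ 𝓐 × 𝓑`. -/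
noncomputable def chirpMatrix (p : ℕ) (A B : Finset (ZMod p)) :
    Matrix (ZMod p) (A ×ˢ B : Finset (ZMod p × ZMod p)) ℂ :=
  fun x ab => ((Real.sqrt p)⁻¹ : ℝ) * ep p (ab.1.1 * x ^ 2 + ab.1.2 * x)

namespace ChirpRIP

section IteratedDifferences

open Finset

/-- The iterated difference set `jB - jB`. -/
def iterDiff {G : Type*} [AddCommGroup G] [DecidableEq G] (B : Finset G) : ℕ → Finset G
  | 0 => 0
  | j + 1 => iterDiff B j + (B - B)

lemma iterDiff_add {G : Type*} [AddCommGroup G] [DecidableEq G] (B : Finset G) (i j : ℕ) :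
    iterDiff B (i + j) = iterDiff B i + iterDiff B j := by
  induction j with
  | zero => simp [iterDiff]
  | succ j ih => rw [← Nat.add_assoc]; simp only [iterDiff]; rw [ih, add_assoc]

lemma iterDiff_neg {G : Type*} [AddCommGroup G] [DecidableEq G] (B : Finset G) (j : ℕ) :
    -iterDiff B j = iterDiff B j := by
  induction j with
  | zero => simp [iterDiff]
  | succ j ih => simp only [iterDiff]; rw [neg_add, ih, neg_sub]

lemma iterDiff_one {G : Type*} [AddCommGroup G] [DecidableEq G] (B : Finset G) :
    iterDiff B 1 = B - B := by
  simp [iterDiff]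

lemma iterDiff_eq {G : Type*} [AddCommGroup G] [DecidableEq G] (B : Finset G) (j : ℕ) :
    iterDiff B j = j • (B - B) := by
  induction j with
  | zero => simp [iterDiff]
  | succ j ih => simp only [iterDiff]; rw [ih, succ_nsmul]

lemma card_iterDiff_le {G : Type*} [AddCommGroup G] [DecidableEq G] {B : Finset G}
    (hB : B.Nonempty) {L : ℝ} (hL : (#(B - B) : ℝ) ≤ L * #B) (j : ℕ) :
    (#(iterDiff B j) : ℝ) ≤ L ^ (2 * j) * #B := by
  have h := Finset.pluennecke_ruzsa_inequality_nsmul_sub_nsmul_sub hB B j j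
  have h' : ((#(iterDiff B j) : ℚ≥0) : ℝ) ≤ (((#(B - B) / #B : ℚ≥0) ^ (j + j) * #B : ℚ≥0) : ℝ) := by
    rw [iterDiff_eq, nsmul_sub]
    exact_mod_cast h
  push_cast at h'
  have hpos : (0 : ℝ) < #B := by exact_mod_cast hB.card_pos
  refine h'.trans ?_
  rw [two_mul]
  gcongr
  rwa [div_le_iff₀ hpos]

/-- `Z` is covered by at most `r` translates of `jB - jB`. -/
def IsCovered {G : Type*} [AddCommGroup G] [DecidableEq G] (B : Finset G) (r : ℝ) (j : ℕ)
    (Z : Finset G) : Prop :=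
  ∃ F : Finset G, (#F : ℝ) ≤ r ∧ Z ⊆ F + iterDiff B j

namespace IsCovered

variable {G : Type*} [AddCommGroup G] [DecidableEq G] {B Z Z' : Finset G} {r r' L : ℝ} {j j' : ℕ}

lemma mono (h : IsCovered B r j Z) (hZ : Z' ⊆ Z) : IsCovered B r j Z' := by
  obtain ⟨F, hF, h⟩ := h
  exact ⟨F, hF, hZ.trans h⟩

lemma add (h : IsCovered B r j Z) (h' : IsCovered B r' j' Z') :
    IsCovered B (r * r') (j + j') (Z + Z') := by
  obtain ⟨F, hF, h⟩ := h
  obtain ⟨F', hF', h'⟩ := h'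
  refine ⟨F + F', ?_, ?_⟩
  · calc (#(F + F') : ℝ) ≤ #F * #F' := by exact_mod_cast Finset.card_add_le
      _ ≤ r * r' := by gcongr; exact (Nat.cast_nonneg _).trans hF
  · rw [iterDiff_add, add_add_add_comm]
    exact Finset.add_subset_add h h'

lemma neg (h : IsCovered B r j Z) : IsCovered B r j (-Z) := by
  obtain ⟨F, hF, h⟩ := h
  refine ⟨-F, by simpa using hF, ?_⟩
  rw [← iterDiff_neg, ← neg_add]
  exact Finset.neg_subset_neg h

lemma sub (h : IsCovered B r j Z) (h' : IsCovered B r' j' Z') :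
    IsCovered B (r * r') (j + j') (Z - Z') := by
  rw [sub_eq_add_neg]
  exact h.add h'.neg

lemma of_iterDiff (B : Finset G) (j : ℕ) : IsCovered B 1 j (iterDiff B j) :=
  ⟨0, by simp, by rw [zero_add]⟩

lemma self (b : G) (hb : b ∈ B) : IsCovered B 1 1 B := by
  refine ⟨{b}, by simp, fun x hx => ?_⟩
  rw [iterDiff_one]
  exact Finset.mem_add.2 ⟨b, by simp, x - b, Finset.sub_mem_sub hx hb, by abel⟩

lemma card_le (h : IsCovered B r j Z) (hB : B.Nonempty) (hL : (#(B - B) : ℝ) ≤ L * #B) :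
    (#Z : ℝ) ≤ r * L ^ (2 * j) * #B := by
  obtain ⟨F, hF, h⟩ := h
  calc (#Z : ℝ) ≤ #F * #(iterDiff B j) := by
        exact_mod_cast (Finset.card_le_card h).trans Finset.card_add_le
    _ ≤ r * (L ^ (2 * j) * #B) := by
        gcongr
        · exact (Nat.cast_nonneg _).trans hF
        · exact card_iterDiff_le hB hL j
    _ = _ := by ring

end IsCovered

end IteratedDifferences

section Covering

open Finset

/-- Cauchy–Schwarz lower bound for the number of collisions of a map. -/
lemma card_sq_le_card_mul_collisions {ι κ : Type*} [DecidableEq κ] (S : Finset ι) (T : Finset κ)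
    (f : ι → κ) (hf : ∀ i ∈ S, f i ∈ T) :
    #S ^ 2 ≤ #T * #{q ∈ S ×ˢ S | f q.1 = f q.2} := by
  have h1 : #S = ∑ t ∈ T, #{i ∈ S | f i = t} := card_eq_sum_card_fiberwise hf
  have h2 : #{q ∈ S ×ˢ S | f q.1 = f q.2} = ∑ t ∈ T, #{i ∈ S | f i = t} ^ 2 := by
    rw [card_eq_sum_card_fiberwise (f := fun q => f q.1) (t := T)]
    · refine sum_congr rfl fun t _ => ?_
      rw [sq, ← card_product]
      congr 1
      ext ⟨a, b⟩
      simp only [mem_filter, mem_product]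
      grind
    · intro q hq
      simp only [coe_filter, mem_product, Set.mem_ofPred_eq] at hq
      exact hf _ hq.1.1
  rw [h1, h2]
  exact sq_sum_le_card_mul_sum_sq

variable {p : ℕ} [Fact p.Prime]

lemma IsCovered.dilate_of_agreement {B : Finset (ZMod p)} {K L : ℝ} (hL : 0 ≤ L)
    (hB : (#(B - B) : ℝ) ≤ L * #B) (hBne : B.Nonempty) {y z : ZMod p} (hy : y ≠ 0)
    (h : (#B : ℝ) ≤ K * #{b ∈ B | y * b + z ∈ B}) :
    IsCovered B (L * K) 1 (B.image (y * ·)) := by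
  set S : Finset (ZMod p) := ({b ∈ B | y * b + z ∈ B}).image (y * ·) with hS
  have hinj : Function.Injective (y * · : ZMod p → ZMod p) := mul_right_injective₀ hy
  have hScard : #S = #{b ∈ B | y * b + z ∈ B} := card_image_of_injective _ hinj
  have hSne : S.Nonempty := by
    rw [nonempty_iff_ne_empty]
    rintro h0
    rw [h0, card_empty] at hScard
    rw [← hScard] at h
    have : (0 : ℝ) < #B := by exact_mod_cast hBne.card_pos
    rw [Nat.cast_zero, mul_zero] at h
    linarith
  have hsub : B.image (y * ·) + -S ⊆ (B - B).image (y * ·) := by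
    intro w hw
    obtain ⟨u, hu, v, hv, rfl⟩ := mem_add.1 hw
    rw [mem_neg] at hv
    obtain ⟨v, hv, rfl⟩ := hv
    obtain ⟨b, hb, rfl⟩ := mem_image.1 hu
    obtain ⟨b', hb', rfl⟩ := mem_image.1 hv
    exact mem_image.2 ⟨b - b', sub_mem_sub hb (mem_filter.1 hb').1, by ring⟩
  have hcard : (#(B.image (y * ·) + -S) : ℝ) ≤ L * K * #(-S) := by
    calc (#(B.image (y * ·) + -S) : ℝ) ≤ #(B - B) := by
          exact_mod_cast (card_le_card hsub).trans card_image_le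
      _ ≤ L * #B := hB
      _ ≤ L * (K * #S) := by rw [hScard]; gcongr
      _ = L * K * #(-S) := by rw [card_neg]; ring
  obtain ⟨F, -, hF, hcov⟩ := ruzsa_covering_add hSne.neg hcard
  refine ⟨F, hF, hcov.trans (add_subset_add_left ?_)⟩
  rw [iterDiff_one]
  intro w hw
  obtain ⟨u, hu, v, hv, rfl⟩ := mem_sub.1 hw
  rw [mem_neg] at hu hv
  obtain ⟨u, hu, rfl⟩ := hu
  obtain ⟨v, hv, rfl⟩ := hv
  obtain ⟨b, hb, rfl⟩ := mem_image.1 hu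
  obtain ⟨b', hb', rfl⟩ := mem_image.1 hv
  exact mem_sub.2 ⟨_, (mem_filter.1 hb').2, _, (mem_filter.1 hb).2, by ring⟩

lemma IsCovered.dilate_iterDiff {B : Finset (ZMod p)} {r : ℝ} {y : ZMod p}
    (h : IsCovered B r 1 (B.image (y * ·))) (j : ℕ) :
    IsCovered B (r ^ (2 * j)) (2 * j) ((iterDiff B j).image (y * ·)) := by
  induction j with
  | zero =>
    refine ⟨0, by simp, ?_⟩
    simp [iterDiff]
  | succ j ih =>
    have h2 := ih.add (h.sub h)
    convert h2.mono ?_ using 1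
    · ring
    · ring
    intro w hw
    obtain ⟨u, hu, rfl⟩ := mem_image.1 hw
    obtain ⟨a, ha, c, hc, rfl⟩ := mem_add.1 hu
    obtain ⟨b, hb, b', hb', rfl⟩ := mem_sub.1 hc
    exact mem_add.2 ⟨_, mem_image_of_mem _ ha, _, sub_mem_sub (mem_image_of_mem _ hb)
      (mem_image_of_mem _ hb'), by ring⟩

lemma exists_popular_difference {B D Y : Finset (ZMod p)} {R : ℝ} (hR : 1 ≤ R)
    (hY : ∀ y ∈ Y, IsCovered B R 1 (B.image (y * ·))) (hDB : D ⊆ B) (hD : R < #D) :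
    ∃ d₁ ∈ D, ∃ d₂ ∈ D, d₁ ≠ d₂ ∧
      (#Y : ℝ) ≤ 4 * R ^ 2 * #{y ∈ Y | y * (d₁ - d₂) ∈ iterDiff B 2} := by
  have hfl : ⌊R⌋₊ + 1 ≤ #D := (Nat.floor_lt (by linarith)).2 hD
  obtain ⟨D', hD'D, hD'⟩ := exists_subset_card_eq hfl
  have hRD' : R < #D' := by rw [hD']; exact_mod_cast Nat.lt_floor_add_one R
  have hD'R : (#D' : ℝ) ≤ 2 * R := by
    rw [hD']; push_cast; linarith [Nat.floor_le (zero_le_one.trans hR)]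
  have hpair : ∀ y ∈ Y, ∃ q ∈ D'.offDiag, y * (q.1 - q.2) ∈ iterDiff B 2 := by
    intro y hy
    obtain ⟨F, hF, hcov⟩ := hY y hy
    have hc : ∀ d ∈ D', ∃ x ∈ F, y * d - x ∈ iterDiff B 1 := by
      intro d hd
      obtain ⟨x, hx, w, hw, hxw⟩ := mem_add.1 (hcov (mem_image_of_mem (y * ·) (hDB (hD'D hd))))
      exact ⟨x, hx, by simpa [← hxw] using hw⟩
    choose! x hx hw using hc
    obtain ⟨d₁, h₁, d₂, h₂, hne, heq⟩ := exists_ne_map_eq_of_card_lt_of_maps_to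
      (s := D') (t := F) (by exact_mod_cast hF.trans_lt hRD') hx
    refine ⟨(d₁, d₂), by simp [h₁, h₂, hne], ?_⟩
    rw [show (2 : ℕ) = 1 + 1 from rfl, iterDiff_add]
    refine mem_add.2 ⟨y * d₁ - x d₁, hw _ h₁, -(y * d₂ - x d₂), ?_, ?_⟩
    · rw [← iterDiff_neg]
      exact neg_mem_neg (hw _ h₂)
    · rw [heq]; ring
  by_contra! hcon
  have h1 : #Y ≤ ∑ q ∈ D'.offDiag, #{y ∈ Y | y * (q.1 - q.2) ∈ iterDiff B 2} := by
    refine (card_le_card fun y hy => ?_).trans card_biUnion_le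
    obtain ⟨q, hq, h⟩ := hpair y hy
    exact mem_biUnion.2 ⟨q, hq, mem_filter.2 ⟨hy, h⟩⟩
  have hDone : 1 < #D' := by exact_mod_cast hR.trans_lt hRD'
  have hne : D'.offDiag.Nonempty := by
    obtain ⟨d₁, h₁, d₂, h₂, hne⟩ := one_lt_card.1 hDone
    exact ⟨(d₁, d₂), by simp [h₁, h₂, hne]⟩
  have h2 : 4 * R ^ 2 * ∑ q ∈ D'.offDiag, (#{y ∈ Y | y * (q.1 - q.2) ∈ iterDiff B 2} : ℝ)
      < ∑ q ∈ D'.offDiag, (#Y : ℝ) := by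
    rw [mul_sum]
    refine sum_lt_sum_of_nonempty hne fun q hq => ?_
    simp only [mem_offDiag] at hq
    exact hcon _ (hD'D hq.1) _ (hD'D hq.2.1) hq.2.2
  have h3 : (#D'.offDiag : ℝ) ≤ 4 * R ^ 2 := by
    calc (#D'.offDiag : ℝ) ≤ #D' * #D' := by
          rw [offDiag_card]; exact_mod_cast Nat.sub_le _ _
      _ ≤ (2 * R) * (2 * R) := by gcongr
      _ = _ := by ring
  have h4 : (#Y : ℝ) ≤ ∑ q ∈ D'.offDiag, (#{y ∈ Y | y * (q.1 - q.2) ∈ iterDiff B 2} : ℝ) := by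
    exact_mod_cast h1
  rw [sum_const, nsmul_eq_mul] at h2
  have h5 : (#D'.offDiag : ℝ) * #Y ≤ 4 * R ^ 2 * #Y := by gcongr
  have h6 : 4 * R ^ 2 * (#Y : ℝ) ≤ 4 * R ^ 2 *
      ∑ q ∈ D'.offDiag, (#{y ∈ Y | y * (q.1 - q.2) ∈ iterDiff B 2} : ℝ) := by gcongr
  linarith

end Covering

section SumProduct

open Finset

variable {p : ℕ} [Fact p.Prime]

/-- Inductive step of the growth argument: a scale `q` at which `B + q•(d₀ Y')` is small for a
dense `Y'` yields the same for `q + 1`. -/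
lemma exists_small_sum_succ {B Y Y' : Finset (ZMod p)} {R L Δ : ℝ} {d₀ q : ZMod p} (hR : 1 ≤ R)
    (hL : 1 ≤ L) (hBne : B.Nonempty) (hB : (#(B - B) : ℝ) ≤ L * #B)
    (hY : ∀ y ∈ Y, IsCovered B R 1 (B.image (y * ·)))
    (hd₀ : d₀ ≠ 0) (hq : q ≠ 0) (hYd : ∀ y ∈ Y, y * d₀ ∈ iterDiff B 2)
    (hΔ : Δ = R ^ 10 * L ^ 24) (hlarge : 4 * R ^ 3 * Δ < #Y) (hY' : Y' ⊆ Y)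
    (hcard : (#Y : ℝ) ≤ 4 * R ^ 2 * #Y')
    (hsum : (#(B + Y'.image (q * d₀ * ·)) : ℝ) ≤ Δ * #B) :
    ∃ Y'' ⊆ Y, (#Y : ℝ) ≤ 4 * R ^ 2 * #Y'' ∧
      (#(B + Y''.image ((q + 1) * d₀ * ·)) : ℝ) ≤ Δ * #B := by
  have hqd : q * d₀ ≠ 0 := mul_ne_zero hq hd₀
  have hΔ1 : 1 ≤ Δ := by
    rw [hΔ]; exact one_le_mul_of_one_le_of_one_le (one_le_pow₀ hR) (one_le_pow₀ hL)
  have hBpos : (0 : ℝ) < #B := by exact_mod_cast hBne.card_pos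
  have hY'R : R * Δ < #Y' := by
    have : 4 * R ^ 2 * (R * Δ) < 4 * R ^ 2 * #Y' := by
      calc 4 * R ^ 2 * (R * Δ) = 4 * R ^ 3 * Δ := by ring
        _ < _ := hlarge.trans_le hcard
    exact lt_of_mul_lt_mul_left this (by positivity)
  obtain ⟨z, -, hz⟩ : ∃ z ∈ B + Y'.image (q * d₀ * ·),
      R < #{w ∈ B ×ˢ Y' | w.1 + q * d₀ * w.2 = z} := by
    by_contra! hcon
    have h1 : #(B ×ˢ Y') = ∑ z ∈ B + Y'.image (q * d₀ * ·),
        #{w ∈ B ×ˢ Y' | w.1 + q * d₀ * w.2 = z} := by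
      refine card_eq_sum_card_fiberwise fun w hw => ?_
      have hw := mem_product.1 (mem_coe.1 hw)
      exact add_mem_add hw.1 (mem_image_of_mem _ hw.2)
    have h2 : (#(B ×ˢ Y') : ℝ) ≤ ∑ z ∈ B + Y'.image (q * d₀ * ·), R := by
      rw [h1]; push_cast; exact sum_le_sum hcon
    rw [sum_const, nsmul_eq_mul, card_product] at h2
    push_cast at h2
    have h3 : (#(B + Y'.image (q * d₀ * ·)) : ℝ) * R ≤ Δ * #B * R := by gcongr
    have h4 : (#B : ℝ) * (R * Δ) < #B * #Y' := by gcongr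
    linarith
  set D : Finset (ZMod p) := ({w ∈ B ×ˢ Y' | w.1 + q * d₀ * w.2 = z}).image Prod.fst with hD
  have hDcard : #D = #{w ∈ B ×ˢ Y' | w.1 + q * d₀ * w.2 = z} := by
    refine card_image_of_injOn fun w hw w' hw' h => ?_
    have hw := (mem_filter.1 (mem_coe.1 hw)).2
    have hw' := (mem_filter.1 (mem_coe.1 hw')).2
    refine Prod.ext h (mul_left_cancel₀ hqd ?_)
    rw [← hw', h] at hw
    exact add_left_cancel hw
  have hDB : D ⊆ B := by
    intro d hd
    obtain ⟨w, hw, rfl⟩ := mem_image.1 hd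
    exact (mem_product.1 (mem_filter.1 hw).1).1
  obtain ⟨d₁, h₁, d₂, h₂, hne, hYc⟩ := exists_popular_difference hR hY hDB (by rwa [hDcard])
  refine ⟨_, filter_subset _ _, hYc, ?_⟩
  set Y'' : Finset (ZMod p) := {y ∈ Y | y * (d₁ - d₂) ∈ iterDiff B 2} with hY''
  obtain ⟨⟨d₁, y₁⟩, hw₁, rfl⟩ := mem_image.1 h₁
  obtain ⟨⟨d₂, y₂⟩, hw₂, rfl⟩ := mem_image.1 h₂
  obtain ⟨hw₁, he₁⟩ := mem_filter.1 hw₁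
  obtain ⟨hw₂, he₂⟩ := mem_filter.1 hw₂
  obtain ⟨-, hy₁⟩ := mem_product.1 hw₁
  obtain ⟨-, hy₂⟩ := mem_product.1 hw₂
  simp only at he₁ he₂ hy₁ hy₂ hne hY''
  have hdiff : d₁ - d₂ = q * d₀ * (y₂ - y₁) := by linear_combination he₁ - he₂
  have hy : y₂ - y₁ ≠ 0 := fun h => hne (sub_eq_zero.1 (by rw [hdiff, h, mul_zero]))
  have hc₁ := hY y₁ (hY' hy₁)
  have hc₂ := hY y₂ (hY' hy₂)
  have hcov := (hc₂.sub hc₁).add ((IsCovered.of_iterDiff B 2).add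
    ((hc₂.dilate_iterDiff 2).sub (hc₁.dilate_iterDiff 2)))
  have hsub : (B + Y''.image ((q + 1) * d₀ * ·)).image ((y₂ - y₁) * ·) ⊆
      B.image (y₂ * ·) - B.image (y₁ * ·) + (iterDiff B 2 +
        ((iterDiff B 2).image (y₂ * ·) - (iterDiff B 2).image (y₁ * ·))) := by
    intro w hw
    obtain ⟨u, hu, rfl⟩ := mem_image.1 hw
    obtain ⟨b, hb, v, hv, rfl⟩ := mem_add.1 hu
    obtain ⟨y, hy, rfl⟩ := mem_image.1 hv
    obtain ⟨hyY, hyd⟩ := mem_filter.1 hy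
    refine mem_add.2 ⟨_, sub_mem_sub (mem_image_of_mem _ hb) (mem_image_of_mem _ hb), _,
      add_mem_add hyd (sub_mem_sub (mem_image_of_mem _ (hYd y hyY))
        (mem_image_of_mem _ (hYd y hyY))), ?_⟩
    rw [hdiff]; ring
  have h := (hcov.mono hsub).card_le hBne hB
  rw [card_image_of_injective _ (mul_right_injective₀ hy)] at h
  refine h.trans_eq ?_
  rw [hΔ]; ring

lemma exists_small_sum {B Y : Finset (ZMod p)} {R L Δ : ℝ} {d₀ : ZMod p} (hR : 1 ≤ R)
    (hL : 1 ≤ L) (hBne : B.Nonempty) (hB : (#(B - B) : ℝ) ≤ L * #B)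
    (hY : ∀ y ∈ Y, IsCovered B R 1 (B.image (y * ·)))
    (hd₀ : d₀ ≠ 0) (hYd : ∀ y ∈ Y, y * d₀ ∈ iterDiff B 2)
    (hΔ : Δ = R ^ 10 * L ^ 24) (hlarge : 4 * R ^ 3 * Δ < #Y) {q : ZMod p} (hq : q ≠ 0) :
    ∃ Y' ⊆ Y, (#Y : ℝ) ≤ 4 * R ^ 2 * #Y' ∧
      (#(B + Y'.image (q * d₀ * ·)) : ℝ) ≤ Δ * #B := by
  have key : ∀ n : ℕ, n + 1 < p → ∃ Y' ⊆ Y, (#Y : ℝ) ≤ 4 * R ^ 2 * #Y' ∧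
      (#(B + Y'.image (((n + 1 : ℕ) : ZMod p) * d₀ * ·)) : ℝ) ≤ Δ * #B := by
    intro n
    induction n with
    | zero =>
      intro _
      refine ⟨Y, Subset.rfl, ?_, ?_⟩
      · have : 1 ≤ 4 * R ^ 2 := by nlinarith
        exact le_mul_of_one_le_left (Nat.cast_nonneg _) this
      obtain ⟨b, hb⟩ := hBne
      have hcov := (IsCovered.self b hb).add (IsCovered.of_iterDiff B 2)
      have hsub : B + Y.image (((0 + 1 : ℕ) : ZMod p) * d₀ * ·) ⊆ B + iterDiff B 2 := by
        refine add_subset_add_left fun w hw => ?_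
        obtain ⟨y, hy, rfl⟩ := mem_image.1 hw
        simpa [mul_comm] using hYd y hy
      refine ((hcov.mono hsub).card_le ⟨b, hb⟩ hB).trans ?_
      rw [hΔ]
      gcongr ?_ * _
      calc (1 : ℝ) * 1 * L ^ (2 * (1 + 2)) ≤ R ^ 10 * L ^ 24 := by
            gcongr
            · rw [mul_one]; exact one_le_pow₀ hR
            · norm_num
    | succ n ih =>
      intro hn
      obtain ⟨Y', hY', hc, hs⟩ := ih (by omega)
      have hq : ((n + 1 : ℕ) : ZMod p) ≠ 0 := by
        rw [Ne, ZMod.natCast_eq_zero_iff]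
        exact Nat.not_dvd_of_pos_of_lt (by omega) (by omega)
      have := exists_small_sum_succ hR hL hBne hB hY hd₀ hq hYd hΔ hlarge hY' hc hs
      simpa using this
  have hv : q.val ≠ 0 := by rwa [Ne, ZMod.val_eq_zero]
  obtain ⟨n, hn⟩ := Nat.exists_eq_succ_of_ne_zero hv
  have h := key n (by rw [← Nat.succ_eq_add_one, ← hn]; exact q.val_lt)
  rwa [← Nat.succ_eq_add_one, ← hn, ZMod.natCast_zmod_val] at h

lemma sum_dilate_collisions_le {B Y : Finset (ZMod p)} {d₀ : ZMod p} (hd₀ : d₀ ≠ 0) :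
    ∑ q ∈ univ.erase (0 : ZMod p), #{w ∈ (B ×ˢ Y) ×ˢ (B ×ˢ Y) |
        w.1.1 + q * d₀ * w.1.2 = w.2.1 + q * d₀ * w.2.2} ≤
      (p - 1) * (#B * #Y) + (#B * #Y) ^ 2 := by
  classical
  simp only [card_filter]
  rw [sum_comm]
  have h : ∀ w ∈ (B ×ˢ Y) ×ˢ (B ×ˢ Y), (∑ q ∈ univ.erase (0 : ZMod p),
      if w.1.1 + q * d₀ * w.1.2 = w.2.1 + q * d₀ * w.2.2 then 1 else 0) ≤
      (if w.1 = w.2 then p - 1 else 0) + 1 := by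
    intro w _
    rw [← card_filter]
    split_ifs with hw
    · refine (card_filter_le _ _).trans ?_
      rw [card_erase_of_mem (mem_univ _), card_univ, ZMod.card]
      omega
    · rw [zero_add, card_le_one]
      intro q hq q' hq'
      have hq := (mem_filter.1 hq).2
      have hq' := (mem_filter.1 hq').2
      have hne : w.1.2 ≠ w.2.2 := by
        intro h
        refine hw (Prod.ext ?_ h)
        rw [h] at hq
        exact add_right_cancel hq
      have h0 : (q - q') * (d₀ * (w.1.2 - w.2.2)) = 0 := by linear_combination hq - hq'
      rcases mul_eq_zero.1 h0 with h | h
      · exact sub_eq_zero.1 h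
      · exact absurd h (mul_ne_zero hd₀ (sub_ne_zero.2 hne))
  refine (sum_le_sum h).trans ?_
  rw [sum_add_distrib, sum_const, smul_eq_mul, mul_one, card_product, card_product, sq]
  gcongr
  rw [← sum_filter, sum_const, smul_eq_mul, mul_comm]
  gcongr
  have : ({w ∈ (B ×ˢ Y) ×ˢ (B ×ˢ Y) | w.1 = w.2}) ⊆ (B ×ˢ Y).image fun v => (v, v) := by
    intro w hw
    obtain ⟨h1, h2⟩ := mem_filter.1 hw
    exact mem_image.2 ⟨w.1, (mem_product.1 h1).1, Prod.ext rfl h2⟩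
  calc _ ≤ _ := card_le_card this
    _ ≤ _ := card_image_le
    _ = _ := card_product _ _

/-- A sum-product estimate: few dilates of a set with small doubling largely agree with it. -/
theorem card_agreeing_dilates_le {B Y : Finset (ZMod p)} {K L : ℝ} (hK : 1 ≤ K) (hL : 1 ≤ L)
    (hB : (#(B - B) : ℝ) ≤ L * #B) (hR : L * K < #B)
    (hp : 32 * (L * K) ^ 4 * ((L * K) ^ 10 * L ^ 24) * #B ≤ p - 1) (hY0 : 0 ∉ Y)
    (hY : ∀ y ∈ Y, ∃ z, (#B : ℝ) ≤ K * #{b ∈ B | y * b + z ∈ B}) :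
    (#Y : ℝ) ≤ 128 * (L * K) ^ 16 * L ^ 24 := by
  set R := L * K with hRdef
  have hR1 : 1 ≤ R := one_le_mul_of_one_le_of_one_le hL hK
  have hBne : B.Nonempty := by
    rw [nonempty_iff_ne_empty]; rintro rfl
    simp at hR; linarith
  have hBpos : (0 : ℝ) < #B := by exact_mod_cast hBne.card_pos
  set Δ : ℝ := R ^ 10 * L ^ 24 with hΔ
  have hΔ1 : 1 ≤ Δ := one_le_mul_of_one_le_of_one_le (one_le_pow₀ hR1) (one_le_pow₀ hL)
  have hcov : ∀ y ∈ Y, IsCovered B R 1 (B.image (y * ·)) := by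
    intro y hy
    obtain ⟨z, hz⟩ := hY y hy
    exact IsCovered.dilate_of_agreement (by linarith) hB hBne (ne_of_mem_of_not_mem hy hY0) hz
  obtain ⟨d₁, h₁, d₂, h₂, hne, hc⟩ := exists_popular_difference hR1 hcov Subset.rfl hR
  set d₀ := d₁ - d₂ with hd
  have hd₀ : d₀ ≠ 0 := sub_ne_zero.2 hne
  set Y₁ : Finset (ZMod p) := {y ∈ Y | y * d₀ ∈ iterDiff B 2} with hY₁
  have hY₁d : ∀ y ∈ Y₁, y * d₀ ∈ iterDiff B 2 := fun y hy => (mem_filter.1 hy).2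
  have hY₁c : ∀ y ∈ Y₁, IsCovered B R 1 (B.image (y * ·)) :=
    fun y hy => hcov y (mem_filter.1 hy).1
  suffices h : (#Y₁ : ℝ) ≤ 32 * R ^ 4 * Δ by
    calc (#Y : ℝ) ≤ 4 * R ^ 2 * (32 * R ^ 4 * Δ) := hc.trans (by gcongr)
      _ = _ := by rw [hΔ]; ring
  rcases le_or_gt (#Y₁ : ℝ) (4 * R ^ 3 * Δ) with hs | hlarge
  · refine hs.trans ?_
    gcongr <;> norm_num
  have hYpos : (0 : ℝ) < #Y₁ := lt_of_le_of_lt (by positivity) hlarge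
  have hp1 : 1 ≤ p := (Fact.out : p.Prime).one_le
  have hpc : ((p - 1 : ℕ) : ℝ) = p - 1 := by push_cast [hp1]; ring
  have hppos : (0 : ℝ) < p - 1 := lt_of_lt_of_le (by positivity) hp
  have hlow : ∀ q ∈ univ.erase (0 : ZMod p), (#B * #Y₁ ^ 2 / (16 * R ^ 4 * Δ) : ℝ) ≤
      #{w ∈ (B ×ˢ Y₁) ×ˢ (B ×ˢ Y₁) | w.1.1 + q * d₀ * w.1.2 = w.2.1 + q * d₀ * w.2.2} := by
    intro q hq
    have hq0 : q ≠ 0 := (mem_erase.1 hq).1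
    obtain ⟨Y', hY', hcard, hsum⟩ :=
      exists_small_sum hR1 hL hBne hB hY₁c hd₀ hY₁d hΔ hlarge hq0
    have h1 := card_sq_le_card_mul_collisions (B ×ˢ Y') (B + Y'.image (q * d₀ * ·))
      (fun w => w.1 + q * d₀ * w.2) fun w hw => add_mem_add (mem_product.1 hw).1
        (mem_image_of_mem _ (mem_product.1 hw).2)
    have h2 : #{w ∈ (B ×ˢ Y') ×ˢ (B ×ˢ Y') | w.1.1 + q * d₀ * w.1.2 = w.2.1 + q * d₀ * w.2.2} ≤
        #{w ∈ (B ×ˢ Y₁) ×ˢ (B ×ˢ Y₁) | w.1.1 + q * d₀ * w.1.2 = w.2.1 + q * d₀ * w.2.2} := by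
      gcongr
    have h3 : ((#B * #Y') ^ 2 : ℝ) ≤ Δ * #B *
        #{w ∈ (B ×ˢ Y₁) ×ˢ (B ×ˢ Y₁) | w.1.1 + q * d₀ * w.1.2 = w.2.1 + q * d₀ * w.2.2} := by
      rw [card_product] at h1
      calc ((#B * #Y') ^ 2 : ℝ) ≤ #(B + Y'.image (q * d₀ * ·)) * #{w ∈ (B ×ˢ Y') ×ˢ (B ×ˢ Y') |
            w.1.1 + q * d₀ * w.1.2 = w.2.1 + q * d₀ * w.2.2} := by exact_mod_cast h1
        _ ≤ _ := by gcongr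
    have h4 : (#Y₁ : ℝ) ^ 2 ≤ 16 * R ^ 4 * #Y' ^ 2 := by
      calc (#Y₁ : ℝ) ^ 2 ≤ (4 * R ^ 2 * #Y') ^ 2 := by gcongr
        _ = _ := by ring
    rw [div_le_iff₀ (by positivity)]
    refine le_of_mul_le_mul_left ?_ hBpos
    calc (#B : ℝ) * (#B * #Y₁ ^ 2) ≤ #B * (#B * (16 * R ^ 4 * #Y' ^ 2)) := by gcongr
      _ = 16 * R ^ 4 * (#B * #Y') ^ 2 := by ring
      _ ≤ 16 * R ^ 4 * (Δ * #B * #{w ∈ (B ×ˢ Y₁) ×ˢ (B ×ˢ Y₁) |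
          w.1.1 + q * d₀ * w.1.2 = w.2.1 + q * d₀ * w.2.2}) := by gcongr
      _ = _ := by ring
  have hup := sum_dilate_collisions_le (B := B) (Y := Y₁) hd₀
  have hup' : (∑ q ∈ univ.erase (0 : ZMod p), (#{w ∈ (B ×ˢ Y₁) ×ˢ (B ×ˢ Y₁) |
        w.1.1 + q * d₀ * w.1.2 = w.2.1 + q * d₀ * w.2.2} : ℝ)) ≤
      (p - 1) * (#B * #Y₁) + (#B * #Y₁) ^ 2 := by
    rw [← hpc]; exact_mod_cast hup
  have htot := (sum_le_sum hlow).trans hup'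
  rw [sum_const, card_erase_of_mem (mem_univ _), card_univ, ZMod.card, nsmul_eq_mul, hpc] at htot
  set T : ℝ := #B * #Y₁ / (32 * R ^ 4 * Δ) with hT
  have h5 : (#B * #Y₁ ^ 2 / (16 * R ^ 4 * Δ) : ℝ) = 2 * #Y₁ * T := by rw [hT]; field_simp; ring
  have h6 : ((#B * #Y₁) ^ 2 : ℝ) ≤ (p - 1) * (#Y₁ * T) := by
    calc ((#B * #Y₁) ^ 2 : ℝ) = 32 * R ^ 4 * Δ * #B * (#Y₁ * T) := by rw [hT]; field_simp
      _ ≤ _ := by gcongr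
  have h7 : (p - 1) * (#Y₁ * T) ≤ (p - 1) * (#B * #Y₁ : ℝ) := by
    rw [h5] at htot; linarith
  have h8 : (#Y₁ : ℝ) * T ≤ #B * #Y₁ := le_of_mul_le_mul_left h7 hppos
  rw [hT, mul_div_assoc', div_le_iff₀ (by positivity)] at h8
  have h9 : (#B * #Y₁ : ℝ) * #Y₁ ≤ (#B * #Y₁) * (32 * R ^ 4 * Δ) := by linarith
  exact le_of_mul_le_mul_left h9 (by positivity)

end SumProduct

section BalogSzemerediGowers

open Finset

variable {G : Type*} [AddCommGroup G] [DecidableEq G]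

/-- The representations of `d` as a difference of two elements of `A`. -/
def diffReps (A : Finset G) (d : G) : Finset (G × G) := {w ∈ A ×ˢ A | w.1 - w.2 = d}

lemma mem_diffReps {A : Finset G} {d : G} {w : G × G} :
    w ∈ diffReps A d ↔ (w.1 ∈ A ∧ w.2 ∈ A) ∧ w.1 - w.2 = d := by
  simp [diffReps]

lemma sum_card_diffReps (A : Finset G) : ∑ d ∈ A - A, #(diffReps A d) = #A ^ 2 := by
  rw [sq, ← card_product]
  refine (card_eq_sum_card_fiberwise (f := fun w : G × G => w.1 - w.2) fun w hw => ?_).symm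
  have hw := mem_product.1 (mem_coe.1 hw)
  exact sub_mem_sub hw.1 hw.2

lemma sum_sq_card_diffReps (A : Finset G) :
    ∑ d ∈ A - A, #(diffReps A d) ^ 2 = _root_.addEnergy A A := by
  have h : _root_.addEnergy A A =
      #{q ∈ (A ×ˢ A) ×ˢ A ×ˢ A | q.1.1 - q.1.2 = q.2.2 - q.2.1} := by
    unfold _root_.addEnergy
    congr 1
    refine filter_congr fun q _ => ?_
    constructor <;> intro h
    · rw [sub_eq_sub_iff_add_eq_add, h, add_comm]
    · rw [sub_eq_sub_iff_add_eq_add] at h; rw [h, add_comm]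
  rw [h, card_eq_sum_card_fiberwise (f := fun q => q.1.1 - q.1.2) (t := A - A)]
  · refine sum_congr rfl fun d _ => ?_
    rw [sq, ← card_product]
    refine card_bij (fun q _ => (q.1, q.2.swap)) ?_ ?_ ?_
    · rintro ⟨u, v⟩ hq
      simp only [mem_product, mem_diffReps, mem_filter, Prod.fst_swap, Prod.snd_swap] at hq ⊢
      grind
    · rintro ⟨u, v⟩ _ ⟨u', v'⟩ _ h
      simpa using h
    · rintro ⟨u, v⟩ hq
      refine ⟨(u, v.swap), ?_, by simp⟩
      simp only [mem_product, mem_diffReps, mem_filter, Prod.fst_swap, Prod.snd_swap] at hq ⊢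
      grind
  · intro q hq
    have hq := mem_product.1 (mem_filter.1 (mem_coe.1 hq)).1
    have := mem_product.1 hq.1
    exact sub_mem_sub this.1 this.2

/-- The fibre `A ∩ (A + s)`. -/
def shiftInter (A : Finset G) (s : G) : Finset G := {a ∈ A | a - s ∈ A}

lemma card_shiftInter (A : Finset G) (s : G) : #(shiftInter A s) = #(diffReps A s) := by
  refine card_bij (fun a _ => (a, a - s)) ?_ ?_ ?_
  · intro a ha
    have ha := mem_filter.1 ha
    exact mem_diffReps.2 ⟨ha, by simp⟩
  · intro a _ a' _ h
    exact (Prod.ext_iff.1 h).1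
  · intro w hw
    rw [mem_diffReps] at hw
    have h2 : w.1 - s = w.2 := by rw [← hw.2]; abel
    exact ⟨w.1, mem_filter.2 ⟨hw.1.1, by rw [h2]; exact hw.1.2⟩, Prod.ext rfl h2⟩

/-- Pairs in `X` whose difference has fewer than `τ` representations in `A - A`. -/
noncomputable def unpopularPairs (A X : Finset G) (τ : ℝ) : Finset (G × G) :=
  {w ∈ X ×ˢ X | (#(diffReps A (w.1 - w.2)) : ℝ) < τ}

lemma sum_card_unpopularPairs_le (A : Finset G) {τ : ℝ} (hτ : 0 ≤ τ) :
    (∑ s ∈ A - A, #(unpopularPairs A (shiftInter A s) τ) : ℝ) ≤ #A ^ 2 * τ := by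
  have h1 : ∀ s, #(unpopularPairs A (shiftInter A s) τ) =
      ∑ w ∈ unpopularPairs A A τ, if w.1 - s ∈ A ∧ w.2 - s ∈ A then 1 else 0 := by
    intro s
    rw [← card_filter]
    congr 1
    ext w
    simp only [unpopularPairs, shiftInter, mem_filter, mem_product]
    tauto
  have h2 : ∀ w ∈ unpopularPairs A A τ,
      (∑ s ∈ A - A, if w.1 - s ∈ A ∧ w.2 - s ∈ A then 1 else 0 : ℕ) ≤
        #(diffReps A (w.1 - w.2)) := by
    intro w _
    rw [← card_filter]
    refine card_le_card_of_injOn (fun s => (w.1 - s, w.2 - s)) ?_ ?_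
    · intro s hs
      have hs := (mem_filter.1 (mem_coe.1 hs)).2
      exact mem_coe.2 (mem_diffReps.2 ⟨hs, by simp⟩)
    · intro s _ s' _ h
      simpa using (Prod.ext_iff.1 h).1
  have h3 : (∑ s ∈ A - A, #(unpopularPairs A (shiftInter A s) τ) : ℝ) ≤
      ∑ w ∈ unpopularPairs A A τ, (#(diffReps A (w.1 - w.2)) : ℝ) := by
    have : ∑ s ∈ A - A, #(unpopularPairs A (shiftInter A s) τ) ≤
        ∑ w ∈ unpopularPairs A A τ, #(diffReps A (w.1 - w.2)) := by
      simp only [h1]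
      rw [sum_comm]
      exact sum_le_sum h2
    exact_mod_cast this
  refine h3.trans ?_
  calc ∑ w ∈ unpopularPairs A A τ, (#(diffReps A (w.1 - w.2)) : ℝ)
      ≤ ∑ w ∈ unpopularPairs A A τ, τ :=
        sum_le_sum fun w hw => (mem_filter.1 hw).2.le
    _ = #(unpopularPairs A A τ) * τ := by rw [sum_const, nsmul_eq_mul]
    _ ≤ #A ^ 2 * τ := by
        gcongr
        rw [sq, ← Nat.cast_mul, ← card_product]
        exact_mod_cast card_filter_le _ _

lemma card_sub_mul_le {A X' : Finset G} {t τ : ℝ} (hτ : 0 ≤ τ)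
    (h : ∀ a ∈ X', ∀ a' ∈ X', ∃ M : Finset G, t ≤ #M ∧
      ∀ b ∈ M, τ ≤ #(diffReps A (a - b)) ∧ τ ≤ #(diffReps A (a' - b))) :
    #(X' - X') * (t * τ ^ 2) ≤ (#A : ℝ) ^ 4 := by
  set Q := (A ×ˢ A) ×ˢ (A ×ˢ A) with hQ
  have h1 : ∑ d ∈ X' - X', #{q ∈ Q | (q.1.1 - q.1.2) - (q.2.1 - q.2.2) = d} ≤ #Q := by
    rw [sum_card_fiberwise_eq_card_filter]; exact card_filter_le _ _
  have h2 : ∀ d ∈ X' - X', t * τ ^ 2 ≤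
      #{q ∈ Q | (q.1.1 - q.1.2) - (q.2.1 - q.2.2) = d} := by
    intro d hd
    obtain ⟨a, ha, a', ha', rfl⟩ := mem_sub.1 hd
    obtain ⟨M, hM, hb⟩ := h a ha a' ha'
    have h3 : ∑ b ∈ M, #{q ∈ {q ∈ Q | (q.1.1 - q.1.2) - (q.2.1 - q.2.2) = a - a'} |
        a - (q.1.1 - q.1.2) = b} ≤ #{q ∈ Q | (q.1.1 - q.1.2) - (q.2.1 - q.2.2) = a - a'} := by
      rw [sum_card_fiberwise_eq_card_filter]; exact card_filter_le _ _
    have h4 : ∀ b ∈ M, τ ^ 2 ≤ (#{q ∈ {q ∈ Q | (q.1.1 - q.1.2) - (q.2.1 - q.2.2) = a - a'} |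
        a - (q.1.1 - q.1.2) = b} : ℝ) := by
      intro b hbM
      have h5 : diffReps A (a - b) ×ˢ diffReps A (a' - b) ⊆
          {q ∈ {q ∈ Q | (q.1.1 - q.1.2) - (q.2.1 - q.2.2) = a - a'} |
            a - (q.1.1 - q.1.2) = b} := by
        intro q hq
        obtain ⟨hq1, hq2⟩ := mem_product.1 hq
        rw [mem_diffReps] at hq1 hq2
        simp only [mem_filter, hQ, mem_product]
        refine ⟨⟨⟨hq1.1, hq2.1⟩, ?_⟩, ?_⟩
        · rw [hq1.2, hq2.2]; abel
        · rw [hq1.2]; abel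
      calc τ ^ 2 = τ * τ := sq τ
        _ ≤ #(diffReps A (a - b)) * #(diffReps A (a' - b)) := by
            gcongr
            · exact (hb b hbM).1
            · exact (hb b hbM).2
        _ ≤ _ := by rw [← Nat.cast_mul, ← card_product]; exact_mod_cast card_le_card h5
    calc t * τ ^ 2 ≤ #M * τ ^ 2 := by gcongr
      _ = ∑ b ∈ M, τ ^ 2 := by rw [sum_const, nsmul_eq_mul]
      _ ≤ _ := sum_le_sum h4
      _ ≤ _ := by exact_mod_cast h3
  calc #(X' - X') * (t * τ ^ 2) = ∑ d ∈ X' - X', t * τ ^ 2 := by rw [sum_const, nsmul_eq_mul]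
    _ ≤ _ := sum_le_sum h2
    _ ≤ #Q := by exact_mod_cast h1
    _ = _ := by rw [hQ]; simp only [card_product]; push_cast; ring

lemma exists_popular_shiftInter {A : Finset G} {K : ℝ} (hK : 1 ≤ K)
    (hA : A.Nonempty) (hE : (#A : ℝ) ^ 3 ≤ K * _root_.addEnergy A A) :
    ∃ X ⊆ A, (#A : ℝ) ≤ 2 * K * #X ∧
      16 * (#(unpopularPairs A X (#A / (32 * K))) : ℝ) ≤ #X ^ 2 := by
  have hApos : (0 : ℝ) < #A := by exact_mod_cast hA.card_pos
  set τ : ℝ := #A / (32 * K) with hτ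
  have hbad := sum_card_unpopularPairs_le A (τ := τ) (by positivity)
  have hsq : (∑ s ∈ A - A, (#(shiftInter A s) : ℝ) ^ 2) = _root_.addEnergy A A := by
    rw [← sum_sq_card_diffReps]; push_cast; simp only [card_shiftInter]
  have hlin : (∑ s ∈ A - A, (#(shiftInter A s) : ℝ)) = #A ^ 2 := by
    have := sum_card_diffReps A
    simp only [card_shiftInter]; exact_mod_cast this
  obtain ⟨s, hs, h⟩ : ∃ s ∈ A - A, #A / (2 * K) * (#(shiftInter A s) : ℝ) ≤
      #(shiftInter A s) ^ 2 - 16 * #(unpopularPairs A (shiftInter A s) τ) := by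
    refine exists_le_of_sum_le (by obtain ⟨a, ha⟩ := hA; exact ⟨a - a, sub_mem_sub ha ha⟩) ?_
    rw [← mul_sum, sum_sub_distrib, ← mul_sum, hsq, hlin]
    have h1 : (#A : ℝ) ^ 3 / K ≤ _root_.addEnergy A A := by
      rw [div_le_iff₀ (by linarith)]; linarith
    have h2 : (#A : ℝ) / (2 * K) * #A ^ 2 = #A ^ 3 / K - 16 * (#A ^ 2 * τ) := by
      rw [hτ]; field_simp; ring
    rw [h2]
    linarith
  have hXne : (0 : ℝ) < #(shiftInter A s) := by
    obtain ⟨a, ha, b, hb, rfl⟩ := mem_sub.1 hs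
    exact_mod_cast card_pos.2 ⟨a, mem_filter.2 ⟨ha, by simpa using hb⟩⟩
  refine ⟨shiftInter A s, filter_subset _ _, ?_, ?_⟩
  · have h1 : #A / (2 * K) * (#(shiftInter A s) : ℝ) ≤ #(shiftInter A s) * #(shiftInter A s) := by
      rw [← sq]; exact h.trans (sub_le_self _ (by positivity))
    have h2 := le_of_mul_le_mul_right h1 hXne
    rw [div_le_iff₀ (by linarith)] at h2
    linarith
  · have : 0 ≤ #A / (2 * K) * (#(shiftInter A s) : ℝ) := by positivity
    linarith

/-- A Balog–Szemerédi–Gowers theorem. -/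
theorem exists_small_doubling_subset {A : Finset G} {K : ℝ} (hK : 1 ≤ K) (hA : A.Nonempty)
    (hE : (#A : ℝ) ^ 3 ≤ K * _root_.addEnergy A A) :
    ∃ X ⊆ A, (#A : ℝ) ≤ 4 * K * #X ∧ (#(X - X) : ℝ) ≤ 2 ^ 14 * K ^ 4 * #X := by
  obtain ⟨X, hXA, hX, hbad⟩ := exists_popular_shiftInter hK hA hE
  have hApos : (0 : ℝ) < #A := by exact_mod_cast hA.card_pos
  have hXpos : (0 : ℝ) < #X := by
    by_contra! hcon
    have := mul_nonpos_of_nonneg_of_nonpos (show 0 ≤ 2 * K by linarith) hcon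
    linarith
  set τ : ℝ := #A / (32 * K) with hτ
  set N : G → Finset G := fun a => {b ∈ X | (#(diffReps A (a - b)) : ℝ) < τ} with hN
  set X' : Finset G := {a ∈ X | (4 * #(N a) : ℝ) ≤ #X} with hX'
  have hsum : #(unpopularPairs A X τ) = ∑ a ∈ X, #(N a) := by
    rw [unpopularPairs, card_filter, sum_product]
    simp only [hN, card_filter]
  have hX'card : (#X : ℝ) ≤ 2 * #X' := by
    have h1 : (#(X \ X') : ℝ) * (#X / 4) ≤ ∑ a ∈ X, (#(N a) : ℝ) := by
      calc (#(X \ X') : ℝ) * (#X / 4) = ∑ a ∈ X \ X', (#X / 4 : ℝ) := by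
            rw [sum_const, nsmul_eq_mul]
        _ ≤ ∑ a ∈ X \ X', (#(N a) : ℝ) := by
            refine sum_le_sum fun a ha => ?_
            obtain ⟨ha, ha'⟩ := mem_sdiff.1 ha
            have : ¬ (4 * #(N a) : ℝ) ≤ #X := fun h => ha' (mem_filter.2 ⟨ha, h⟩)
            linarith
        _ ≤ _ := sum_le_sum_of_subset_of_nonneg sdiff_subset fun _ _ _ => by positivity
    rw [hsum] at hbad
    push_cast at hbad
    have h2 : (4 * #(X \ X') : ℝ) * #X ≤ #X * #X := by nlinarith
    have h3 := le_of_mul_le_mul_right h2 hXpos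
    have h4 : (#(X \ X') : ℝ) = #X - #X' := by
      rw [card_sdiff_of_subset (filter_subset _ _), Nat.cast_sub (card_filter_le _ _)]
    rw [h4] at h3
    linarith
  refine ⟨X', (filter_subset _ _).trans hXA, ?_, ?_⟩
  · calc (#A : ℝ) ≤ 2 * K * #X := hX
      _ ≤ 2 * K * (2 * #X') := by gcongr
      _ = _ := by ring
  have hcount := card_sub_mul_le (A := A) (X' := X') (t := #X / 2) (τ := τ) (by positivity) ?_
  · have h1 : (#(X' - X') : ℝ) * (#X / 2 * τ ^ 2) =
        #(X' - X') * #X / (2048 * K ^ 2) * #A ^ 2 := by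
      rw [hτ]; field_simp; ring
    rw [h1, show (#A : ℝ) ^ 4 = #A ^ 2 * #A ^ 2 by ring] at hcount
    have h2 := le_of_mul_le_mul_right hcount (by positivity)
    rw [div_le_iff₀ (by positivity)] at h2
    have h3 : (#A : ℝ) ^ 2 ≤ (2 * K * #X) * (2 * K * (2 * #X')) := by
      rw [sq]
      gcongr
      exact hX.trans (by gcongr)
    refine le_of_mul_le_mul_right (h2.trans ?_) hXpos
    calc (#A : ℝ) ^ 2 * (2048 * K ^ 2)
        ≤ ((2 * K * #X) * (2 * K * (2 * #X'))) * (2048 * K ^ 2) := by gcongr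
      _ = _ := by ring
  · intro a ha a' ha'
    refine ⟨X \ (N a ∪ N a'), ?_, ?_⟩
    · have h1 : (#(N a ∪ N a') : ℝ) ≤ #(N a) + #(N a') := by exact_mod_cast card_union_le _ _
      have h2 : (#X : ℝ) ≤ #(X \ (N a ∪ N a')) + #(N a ∪ N a') := by
        have := le_card_sdiff (N a ∪ N a') X
        exact_mod_cast (by omega : #X ≤ #(X \ (N a ∪ N a')) + #(N a ∪ N a'))
      have h3 := (mem_filter.1 ha).2
      have h4 := (mem_filter.1 ha').2
      linarith
    · intro b hb
      obtain ⟨hbX, hb⟩ := mem_sdiff.1 hb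
      simp only [hN, mem_union, mem_filter, hbX, true_and, not_or, not_lt] at hb
      exact hb

end BalogSzemerediGowers

section CharacterSums

open Finset ZMod
open scoped ComplexConjugate

lemma norm_sum_sq_le {ι : Type*} (s : Finset ι) (f : ι → ℂ) :
    ‖∑ i ∈ s, f i‖ ^ 2 ≤ #s * ∑ i ∈ s, ‖f i‖ ^ 2 := by
  calc ‖∑ i ∈ s, f i‖ ^ 2 ≤ (∑ i ∈ s, ‖f i‖) ^ 2 := by gcongr; exact norm_sum_le _ _
    _ ≤ _ := sq_sum_le_card_mul_sum_sq

lemma ofReal_norm_sum_sq {κ : Type*} (t : Finset κ) (f : κ → ℂ) :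
    ((‖∑ k ∈ t, f k‖ ^ 2 : ℝ) : ℂ) = ∑ k ∈ t, ∑ k' ∈ t, f k * conj (f k') := by
  push_cast
  rw [← Complex.mul_conj', map_sum, sum_mul_sum]

/-- Cauchy–Schwarz in the outer variable, after expanding the square in the inner one. -/
lemma norm_sum_sum_sq_le {ι κ : Type*} (s : Finset ι) (t : Finset κ) (F : ι → κ → ℂ) :
    ‖∑ i ∈ s, ∑ k ∈ t, F i k‖ ^ 2 ≤
      #s * ∑ k ∈ t, ∑ k' ∈ t, ‖∑ i ∈ s, F i k * conj (F i k')‖ := by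
  refine (norm_sum_sq_le _ _).trans ?_
  gcongr
  have h : ((∑ i ∈ s, ‖∑ k ∈ t, F i k‖ ^ 2 : ℝ) : ℂ) =
      ∑ k ∈ t, ∑ k' ∈ t, ∑ i ∈ s, F i k * conj (F i k') := by
    rw [Complex.ofReal_sum]
    simp only [ofReal_norm_sum_sq]
    rw [sum_comm]
    exact sum_congr rfl fun k _ => sum_comm
  calc ∑ i ∈ s, ‖∑ k ∈ t, F i k‖ ^ 2 ≤ ‖((∑ i ∈ s, ‖∑ k ∈ t, F i k‖ ^ 2 : ℝ) : ℂ)‖ := by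
        rw [Complex.norm_real]; exact le_abs_self _
    _ ≤ _ := by
        rw [h]
        exact (norm_sum_le _ _).trans (sum_le_sum fun k _ => norm_sum_le _ _)

variable {p : ℕ} [Fact p.Prime]

lemma stdAddChar_mul_conj (s t : ZMod p) :
    stdAddChar s * conj (stdAddChar t : ℂ) = stdAddChar (s - t) := by
  rw [← AddChar.map_neg_eq_conj, ← AddChar.map_add_eq_mul, sub_eq_add_neg]

/-- Parseval for an exponential sum with arbitrary frequencies. -/
lemma sum_norm_sq_sum_stdAddChar {ι : Type*} (Q : Finset ι) (φ : ι → ZMod p) :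
    ∑ u : ZMod p, ‖∑ q ∈ Q, (stdAddChar (u * φ q) : ℂ)‖ ^ 2 =
      p * #{w ∈ Q ×ˢ Q | φ w.1 = φ w.2} := by
  rw [← Complex.ofReal_inj, Complex.ofReal_sum]
  simp only [ofReal_norm_sum_sq, stdAddChar_mul_conj, ← mul_sub]
  rw [sum_comm]
  have h : ∀ k ∈ Q, (∑ u : ZMod p, ∑ k' ∈ Q, (stdAddChar (u * (φ k - φ k')) : ℂ)) =
      ∑ k' ∈ Q, if φ k = φ k' then (p : ℂ) else 0 := by
    intro k _
    rw [sum_comm]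
    refine sum_congr rfl fun k' _ => ?_
    rw [AddChar.sum_mulShift _ (isPrimitive_stdAddChar p)]
    simp only [sub_eq_zero, ZMod.card]
    split_ifs <;> simp
  rw [sum_congr rfl h, ← sum_product', ← sum_filter, sum_const, nsmul_eq_mul]
  push_cast
  ring

lemma card_diff_collisions (B : Finset (ZMod p)) :
    #{w ∈ (B ×ˢ B) ×ˢ (B ×ˢ B) | w.1.1 - w.1.2 = w.2.1 - w.2.2} =
      _root_.addEnergy B B := by
  rw [← sum_sq_card_diffReps,
    card_eq_sum_card_fiberwise (f := fun w => w.1.1 - w.1.2) (t := B - B)]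
  · refine sum_congr rfl fun d _ => ?_
    rw [sq, ← card_product]
    congr 1
    ext w
    simp only [mem_filter, mem_product, mem_diffReps]
    grind
  · intro w hw
    have hw := (mem_product.1 (mem_product.1 (mem_filter.1 (mem_coe.1 hw)).1).1)
    exact sub_mem_sub hw.1 hw.2

lemma sum_norm_diff_sums_sq_le (B₁ B₂ : Finset (ZMod p)) {c : ZMod p} (hc : c ≠ 0) :
    (∑ b₂ ∈ B₂, ∑ b₂' ∈ B₂, ‖∑ b₁ ∈ B₁, (stdAddChar (c * b₁ * (b₂ - b₂')) : ℂ)‖ ^ 2) ^ 2 ≤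
      p * _root_.addEnergy B₁ B₁ * _root_.addEnergy B₂ B₂ := by
  set H : ZMod p → ℂ := fun u => ∑ q ∈ B₁ ×ˢ B₁, stdAddChar (u * (c * (q.1 - q.2))) with hH
  have h1 : ∀ b₂ b₂' : ZMod p, ‖∑ b₁ ∈ B₁, (stdAddChar (c * b₁ * (b₂ - b₂')) : ℂ)‖ ^ 2 ≤
      ‖H (b₂ - b₂')‖ := by
    intro b₂ b₂'
    have : ((‖∑ b₁ ∈ B₁, (stdAddChar (c * b₁ * (b₂ - b₂')) : ℂ)‖ ^ 2 : ℝ) : ℂ) =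
        H (b₂ - b₂') := by
      rw [ofReal_norm_sum_sq, hH]
      simp only [stdAddChar_mul_conj]
      rw [sum_product]
      refine sum_congr rfl fun a _ => sum_congr rfl fun b _ => ?_
      congr 1; ring
    rw [← this, Complex.norm_real]
    exact le_abs_self _
  have h2 : ∑ b₂ ∈ B₂, ∑ b₂' ∈ B₂, ‖∑ b₁ ∈ B₁, (stdAddChar (c * b₁ * (b₂ - b₂')) : ℂ)‖ ^ 2 ≤
      ∑ d ∈ B₂ - B₂, #(diffReps B₂ d) * ‖H d‖ := by
    refine (sum_le_sum fun b₂ _ => sum_le_sum fun b₂' _ => h1 b₂ b₂').trans_eq ?_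
    rw [← sum_product' (f := fun b₂ b₂' => ‖H (b₂ - b₂')‖),
      ← sum_fiberwise_of_maps_to (g := fun w : ZMod p × ZMod p => w.1 - w.2) (t := B₂ - B₂)]
    · refine sum_congr rfl fun d _ => ?_
      rw [diffReps, ← nsmul_eq_mul, ← sum_const]
      exact sum_congr rfl fun w hw => by rw [(mem_filter.1 hw).2]
    · intro w hw
      exact sub_mem_sub (mem_product.1 hw).1 (mem_product.1 hw).2
  have h3 : ∑ u : ZMod p, ‖H u‖ ^ 2 = p * _root_.addEnergy B₁ B₁ := by
    rw [hH, sum_norm_sq_sum_stdAddChar, ← card_diff_collisions]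
    congr 3
    refine filter_congr fun w _ => ?_
    exact ⟨fun h => mul_left_cancel₀ hc h, fun h => by rw [h]⟩
  have h4 : ∑ d ∈ B₂ - B₂, (#(diffReps B₂ d) : ℝ) ^ 2 = _root_.addEnergy B₂ B₂ := by
    exact_mod_cast sum_sq_card_diffReps B₂
  calc _ ≤ (∑ d ∈ B₂ - B₂, #(diffReps B₂ d) * ‖H d‖) ^ 2 :=
        pow_le_pow_left₀ (sum_nonneg fun _ _ => sum_nonneg fun _ _ => sq_nonneg _) h2 2
    _ ≤ (∑ d ∈ B₂ - B₂, (#(diffReps B₂ d) : ℝ) ^ 2) * ∑ d ∈ B₂ - B₂, ‖H d‖ ^ 2 :=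
        sum_mul_sq_le_sq_mul_sq _ _ _
    _ ≤ (_root_.addEnergy B₂ B₂ : ℝ) * (p * _root_.addEnergy B₁ B₁) := by
        rw [h4]
        refine mul_le_mul_of_nonneg_left ?_ (Nat.cast_nonneg _)
        rw [← h3]
        exact sum_le_sum_of_subset_of_nonneg (subset_univ _) fun _ _ _ => by positivity
    _ = _ := by ring

/-- The quadratic exponential sum over `B₁ × B₂` is controlled by the additive energies. -/
theorem norm_sum_stdAddChar_sq_le (h2 : (2 : ZMod p) ≠ 0) (B₁ B₂ : Finset (ZMod p)) {c : ZMod p}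
    (hc : c ≠ 0) :
    ‖∑ b₁ ∈ B₁, ∑ b₂ ∈ B₂, (stdAddChar (c * (b₁ - b₂) ^ 2) : ℂ)‖ ^ 8 ≤
      p * #B₁ ^ 4 * #B₂ ^ 4 * _root_.addEnergy B₁ B₁ * _root_.addEnergy B₂ B₂ := by
  have hc2 : -2 * c ≠ 0 := mul_ne_zero (neg_ne_zero.2 h2) hc
  set S := ∑ b₁ ∈ B₁, ∑ b₂ ∈ B₂, (stdAddChar (c * (b₁ - b₂) ^ 2) : ℂ) with hS
  set T := ∑ b₂ ∈ B₂, ∑ b₂' ∈ B₂,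
    ‖∑ b₁ ∈ B₁, (stdAddChar (-2 * c * b₁ * (b₂ - b₂')) : ℂ)‖ with hT
  have hT0 : 0 ≤ T := sum_nonneg fun _ _ => sum_nonneg fun _ _ => norm_nonneg _
  have h1 : ‖S‖ ^ 2 ≤ #B₁ * T := by
    refine (norm_sum_sum_sq_le _ _ _).trans_eq ?_
    congr 1
    refine sum_congr rfl fun b _ => sum_congr rfl fun b' _ => ?_
    simp only [stdAddChar_mul_conj]
    have : ∀ a : ZMod p, (stdAddChar (c * (a - b) ^ 2 - c * (a - b') ^ 2) : ℂ) =
        stdAddChar (c * (b ^ 2 - b' ^ 2)) * stdAddChar (-2 * c * a * (b - b')) := by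
      intro a
      rw [← AddChar.map_add_eq_mul]; congr 1; ring
    simp only [this]
    rw [← mul_sum, norm_mul, AddChar.norm_apply, one_mul]
  have h3 : T ^ 2 ≤ #B₂ ^ 2 * ∑ b₂ ∈ B₂, ∑ b₂' ∈ B₂,
      ‖∑ b₁ ∈ B₁, (stdAddChar (-2 * c * b₁ * (b₂ - b₂')) : ℂ)‖ ^ 2 := by
    rw [hT, ← sum_product', ← sum_product', sq (#B₂ : ℝ), ← Nat.cast_mul, ← card_product]
    exact sq_sum_le_card_mul_sum_sq
  calc ‖S‖ ^ 8 = (‖S‖ ^ 2) ^ 4 := by ring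
    _ ≤ (#B₁ * T) ^ 4 := by gcongr
    _ = #B₁ ^ 4 * (T ^ 2) ^ 2 := by ring
    _ ≤ #B₁ ^ 4 * (#B₂ ^ 2 * _) ^ 2 := by gcongr
    _ = #B₁ ^ 4 * #B₂ ^ 4 * (∑ b₂ ∈ B₂, ∑ b₂' ∈ B₂,
      ‖∑ b₁ ∈ B₁, (stdAddChar (-2 * c * b₁ * (b₂ - b₂')) : ℂ)‖ ^ 2) ^ 2 := by ring
    _ ≤ #B₁ ^ 4 * #B₂ ^ 4 * (p * _root_.addEnergy B₁ B₁ * _root_.addEnergy B₂ B₂) := by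
        gcongr
        exact sum_norm_diff_sums_sq_le B₁ B₂ hc2
    _ = _ := by ring

end CharacterSums

section Dilates

open Finset ZMod
open scoped ComplexConjugate

variable {p : ℕ} [Fact p.Prime]

/-- The energy of the dilates `c • B` and `c' • B`. -/
def dilateEnergy (B : Finset (ZMod p)) (c c' : ZMod p) : ℕ :=
  #{w ∈ (B ×ˢ B) ×ˢ (B ×ˢ B) | c * w.1.1 - c' * w.1.2 = c * w.2.1 - c' * w.2.2}

lemma sum_norm_dilates_pow_four_le {ι : Type*} (V B : Finset (ZMod p)) (T : Finset ι)
    (C : ι → ZMod p) {θ : ZMod p} (hθ : θ ≠ 0) :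
    (∑ v ∈ V, ∑ t ∈ T, ‖∑ b ∈ B, (stdAddChar (θ * v * (C t * b)) : ℂ)‖) ^ 4 ≤
      #V ^ 3 * #T ^ 2 * p * ∑ t ∈ T, ∑ t' ∈ T, (dilateEnergy B (C t) (C t') : ℝ) := by
  set g : ι → ZMod p → ℂ := fun t v => ∑ b ∈ B, stdAddChar (θ * v * (C t * b)) with hg
  have h1 : (∑ v ∈ V, ∑ t ∈ T, ‖g t v‖) ^ 2 ≤ #V * #T * ∑ v ∈ V, ∑ t ∈ T, ‖g t v‖ ^ 2 := by
    rw [← sum_product', ← sum_product', ← Nat.cast_mul, ← card_product]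
    exact sq_sum_le_card_mul_sum_sq
  have h2 : (∑ v ∈ V, ∑ t ∈ T, ‖g t v‖ ^ 2) ^ 2 ≤ #V * ∑ v ∈ V, (∑ t ∈ T, ‖g t v‖ ^ 2) ^ 2 :=
    sq_sum_le_card_mul_sum_sq
  have h3 : ∀ t t', ∑ v ∈ V, ‖g t v‖ ^ 2 * ‖g t' v‖ ^ 2 ≤ p * dilateEnergy B (C t) (C t') := by
    intro t t'
    have h4 : ∀ v, ‖g t v‖ ^ 2 * ‖g t' v‖ ^ 2 =
        ‖∑ w ∈ B ×ˢ B, (stdAddChar (v * (θ * (C t * w.1 - C t' * w.2))) : ℂ)‖ ^ 2 := by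
      intro v
      rw [← mul_pow, ← Complex.norm_conj (g t' v), ← norm_mul]
      congr 2
      rw [hg, map_sum, sum_mul_sum, sum_product]
      refine sum_congr rfl fun b _ => sum_congr rfl fun b' _ => ?_
      rw [stdAddChar_mul_conj]
      congr 1; ring
    calc ∑ v ∈ V, ‖g t v‖ ^ 2 * ‖g t' v‖ ^ 2
        ≤ ∑ v : ZMod p, ‖g t v‖ ^ 2 * ‖g t' v‖ ^ 2 :=
          sum_le_sum_of_subset_of_nonneg (subset_univ _) fun _ _ _ => by positivity
      _ = p * dilateEnergy B (C t) (C t') := by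
          simp only [h4]
          rw [sum_norm_sq_sum_stdAddChar, dilateEnergy]
          congr 3
          refine filter_congr fun w _ => ?_
          exact ⟨fun h => mul_left_cancel₀ hθ h, fun h => by rw [h]⟩
  have h5 : ∑ v ∈ V, (∑ t ∈ T, ‖g t v‖ ^ 2) ^ 2 ≤
      p * ∑ t ∈ T, ∑ t' ∈ T, (dilateEnergy B (C t) (C t') : ℝ) := by
    simp only [sq (∑ t ∈ T, ‖g t _‖ ^ 2), sum_mul_sum]
    rw [sum_comm, mul_sum]
    refine sum_le_sum fun t _ => ?_
    rw [sum_comm, mul_sum]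
    exact sum_le_sum fun t' _ => h3 t t'
  calc (∑ v ∈ V, ∑ t ∈ T, ‖g t v‖) ^ 4 = ((∑ v ∈ V, ∑ t ∈ T, ‖g t v‖) ^ 2) ^ 2 := by ring
    _ ≤ (#V * #T * ∑ v ∈ V, ∑ t ∈ T, ‖g t v‖ ^ 2) ^ 2 := pow_le_pow_left₀ (sq_nonneg _) h1 2
    _ = (#V * #T) ^ 2 * (∑ v ∈ V, ∑ t ∈ T, ‖g t v‖ ^ 2) ^ 2 := by ring
    _ ≤ (#V * #T) ^ 2 * (#V * (p * ∑ t ∈ T, ∑ t' ∈ T, (dilateEnergy B (C t) (C t') : ℝ))) :=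
        mul_le_mul_of_nonneg_left (h2.trans (mul_le_mul_of_nonneg_left h5 (Nat.cast_nonneg _)))
          (sq_nonneg _)
    _ = _ := by ring

lemma dilateEnergy_le {B : Finset (ZMod p)} {c c' : ZMod p} (hc : c ≠ 0) {M : ℝ}
    (hM : ∀ z, (#{b ∈ B | c' / c * b + z ∈ B} : ℝ) ≤ M) :
    (dilateEnergy B c c' : ℝ) ≤ #B ^ 2 * M := by
  have h1 : dilateEnergy B c c' ≤ ∑ w ∈ B ×ˢ B,
      #{b ∈ B | c' / c * b + (w.1 - c' / c * w.2) ∈ B} := by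
    rw [dilateEnergy, card_eq_sum_card_fiberwise (f := Prod.fst) (t := B ×ˢ B)]
    · refine sum_le_sum fun w hw => ?_
      refine card_le_card_of_injOn (fun q => q.2.2) ?_ ?_
      · intro q hq
        simp only [coe_filter, mem_filter, mem_product, Set.mem_ofPred_eq] at hq ⊢
        obtain ⟨⟨⟨h1, h2⟩, h3⟩, rfl⟩ := hq
        refine ⟨h2.2, ?_⟩
        convert h2.1 using 1
        field_simp
        linear_combination h3
      · intro q hq q' hq' h
        simp only [coe_filter, mem_filter, mem_product, Set.mem_ofPred_eq] at hq hq' h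
        obtain ⟨⟨-, h3⟩, h4⟩ := hq
        obtain ⟨⟨-, h3'⟩, h4'⟩ := hq'
        rw [h4] at h3
        rw [h4'] at h3'
        refine Prod.ext (h4.trans h4'.symm) (Prod.ext (mul_left_cancel₀ hc ?_) h)
        rw [h] at h3
        linear_combination h3' - h3
    · intro w hw
      exact (mem_product.1 (mem_filter.1 (mem_coe.1 hw)).1).1
  calc (dilateEnergy B c c' : ℝ)
      ≤ ∑ w ∈ B ×ˢ B, (#{b ∈ B | c' / c * b + (w.1 - c' / c * w.2) ∈ B} : ℝ) := by
        exact_mod_cast h1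
    _ ≤ ∑ w ∈ B ×ˢ B, M := sum_le_sum fun w _ => hM _
    _ = _ := by rw [sum_const, nsmul_eq_mul, card_product]; push_cast; ring

open Classical in
lemma sum_dilateEnergy_le {ι : Type*} {B : Finset (ZMod p)} {T : Finset ι} {C : ι → ZMod p}
    {K L n : ℝ} (hK : 1 ≤ K) (hL : 1 ≤ L) (hB : (#(B - B) : ℝ) ≤ L * #B) (hR : L * K < #B)
    (hp : 32 * (L * K) ^ 4 * ((L * K) ^ 10 * L ^ 24) * #B ≤ p - 1)
    (hC : ∀ t ∈ T, C t ≠ 0) (hn : 0 ≤ n) (hT : (#T : ℝ) ≤ n)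
    (hcoll : K ^ 2 * (128 * (L * K) ^ 16 * L ^ 24) * #{w ∈ T ×ˢ T | C w.1 = C w.2} ≤ n ^ 2)
    {t : ι} (ht : t ∈ T) :
    ∑ t' ∈ T, (dilateEnergy B (C t) (C t') : ℝ) ≤ 2 * n * #B ^ 3 / K := by
  have hK0 : 0 < K := by linarith
  set bad : Finset ι := {t' ∈ T | ∃ z, (#B : ℝ) ≤ K * #{b ∈ B | C t' / C t * b + z ∈ B}} with hbad
  set Y : Finset (ZMod p) := bad.image fun t' => C t' / C t with hYdef
  have hY : (#Y : ℝ) ≤ 128 * (L * K) ^ 16 * L ^ 24 := by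
    refine card_agreeing_dilates_le hK hL hB hR hp ?_ ?_
    · intro h0
      obtain ⟨t', ht', h⟩ := mem_image.1 h0
      exact div_ne_zero (hC _ (mem_filter.1 ht').1) (hC _ ht) h
    · intro y hy
      obtain ⟨t', ht', rfl⟩ := mem_image.1 hy
      exact (mem_filter.1 ht').2
  have hbadcard : K * #bad ≤ n := by
    have h1 := card_sq_le_card_mul_collisions bad Y (fun t' => C t' / C t)
      fun t' h => mem_image_of_mem _ h
    have h2 : #{q ∈ bad ×ˢ bad | C q.1 / C t = C q.2 / C t} ≤ #{w ∈ T ×ˢ T | C w.1 = C w.2} := by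
      refine card_le_card fun q hq => ?_
      simp only [mem_filter, mem_product, hbad] at hq ⊢
      exact ⟨⟨hq.1.1.1, hq.1.2.1⟩, (div_left_inj' (hC t ht)).1 hq.2⟩
    refine le_of_sq_le_sq ?_ hn
    calc (K * #bad) ^ 2 = K ^ 2 * (#bad : ℝ) ^ 2 := by ring
      _ ≤ K ^ 2 * (#Y * #{w ∈ T ×ˢ T | C w.1 = C w.2}) := by
          gcongr
          exact_mod_cast h1.trans (Nat.mul_le_mul_left _ h2)
      _ ≤ K ^ 2 * ((128 * (L * K) ^ 16 * L ^ 24) * #{w ∈ T ×ˢ T | C w.1 = C w.2}) := by gcongr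
      _ ≤ n ^ 2 := by rw [← mul_assoc]; exact hcoll
  have h1 : ∀ t' ∈ T, (dilateEnergy B (C t) (C t') : ℝ) ≤
      #B ^ 3 / K + if t' ∈ bad then (#B : ℝ) ^ 3 else 0 := by
    intro t' ht'
    split_ifs with h
    · have := dilateEnergy_le (B := B) (c' := C t') (hC t ht) (M := #B) fun z => by
        exact_mod_cast card_filter_le _ _
      have h0 : 0 ≤ (#B : ℝ) ^ 3 / K := by positivity
      linarith
    · have hgood : ∀ z, K * (#{b ∈ B | C t' / C t * b + z ∈ B} : ℝ) < #B := by
        simpa [hbad, ht'] using h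
      have := dilateEnergy_le (B := B) (c' := C t') (hC t ht) (M := #B / K) fun z => by
        rw [le_div_iff₀ hK0, mul_comm]; exact (hgood z).le
      rw [add_zero]
      exact this.trans_eq (by ring)
  calc _ ≤ _ := sum_le_sum h1
    _ = #T * (#B ^ 3 / K) + #bad * #B ^ 3 := by
        rw [sum_add_distrib, sum_const, nsmul_eq_mul, ← sum_filter, sum_const, nsmul_eq_mul,
          filter_mem_eq_inter, inter_eq_right.2 (filter_subset _ _)]
    _ ≤ n * (#B ^ 3 / K) + n / K * #B ^ 3 := by
        gcongr
        rw [le_div_iff₀ hK0, mul_comm]; exact hbadcard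
    _ = _ := by ring

open Classical in
lemma sum_norm_nonzero_dilates_le {ι : Type*} {V B : Finset (ZMod p)} {T : Finset ι}
    {C : ι → ZMod p} {K L n : ℝ} (hK : 1 ≤ K) (hL : 1 ≤ L) (hB : (#(B - B) : ℝ) ≤ L * #B)
    (hR : L * K < #B) (hp : 32 * (L * K) ^ 4 * ((L * K) ^ 10 * L ^ 24) * #B ≤ p - 1)
    (hC : ∀ t ∈ T, C t ≠ 0) (hn : 0 ≤ n) (hT : (#T : ℝ) ≤ n)
    (hcoll : K ^ 2 * (128 * (L * K) ^ 16 * L ^ 24) * #{w ∈ T ×ˢ T | C w.1 = C w.2} ≤ n ^ 2)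
    {θ : ZMod p} (hθ : θ ≠ 0) :
    (∑ v ∈ V, ∑ t ∈ T, ‖∑ b ∈ B, (stdAddChar (θ * v * (C t * b)) : ℂ)‖) ^ 4 ≤
      #V ^ 3 * n ^ 4 * #B ^ 3 * (2 * p / K) := by
  have hK0 : 0 < K := by linarith
  refine (sum_norm_dilates_pow_four_le V B T C hθ).trans ?_
  have h1 : ∑ t ∈ T, ∑ t' ∈ T, (dilateEnergy B (C t) (C t') : ℝ) ≤ n * (2 * n * #B ^ 3 / K) := by
    calc _ ≤ ∑ t ∈ T, 2 * n * #B ^ 3 / K :=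
          sum_le_sum fun t ht => sum_dilateEnergy_le hK hL hB hR hp hC hn hT hcoll ht
      _ = #T * (2 * n * #B ^ 3 / K) := by rw [sum_const, nsmul_eq_mul]
      _ ≤ _ := by gcongr
  calc _ ≤ (#V : ℝ) ^ 3 * n ^ 2 * p * (n * (2 * n * #B ^ 3 / K)) := by gcongr
    _ = _ := by ring

end Dilates

section SmallDoubling

open Finset ZMod
open scoped ComplexConjugate

variable {p : ℕ}

/-- Sums of `2 * k` values of `c` on `A` agree only when the arguments agree up to order. -/
def OnlyTrivialSums (A : Finset (ZMod p)) (c : ZMod p → ZMod p) (k : ℕ) : Prop :=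
  ∀ F H : Fin k ⊕ Fin k → ZMod p, (∀ i, F i ∈ A) → (∀ i, H i ∈ A) →
    ∑ i, c (F i) = ∑ i, c (H i) → ∃ σ : Equiv.Perm (Fin k ⊕ Fin k), F = H ∘ σ

/-- Pairs of `k`-tuples in `A`. -/
def tuplePairs (A : Finset (ZMod p)) (k : ℕ) : Finset ((Fin k → ZMod p) × (Fin k → ZMod p)) :=
  Fintype.piFinset (fun _ => A) ×ˢ Fintype.piFinset (fun _ => A)

/-- The frequency attached to a pair of tuples. -/
def tupleFreq (c : ZMod p → ZMod p) {k : ℕ} (t : (Fin k → ZMod p) × (Fin k → ZMod p)) : ZMod p :=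
  ∑ j, c (t.1 j) - ∑ j, c (t.2 j)

lemma mem_tuplePairs {A : Finset (ZMod p)} {k : ℕ} {t : (Fin k → ZMod p) × (Fin k → ZMod p)} :
    t ∈ tuplePairs A k ↔ (∀ j, t.1 j ∈ A) ∧ ∀ j, t.2 j ∈ A := by
  simp [tuplePairs]

lemma card_tuplePairs (A : Finset (ZMod p)) (k : ℕ) : #(tuplePairs A k) = #A ^ (2 * k) := by
  rw [tuplePairs, card_product, Fintype.card_piFinset_const, ← pow_add, two_mul]

variable [Fact p.Prime]

lemma card_tupleFreq_collisions_le {A : Finset (ZMod p)} {c : ZMod p → ZMod p} {k : ℕ}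
    (h : OnlyTrivialSums A c k) :
    #{w ∈ tuplePairs A k ×ˢ tuplePairs A k | tupleFreq c w.1 = tupleFreq c w.2} ≤
      (2 * k).factorial * #A ^ (2 * k) := by
  set S : Finset (((Fin k → ZMod p) × (Fin k → ZMod p)) × Equiv.Perm (Fin k ⊕ Fin k)) :=
    tuplePairs A k ×ˢ univ
  have hS : #S = (2 * k).factorial * #A ^ (2 * k) := by
    rw [card_product, card_tuplePairs, card_univ, Fintype.card_perm, Fintype.card_sum,
      Fintype.card_fin, ← two_mul, mul_comm]
  rw [← hS]
  refine (card_le_card ?_).trans (card_image_le (s := S) (f := fun q =>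
    (((fun j => Sum.elim q.1.1 q.1.2 (q.2 (Sum.inl j))), q.1.2),
      (q.1.1, fun j => Sum.elim q.1.1 q.1.2 (q.2 (Sum.inr j))))))
  rintro ⟨⟨f, h₁⟩, ⟨f', h'⟩⟩ hw
  obtain ⟨hmem, heq⟩ := mem_filter.1 hw
  obtain ⟨hmem₁, hmem₂⟩ := mem_product.1 hmem
  obtain ⟨hf, hh⟩ := mem_tuplePairs.1 hmem₁
  obtain ⟨hf', hh'⟩ := mem_tuplePairs.1 hmem₂
  simp only [tupleFreq] at heq
  obtain ⟨σ, hσ⟩ := h (Sum.elim f h') (Sum.elim f' h₁)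
    (by rintro (j | j) <;> simp [hf, hh']) (by rintro (j | j) <;> simp [hf', hh])
    (by
      simp only [Fintype.sum_sum_type, Sum.elim_inl, Sum.elim_inr]
      linear_combination heq)
  refine mem_image.2 ⟨((f', h₁), σ), mem_product.2 ⟨mem_tuplePairs.2 ⟨hf', hh⟩, mem_univ _⟩, ?_⟩
  have h1 : ∀ j, Sum.elim f' h₁ (σ (Sum.inl j)) = f j := fun j => (congrFun hσ (Sum.inl j)).symm
  have h2 : ∀ j, Sum.elim f' h₁ (σ (Sum.inr j)) = h' j := fun j => (congrFun hσ (Sum.inr j)).symm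
  simp only [h1, h2]

lemma sum_norm_pow_le_sum_tuplePairs (A B : Finset (ZMod p)) (c : ZMod p → ZMod p)
    {w : ZMod p → ℂ} {M : ℝ} (hw : ∀ a ∈ A, ‖w a‖ ≤ M) (v : ZMod p) (k : ℕ) :
    ∑ b ∈ B, ‖∑ a ∈ A, w a * stdAddChar (2 * v * (c a * b))‖ ^ (2 * k) ≤
      M ^ (2 * k) * ∑ t ∈ tuplePairs A k,
        ‖∑ b ∈ B, (stdAddChar (2 * v * (tupleFreq c t * b)) : ℂ)‖ := by
  set P : Finset (Fin k → ZMod p) := Fintype.piFinset fun _ => A with hP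
  have h1 : ∀ b, ((‖∑ a ∈ A, w a * stdAddChar (2 * v * (c a * b))‖ ^ (2 * k) : ℝ) : ℂ) =
      ∑ t ∈ tuplePairs A k, (∏ j, w (t.1 j)) * conj (∏ j, w (t.2 j)) *
        stdAddChar (2 * v * (tupleFreq c t * b)) := by
    intro b
    have h2 : (∑ a ∈ A, w a * (stdAddChar (2 * v * (c a * b)) : ℂ)) ^ k =
        ∑ f ∈ P, (∏ j, w (f j)) * stdAddChar (2 * v * ((∑ j, c (f j)) * b)) := by
      calc (∑ a ∈ A, w a * (stdAddChar (2 * v * (c a * b)) : ℂ)) ^ k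
          = ∏ _j : Fin k, ∑ a ∈ A, w a * (stdAddChar (2 * v * (c a * b)) : ℂ) := by
            rw [prod_const, card_univ, Fintype.card_fin]
        _ = ∑ f ∈ P, ∏ j, w (f j) * (stdAddChar (2 * v * (c (f j) * b)) : ℂ) :=
            prod_univ_sum _ _
        _ = _ := by
            refine sum_congr rfl fun f _ => ?_
            rw [prod_mul_distrib, sum_mul, mul_sum]
            congr 1
            exact (map_prod (stdAddChar (N := p)).toMonoidHom
              (fun j => Multiplicative.ofAdd (2 * v * (c (f j) * b))) univ).symm
    rw [mul_comm 2 k, pow_mul, ← norm_pow, h2, ofReal_norm_sum_sq, tuplePairs, sum_product]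
    refine sum_congr rfl fun f _ => sum_congr rfl fun f' _ => ?_
    rw [(starRingEnd ℂ).map_mul, mul_mul_mul_comm, stdAddChar_mul_conj, tupleFreq]
    congr 2
    ring
  have h3 : ∑ b ∈ B, ‖∑ a ∈ A, w a * stdAddChar (2 * v * (c a * b))‖ ^ (2 * k) ≤
      ‖∑ t ∈ tuplePairs A k, (∏ j, w (t.1 j)) * conj (∏ j, w (t.2 j)) *
        ∑ b ∈ B, (stdAddChar (2 * v * (tupleFreq c t * b)) : ℂ)‖ := by
    have h4 : ((∑ b ∈ B, ‖∑ a ∈ A, w a * stdAddChar (2 * v * (c a * b))‖ ^ (2 * k) : ℝ) : ℂ) =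
        ∑ t ∈ tuplePairs A k, (∏ j, w (t.1 j)) * conj (∏ j, w (t.2 j)) *
          ∑ b ∈ B, (stdAddChar (2 * v * (tupleFreq c t * b)) : ℂ) := by
      rw [Complex.ofReal_sum, sum_congr rfl fun b _ => h1 b, sum_comm]
      simp only [mul_sum]
    rw [← h4, Complex.norm_real]
    exact le_abs_self _
  refine h3.trans ((norm_sum_le _ _).trans ?_)
  rw [mul_sum]
  refine sum_le_sum fun t ht => ?_
  obtain ⟨ht1, ht2⟩ := mem_tuplePairs.1 ht
  have h5 : ∀ f : Fin k → ZMod p, (∀ j, f j ∈ A) → ‖∏ j, w (f j)‖ ≤ M ^ k := by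
    intro f hf
    rw [norm_prod]
    calc ∏ j, ‖w (f j)‖ ≤ ∏ _j : Fin k, M :=
          prod_le_prod (fun _ _ => norm_nonneg _) fun j _ => hw _ (hf j)
      _ = M ^ k := by rw [prod_const, card_univ, Fintype.card_fin]
  rw [norm_mul, norm_mul, Complex.norm_conj, show M ^ (2 * k) = M ^ k * M ^ k by
    rw [two_mul, pow_add]]
  gcongr
  · exact (norm_nonneg _).trans (h5 _ ht1)
  · exact h5 _ ht1
  · exact h5 _ ht2

lemma sum_tuplePairs_le {A B : Finset (ZMod p)} {c : ZMod p → ZMod p} {k : ℕ}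
    (htriv : OnlyTrivialSums A c k) (h2 : (2 : ZMod p) ≠ 0)
    {K L η : ℝ} (hK : 1 ≤ K) (hL : 1 ≤ L) (hη : 0 ≤ η)
    (hB : (#(B - B) : ℝ) ≤ L * #B) (hR : L * K < #B)
    (hp : 32 * (L * K) ^ 4 * ((L * K) ^ 10 * L ^ 24) * #B ≤ p - 1)
    (hn : K ^ 2 * (128 * (L * K) ^ 16 * L ^ 24) * (2 * k).factorial ≤ (#A : ℝ) ^ (2 * k))
    (hη1 : ((2 * k).factorial : ℝ) ≤ η ^ 2 * #A ^ (2 * k))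
    (hη2 : 2 * p ≤ K * η ^ 4 * #B ^ 2) :
    ∑ v ∈ B - B, ∑ t ∈ tuplePairs A k,
        ‖∑ b ∈ B, (stdAddChar (2 * v * (tupleFreq c t * b)) : ℂ)‖ ≤
      2 * η * (#(B - B) * #B * #A ^ (2 * k)) := by
  classical
  have hK0 : 0 < K := by linarith
  set n : ℝ := (#A : ℝ) ^ (2 * k) with hndef
  have hn0 : 0 ≤ n := by positivity
  have hBpos : (0 : ℝ) < #B := lt_trans (by positivity) hR
  have hBne : B.Nonempty := card_pos.1 (by exact_mod_cast hBpos)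
  have hBV : (#B : ℝ) ≤ #(B - B) := by exact_mod_cast card_le_card_sub_right hBne
  have hcoll : (#{w ∈ tuplePairs A k ×ˢ tuplePairs A k | tupleFreq c w.1 = tupleFreq c w.2} : ℝ)
      ≤ (2 * k).factorial * n := by
    rw [hndef]
    exact_mod_cast card_tupleFreq_collisions_le htriv
  have htc : (#(tuplePairs A k) : ℝ) = n := by rw [card_tuplePairs]; push_cast; rfl
  set T₀ := {t ∈ tuplePairs A k | tupleFreq c t = 0} with hT₀
  set T₁ := {t ∈ tuplePairs A k | ¬ tupleFreq c t = 0} with hT₁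
  have hT₀card : (#T₀ : ℝ) ≤ η * n := by
    refine le_of_sq_le_sq ?_ (by positivity)
    calc (#T₀ : ℝ) ^ 2 = #(T₀ ×ˢ T₀) := by rw [card_product]; push_cast; ring
      _ ≤ #{w ∈ tuplePairs A k ×ˢ tuplePairs A k | tupleFreq c w.1 = tupleFreq c w.2} := by
          gcongr
          intro w hw
          simp only [hT₀, mem_product, mem_filter] at hw ⊢
          exact ⟨⟨hw.1.1, hw.2.1⟩, hw.1.2.trans hw.2.2.symm⟩
      _ ≤ (2 * k).factorial * n := hcoll
      _ ≤ (η ^ 2 * n) * n := by gcongr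
      _ = _ := by ring
  have hzero : ∑ v ∈ B - B, ∑ t ∈ T₀,
      ‖∑ b ∈ B, (stdAddChar (2 * v * (tupleFreq c t * b)) : ℂ)‖ ≤
        η * (#(B - B) * #B * n) := by
    calc _ ≤ ∑ v ∈ B - B, ∑ t ∈ T₀, (#B : ℝ) := by
          refine sum_le_sum fun v _ => sum_le_sum fun t _ => ?_
          refine (norm_sum_le _ _).trans_eq ?_
          simp [AddChar.norm_apply]
      _ = #(B - B) * (#T₀ * #B) := by simp only [sum_const, nsmul_eq_mul]
      _ ≤ #(B - B) * ((η * n) * #B) := by gcongr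
      _ = _ := by ring
  have hone : ∑ v ∈ B - B, ∑ t ∈ T₁,
      ‖∑ b ∈ B, (stdAddChar (2 * v * (tupleFreq c t * b)) : ℂ)‖ ≤
        η * (#(B - B) * #B * n) := by
    refine le_of_pow_le_pow_left₀ (n := 4) (by norm_num) (by positivity) ?_
    refine (sum_norm_nonzero_dilates_le (n := n) hK hL hB hR hp (fun t ht => (mem_filter.1 ht).2)
      hn0 (htc ▸ by exact_mod_cast card_filter_le _ _) ?_ h2).trans ?_
    · calc _ ≤ K ^ 2 * (128 * (L * K) ^ 16 * L ^ 24) * ((2 * k).factorial * n) := by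
            gcongr
            refine le_trans ?_ hcoll
            gcongr <;> exact filter_subset _ _
        _ = K ^ 2 * (128 * (L * K) ^ 16 * L ^ 24) * (2 * k).factorial * n := by ring
        _ ≤ n * n := by gcongr
        _ = _ := by ring
    · have h3 : 2 * p / K ≤ η ^ 4 * (#B * #(B - B)) := by
        rw [div_le_iff₀ hK0]
        calc (2 * p : ℝ) ≤ K * η ^ 4 * #B ^ 2 := hη2
          _ = K * η ^ 4 * (#B * #B) := by ring
          _ ≤ K * η ^ 4 * (#B * #(B - B)) := by gcongr
          _ = _ := by ring
      calc (#(B - B) : ℝ) ^ 3 * n ^ 4 * #B ^ 3 * (2 * p / K)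
          ≤ #(B - B) ^ 3 * n ^ 4 * #B ^ 3 * (η ^ 4 * (#B * #(B - B))) := by gcongr
        _ = _ := by ring
  have hsplit : ∀ v, ∑ t ∈ tuplePairs A k,
      ‖∑ b ∈ B, (stdAddChar (2 * v * (tupleFreq c t * b)) : ℂ)‖ =
      ∑ t ∈ T₀, ‖∑ b ∈ B, (stdAddChar (2 * v * (tupleFreq c t * b)) : ℂ)‖ +
      ∑ t ∈ T₁, ‖∑ b ∈ B, (stdAddChar (2 * v * (tupleFreq c t * b)) : ℂ)‖ := fun v =>
    (sum_filter_add_sum_filter_not _ _ _).symm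
  simp only [hsplit, sum_add_distrib]
  linarith

lemma sum_pow_le_card_pow_mul {ι : Type*} (s : Finset ι) {f : ι → ℝ} (hf : ∀ i ∈ s, 0 ≤ f i)
    {m : ℕ} (hm : m ≠ 0) : (∑ i ∈ s, f i) ^ m ≤ (#s : ℝ) ^ (m - 1) * ∑ i ∈ s, f i ^ m := by
  obtain ⟨n, rfl⟩ := Nat.exists_eq_succ_of_ne_zero hm
  rcases s.eq_empty_or_nonempty with rfl | hs
  · simp
  have h := pow_sum_div_card_le_sum_pow hf n
  have hpos : (0 : ℝ) < #s := by exact_mod_cast hs.card_pos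
  rw [div_le_iff₀ (by positivity)] at h
  simpa [mul_comm] using h

/-- The main estimate for a set `B` of small doubling against the fibres `β a`. -/
theorem norm_sum_small_doubling_le {A B : Finset (ZMod p)} {β : ZMod p → Finset (ZMod p)}
    {g : ZMod p → ℂ} {c : ZMod p → ZMod p} {k : ℕ} (hk : k ≠ 0)
    (hg : ∀ a ∈ A, ‖g a‖ ≤ 1) {M : ℝ} (hM : 0 ≤ M) (hβ : ∀ a ∈ A, (#(β a) : ℝ) ≤ M)
    (htriv : OnlyTrivialSums A c k) (h2 : (2 : ZMod p) ≠ 0)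
    {K L η : ℝ} (hK : 1 ≤ K) (hL : 1 ≤ L) (hη : 0 ≤ η)
    (hB : (#(B - B) : ℝ) ≤ L * #B) (hR : L * K < #B)
    (hp : 32 * (L * K) ^ 4 * ((L * K) ^ 10 * L ^ 24) * #B ≤ p - 1)
    (hn : K ^ 2 * (128 * (L * K) ^ 16 * L ^ 24) * (2 * k).factorial ≤ (#A : ℝ) ^ (2 * k))
    (hη1 : ((2 * k).factorial : ℝ) ≤ η ^ 2 * #A ^ (2 * k))
    (hη2 : 2 * p ≤ K * η ^ 4 * #B ^ 2) :
    ‖∑ b ∈ B, ∑ a ∈ A, g a * ∑ b' ∈ β a, (stdAddChar (c a * (b - b') ^ 2) : ℂ)‖ ^ (4 * k) ≤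
      (#A * M * #B) ^ (4 * k) * (2 * L * η) := by
  set Ω : Finset (Σ _ : ZMod p, ZMod p) := A.sigma β with hΩ
  have hΩcard : (#Ω : ℝ) ≤ #A * M := by
    rw [hΩ, card_sigma]
    push_cast
    calc ∑ a ∈ A, (#(β a) : ℝ) ≤ ∑ a ∈ A, M := sum_le_sum hβ
      _ = _ := by rw [sum_const, nsmul_eq_mul]
  set w : ZMod p → ZMod p → ℂ := fun v a =>
    g a * conj (g a) * ∑ b' ∈ β a, stdAddChar (c a * (-v ^ 2 - 2 * b' * v)) with hw
  have hwM : ∀ v, ∀ a ∈ A, ‖w v a‖ ≤ M := by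
    intro v a ha
    have h3 : ‖∑ b' ∈ β a, (stdAddChar (c a * (-v ^ 2 - 2 * b' * v)) : ℂ)‖ ≤ #(β a) := by
      refine (norm_sum_le _ _).trans_eq ?_
      simp [AddChar.norm_apply]
    rw [hw, norm_mul, norm_mul, Complex.norm_conj]
    calc ‖g a‖ * ‖g a‖ * _ ≤ 1 * 1 * (#(β a) : ℝ) := by
          gcongr <;> exact hg a ha
      _ ≤ M := by rw [one_mul, one_mul]; exact hβ a ha
  set Ξ : ZMod p → ZMod p → ℂ := fun b v =>
    ∑ a ∈ A, w v a * stdAddChar (2 * v * (c a * b)) with hΞ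
  set S := ∑ b ∈ B, ∑ a ∈ A, g a * ∑ b' ∈ β a, (stdAddChar (c a * (b - b') ^ 2) : ℂ) with hS
  have h1 : ‖S‖ ^ 2 ≤ #A * M * ∑ q ∈ B ×ˢ B, ‖Ξ q.1 (q.1 - q.2)‖ := by
    have hSΩ : S = ∑ i ∈ Ω, ∑ b ∈ B, g i.1 * stdAddChar (c i.1 * (b - i.2) ^ 2) := by
      rw [hS, sum_comm (s := Ω), hΩ]
      refine sum_congr rfl fun b _ => ?_
      rw [sum_sigma]
      simp only [mul_sum]
    rw [hSΩ, sum_product]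
    refine (norm_sum_sum_sq_le _ _ _).trans ?_
    refine mul_le_mul hΩcard (le_of_eq ?_)
      (sum_nonneg fun _ _ => sum_nonneg fun _ _ => norm_nonneg _) (by positivity)
    refine sum_congr rfl fun b _ => sum_congr rfl fun b' _ => ?_
    congr 1
    rw [hΩ, sum_sigma, hΞ]
    refine sum_congr rfl fun a _ => ?_
    simp only [hw, mul_sum, sum_mul]
    refine sum_congr rfl fun b₂ _ => ?_
    rw [(starRingEnd ℂ).map_mul, mul_mul_mul_comm, stdAddChar_mul_conj, mul_assoc _ (stdAddChar _ : ℂ),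
      ← AddChar.map_add_eq_mul]
    congr 2
    ring
  have h3 : (∑ q ∈ B ×ˢ B, ‖Ξ q.1 (q.1 - q.2)‖) ^ (2 * k) ≤
      ((#B : ℝ) ^ 2) ^ (2 * k - 1) * ∑ v ∈ B - B, ∑ b ∈ B, ‖Ξ b v‖ ^ (2 * k) := by
    refine (sum_pow_le_card_pow_mul _ (fun _ _ => norm_nonneg _) (by omega)).trans ?_
    rw [card_product, Nat.cast_mul, ← sq]
    gcongr
    rw [← sum_product_right']
    refine (sum_image (f := fun w : ZMod p × ZMod p => ‖Ξ w.1 w.2‖ ^ (2 * k))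
      (g := fun q : ZMod p × ZMod p => (q.1, q.1 - q.2)) ?_).symm.le.trans ?_
    · intro q _ q' _ h
      simp only [Prod.mk.injEq] at h
      refine Prod.ext h.1 ?_
      have := h.2
      rw [h.1] at this
      exact sub_right_injective this
    · refine sum_le_sum_of_subset_of_nonneg ?_ fun _ _ _ => by positivity
      intro w hw
      obtain ⟨q, hq, rfl⟩ := mem_image.1 hw
      obtain ⟨hq1, hq2⟩ := mem_product.1 hq
      exact mem_product.2 ⟨hq1, sub_mem_sub hq1 hq2⟩
  have h4 : ∑ v ∈ B - B, ∑ b ∈ B, ‖Ξ b v‖ ^ (2 * k) ≤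
      M ^ (2 * k) * (2 * η * (L * #B * #B * #A ^ (2 * k))) := by
    calc _ ≤ ∑ v ∈ B - B, M ^ (2 * k) * ∑ t ∈ tuplePairs A k,
            ‖∑ b ∈ B, (stdAddChar (2 * v * (tupleFreq c t * b)) : ℂ)‖ :=
          sum_le_sum fun v _ => sum_norm_pow_le_sum_tuplePairs A B c (hwM v) v k
      _ ≤ M ^ (2 * k) * (2 * η * (#(B - B) * #B * #A ^ (2 * k))) := by
          rw [← mul_sum]
          gcongr
          exact sum_tuplePairs_le htriv h2 hK hL hη hB hR hp hn hη1 hη2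
      _ ≤ _ := by gcongr
  calc ‖S‖ ^ (4 * k) = (‖S‖ ^ 2) ^ (2 * k) := by rw [← pow_mul]; congr 1; ring
    _ ≤ (#A * M * ∑ q ∈ B ×ˢ B, ‖Ξ q.1 (q.1 - q.2)‖) ^ (2 * k) := by gcongr
    _ = (#A * M) ^ (2 * k) * (∑ q ∈ B ×ˢ B, ‖Ξ q.1 (q.1 - q.2)‖) ^ (2 * k) := mul_pow _ _ _
    _ ≤ (#A * M) ^ (2 * k) * (((#B : ℝ) ^ 2) ^ (2 * k - 1) *
          (M ^ (2 * k) * (2 * η * (L * #B * #B * #A ^ (2 * k))))) := by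
        gcongr
        exact h3.trans (by gcongr)
    _ = (#A * M) ^ (2 * k) * ((((#B : ℝ) ^ 2) ^ (2 * k - 1) * #B ^ 2) *
          (#A * M) ^ (2 * k)) * (2 * L * η) := by rw [mul_pow]; ring
    _ = _ := by
        rw [pow_sub_one_mul (by omega)]
        rw [show 4 * k = 2 * (2 * k) by ring, pow_mul, mul_pow (_ * M), mul_pow]
        ring

end SmallDoubling

section Decomposition

open Finset

variable {G : Type*} [AddCommGroup G] [DecidableEq G]

lemma addEnergy_self_le_card_pow (A : Finset G) : _root_.addEnergy A A ≤ #A ^ 3 := by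
  rw [← sum_sq_card_diffReps]
  calc ∑ d ∈ A - A, #(diffReps A d) ^ 2 ≤ ∑ d ∈ A - A, #A * #(diffReps A d) := by
        refine sum_le_sum fun d _ => ?_
        rw [sq]
        gcongr
        rw [← card_shiftInter]
        exact card_filter_le _ _
    _ = #A ^ 3 := by rw [← mul_sum, sum_card_diffReps]; ring

/-- Pieces of small doubling are split off `B` until the rest has small energy. -/
lemma exists_low_energy_remainder {B : Finset G} {K s : ℝ} (hK : 1 ≤ K) (hs : 0 ≤ s) (f : G → ℂ)
    (hf : ∀ X ⊆ B, (#B : ℝ) ^ 3 ≤ 64 * K ^ 4 * #X ^ 3 → (#(X - X) : ℝ) ≤ 2 ^ 14 * K ^ 4 * #X →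
      ‖∑ b ∈ X, f b‖ ≤ s * #X) :
    ∃ R ⊆ B, K * _root_.addEnergy R R ≤ (#B : ℝ) ^ 3 ∧
      ‖∑ b ∈ B, f b‖ ≤ s * #B + ‖∑ b ∈ R, f b‖ := by
  suffices H : ∀ C : Finset G, C ⊆ B → ∃ R ⊆ C, K * _root_.addEnergy R R ≤ (#B : ℝ) ^ 3 ∧
      ‖∑ b ∈ C, f b‖ ≤ s * #C + ‖∑ b ∈ R, f b‖ from H B Subset.rfl
  intro C
  induction C using Finset.strongInduction with
  | H C ih =>
    intro hC
    by_cases hE : K * _root_.addEnergy C C ≤ (#B : ℝ) ^ 3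
    · exact ⟨C, Subset.rfl, hE, by linarith [mul_nonneg hs (Nat.cast_nonneg (α := ℝ) #C)]⟩
    push Not at hE
    have hCE : (_root_.addEnergy C C : ℝ) ≤ (#C : ℝ) ^ 3 := by
      exact_mod_cast addEnergy_self_le_card_pow C
    have hCne : C.Nonempty := by
      rw [nonempty_iff_ne_empty]
      rintro rfl
      have h0 : (0 : ℝ) ≤ (#B : ℝ) ^ 3 := by positivity
      rw [card_empty, Nat.cast_zero, zero_pow three_ne_zero] at hCE
      nlinarith
    have hCB : (#C : ℝ) ≤ #B := by exact_mod_cast card_le_card hC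
    obtain ⟨X, hXC, hX1, hX2⟩ := exists_small_doubling_subset hK hCne
      ((pow_le_pow_left₀ (by positivity) hCB 3).trans hE.le)
    have hCpos : (0 : ℝ) < #C := by exact_mod_cast hCne.card_pos
    have hXpos : (0 : ℝ) < #X := by
      by_contra h
      nlinarith
    have hXne : X.Nonempty := card_pos.1 (by exact_mod_cast hXpos)
    have hX3 : (#B : ℝ) ^ 3 ≤ 64 * K ^ 4 * #X ^ 3 := by
      calc (#B : ℝ) ^ 3 ≤ K * #C ^ 3 := hE.le.trans (by gcongr)
        _ ≤ K * (4 * K * #X) ^ 3 := by gcongr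
        _ = _ := by ring
    have hXbd := hf X (hXC.trans hC) hX3 hX2
    obtain ⟨R, hR, hRE, hRf⟩ := ih (C \ X) (sdiff_ssubset hXC hXne) (sdiff_subset.trans hC)
    refine ⟨R, hR.trans sdiff_subset, hRE, ?_⟩
    have hcard : (#C : ℝ) = #(C \ X) + #X := by
      exact_mod_cast (card_sdiff_add_card_eq_card hXC).symm
    rw [← sum_sdiff hXC, hcard]
    calc _ ≤ _ := norm_add_le _ _
      _ ≤ _ := by linarith

end Decomposition

section Bilinear

open Finset ZMod

variable {p : ℕ} [Fact p.Prime]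

lemma norm_sum_stdAddChar_sq_le_of_energy (h2 : (2 : ZMod p) ≠ 0) {B₁ B₂ : Finset (ZMod p)}
    {c : ZMod p} (hc : c ≠ 0) {M₁ M₂ τ₁ τ₂ t : ℝ} (hM₁ : (#B₁ : ℝ) ≤ M₁) (hM₂ : (#B₂ : ℝ) ≤ M₂)
    (hE₁ : (_root_.addEnergy B₁ B₁ : ℝ) ≤ τ₁ * M₁ ^ 3)
    (hE₂ : (_root_.addEnergy B₂ B₂ : ℝ) ≤ τ₂ * M₂ ^ 3) (ht : 0 ≤ t)
    (hpt : p * M₁ ^ 7 * M₂ ^ 7 * (τ₁ * τ₂) ≤ t ^ 8) :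
    ‖∑ b₁ ∈ B₁, ∑ b₂ ∈ B₂, (stdAddChar (c * (b₁ - b₂) ^ 2) : ℂ)‖ ≤ t := by
  have h₁ : 0 ≤ M₁ := (Nat.cast_nonneg _).trans hM₁
  have h₂ : 0 ≤ M₂ := (Nat.cast_nonneg _).trans hM₂
  refine le_of_pow_le_pow_left₀ (n := 8) (by norm_num) ht ?_
  refine (norm_sum_stdAddChar_sq_le h2 B₁ B₂ hc).trans (le_trans ?_ hpt)
  calc (p * #B₁ ^ 4 * #B₂ ^ 4 * _root_.addEnergy B₁ B₁ * _root_.addEnergy B₂ B₂ : ℝ)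
      ≤ p * M₁ ^ 4 * M₂ ^ 4 * (τ₁ * M₁ ^ 3) * (τ₂ * M₂ ^ 3) := by
        gcongr
        exact mul_nonneg (by positivity) ((Nat.cast_nonneg _).trans hE₁)
    _ = _ := by ring

/-- The bilinear form attached to fibres `β₁ a` over `a ∈ A₁` and `β₂ a'` over `a' ∈ A₂`. -/
noncomputable def slopeForm (κ : ZMod p) (g : ZMod p → ZMod p → ℂ)
    (β₁ β₂ : ZMod p → Finset (ZMod p)) (A₁ A₂ : Finset (ZMod p)) : ℂ :=
  ∑ a ∈ A₁, ∑ a' ∈ A₂, g a a' *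
    ∑ b ∈ β₁ a, ∑ b' ∈ β₂ a', (stdAddChar (κ * (a - a')⁻¹ * (b - b') ^ 2) : ℂ)

/-- Bilinear bound when one family of slopes is large enough for the small doubling estimate. -/
lemma norm_bilinear_le_of_onlyTrivialSums {A₁ A₂ : Finset (ZMod p)}
    {β₁ β₂ : ZMod p → Finset (ZMod p)} {g : ZMod p → ZMod p → ℂ} (hg : ∀ a a', ‖g a a'‖ ≤ 1)
    (hdiag : ∀ a, g a a = 0) {κ : ZMod p} (hκ : κ ≠ 0) (h2 : (2 : ZMod p) ≠ 0) {k : ℕ} (hk : k ≠ 0)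
    (htriv : ∀ a ∈ A₁, OnlyTrivialSums (A₂.erase a) (fun a' => κ * (a - a')⁻¹) k)
    {μ M₁ M₂ : ℝ} (hμ : ∀ a ∈ A₁, μ ≤ #(β₁ a)) (hM₁ : ∀ a ∈ A₁, (#(β₁ a) : ℝ) ≤ M₁) (hM₂0 : 0 ≤ M₂)
    (hM₂ : ∀ a ∈ A₂, (#(β₂ a) : ℝ) ≤ M₂) {D K η N s t : ℝ} (hD : 1 ≤ D) (hK : 1 ≤ K) (hη : 0 ≤ η)
    (hN : 0 ≤ N) (hs0 : 0 ≤ s) (ht0 : 0 ≤ t) (hNμ : 64 * D ^ 4 * N ^ 3 ≤ μ ^ 3) (hμ0 : 0 ≤ μ)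
    (hR : 2 ^ 14 * D ^ 4 * K < N)
    (hp : 32 * (2 ^ 14 * D ^ 4 * K) ^ 4 * ((2 ^ 14 * D ^ 4 * K) ^ 10 * (2 ^ 14 * D ^ 4) ^ 24) * M₁ ≤
      p - 1)
    (hn : ∀ a ∈ A₁, K ^ 2 * (128 * (2 ^ 14 * D ^ 4 * K) ^ 16 * (2 ^ 14 * D ^ 4) ^ 24) *
      (2 * k).factorial ≤ (#(A₂.erase a) : ℝ) ^ (2 * k))
    (hη1 : ∀ a ∈ A₁, ((2 * k).factorial : ℝ) ≤ η ^ 2 * #(A₂.erase a) ^ (2 * k))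
    (hη2 : 2 * p ≤ K * η ^ 4 * N ^ 2) (hs : 2 * (2 ^ 14 * D ^ 4) * η ≤ s ^ (4 * k))
    (ht : p * M₁ ^ 7 * M₂ ^ 7 * (D⁻¹ * 1) ≤ t ^ 8) :
    ‖slopeForm κ g β₁ β₂ A₁ A₂‖ ≤
      #A₁ * (#A₂ * M₂ * s * M₁ + #A₂ * t) := by
  have hD0 : 0 < D := by linarith
  rw [slopeForm, ← nsmul_eq_mul, ← sum_const]
  refine norm_sum_le_of_le _ fun a ha => ?_
  set c : ZMod p → ZMod p := fun a' => κ * (a - a')⁻¹ with hc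
  set f : ZMod p → ℂ := fun b => ∑ a' ∈ A₂.erase a, g a a' *
    ∑ b' ∈ β₂ a', (stdAddChar (c a' * (b - b') ^ 2) : ℂ) with hf
  have hflip : ∀ X : Finset (ZMod p), ∑ b ∈ X, f b = ∑ a' ∈ A₂.erase a, g a a' *
      ∑ b ∈ X, ∑ b' ∈ β₂ a', (stdAddChar (c a' * (b - b') ^ 2) : ℂ) := by
    intro X
    rw [hf, sum_comm]
    simp only [mul_sum]
  have hmain : ∑ a' ∈ A₂, g a a' *
      ∑ b ∈ β₁ a, ∑ b' ∈ β₂ a', (stdAddChar (κ * (a - a')⁻¹ * (b - b') ^ 2) : ℂ) =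
      ∑ b ∈ β₁ a, f b := by
    rw [hflip, sum_erase _ (by rw [hdiag, zero_mul])]
  have hA₂ : (#(A₂.erase a) : ℝ) ≤ #A₂ := by exact_mod_cast card_erase_le
  obtain ⟨R, hRB, hRE, hRf⟩ := exists_low_energy_remainder (B := β₁ a) (s := #A₂ * M₂ * s) hD
    (by positivity) f (by
      intro X hXB hX3 hX2
      have hNX : N ≤ #X := by
        refine le_of_pow_le_pow_left₀ three_ne_zero (by positivity) ?_
        refine le_of_mul_le_mul_left ?_ (by positivity : 0 < 64 * D ^ 4)
        exact hNμ.trans ((pow_le_pow_left₀ hμ0 (hμ a ha) 3).trans hX3)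
      have hXM : (#X : ℝ) ≤ M₁ :=
        le_trans (by exact_mod_cast card_le_card hXB) (hM₁ a ha)
      refine le_of_pow_le_pow_left₀ (n := 4 * k) (by omega) (by positivity) ?_
      refine (norm_sum_small_doubling_le hk (fun a' _ => hg a a') hM₂0
        (fun a' ha' => hM₂ a' (mem_of_mem_erase ha')) (htriv a ha) h2 hK
        (by nlinarith [one_le_pow₀ (n := 4) hD] : (1 : ℝ) ≤ 2 ^ 14 * D ^ 4) hη hX2
        (hR.trans_le hNX) (le_trans (by gcongr) hp) (hn a ha) (hη1 a ha)
        (hη2.trans (by gcongr))).trans ?_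
      calc (#(A₂.erase a) * M₂ * #X) ^ (4 * k) * (2 * (2 ^ 14 * D ^ 4) * η)
          ≤ (#A₂ * M₂ * #X) ^ (4 * k) * s ^ (4 * k) := by gcongr
        _ = _ := by rw [← mul_pow]; congr 1; ring)
  rw [hmain]
  refine hRf.trans (add_le_add ?_ ?_)
  · gcongr
    exact hM₁ a ha
  · rw [hflip]
    calc _ ≤ ∑ a' ∈ A₂.erase a, t := by
          refine norm_sum_le_of_le _ fun a' ha' => ?_
          have hca : c a' ≠ 0 :=
            mul_ne_zero hκ (inv_ne_zero (sub_ne_zero.2 (ne_of_mem_erase ha').symm))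
          rw [norm_mul]
          refine (mul_le_of_le_one_left (norm_nonneg _) (hg a a')).trans ?_
          refine norm_sum_stdAddChar_sq_le_of_energy h2 hca
            (le_trans (by exact_mod_cast card_le_card hRB) (hM₁ a ha))
            (hM₂ a' (mem_of_mem_erase ha')) (τ₁ := D⁻¹) (τ₂ := 1) ?_ ?_ ht0 ht
          · rw [inv_mul_eq_div, le_div_iff₀' hD0]
            exact hRE.trans (pow_le_pow_left₀ (by positivity) (hM₁ a ha) 3)
          · rw [one_mul]
            calc (_root_.addEnergy (β₂ a') (β₂ a') : ℝ) ≤ (#(β₂ a') : ℝ) ^ 3 := by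
                  exact_mod_cast addEnergy_self_le_card_pow (β₂ a')
              _ ≤ M₂ ^ 3 :=
                  pow_le_pow_left₀ (by positivity) (hM₂ a' (mem_of_mem_erase ha')) 3
      _ ≤ _ := by
          rw [sum_const, nsmul_eq_mul]
          gcongr

/-- Bilinear bound when all fibres have small energy. -/
lemma norm_bilinear_le_of_energy {A₁ A₂ : Finset (ZMod p)}
    {β₁ β₂ : ZMod p → Finset (ZMod p)} {g : ZMod p → ZMod p → ℂ} (hg : ∀ a a', ‖g a a'‖ ≤ 1)
    (hdiag : ∀ a, g a a = 0) {κ : ZMod p} (hκ : κ ≠ 0) (h2 : (2 : ZMod p) ≠ 0)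
    {M₁ M₂ τ t : ℝ} (hM₁ : ∀ a ∈ A₁, (#(β₁ a) : ℝ) ≤ M₁) (hM₂ : ∀ a ∈ A₂, (#(β₂ a) : ℝ) ≤ M₂)
    (hE₁ : ∀ a ∈ A₁, (_root_.addEnergy (β₁ a) (β₁ a) : ℝ) ≤ τ * M₁ ^ 3)
    (hE₂ : ∀ a ∈ A₂, (_root_.addEnergy (β₂ a) (β₂ a) : ℝ) ≤ τ * M₂ ^ 3) (ht0 : 0 ≤ t)
    (ht : p * M₁ ^ 7 * M₂ ^ 7 * (τ * τ) ≤ t ^ 8) :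
    ‖slopeForm κ g β₁ β₂ A₁ A₂‖ ≤
      #A₁ * (#A₂ * t) := by
  rw [slopeForm, ← nsmul_eq_mul, ← nsmul_eq_mul, ← sum_const, ← sum_const]
  refine norm_sum_le_of_le _ fun a ha => norm_sum_le_of_le _ fun a' ha' => ?_
  by_cases h : a = a'
  · rw [h, hdiag, zero_mul, norm_zero]
    exact ht0
  rw [norm_mul]
  refine (mul_le_of_le_one_left (norm_nonneg _) (hg a a')).trans ?_
  exact norm_sum_stdAddChar_sq_le_of_energy h2
    (mul_ne_zero hκ (inv_ne_zero (sub_ne_zero.2 h))) (hM₁ a ha) (hM₂ a' ha') (hE₁ a ha)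
    (hE₂ a' ha') ht0 ht

/-- The trivial bound. -/
lemma norm_bilinear_le_card {A₁ A₂ : Finset (ZMod p)}
    {β₁ β₂ : ZMod p → Finset (ZMod p)} {g : ZMod p → ZMod p → ℂ} (hg : ∀ a a', ‖g a a'‖ ≤ 1)
    {κ : ZMod p} {M₁ M₂ : ℝ} (hM₁ : ∀ a ∈ A₁, (#(β₁ a) : ℝ) ≤ M₁)
    (hM₂ : ∀ a ∈ A₂, (#(β₂ a) : ℝ) ≤ M₂) :
    ‖slopeForm κ g β₁ β₂ A₁ A₂‖ ≤
      #A₁ * (#A₂ * (M₁ * M₂)) := by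
  rw [slopeForm, ← nsmul_eq_mul, ← nsmul_eq_mul, ← sum_const, ← sum_const]
  refine norm_sum_le_of_le _ fun a ha => norm_sum_le_of_le _ fun a' ha' => ?_
  rw [norm_mul]
  refine (mul_le_of_le_one_left (norm_nonneg _) (hg a a')).trans ?_
  calc _ ≤ ∑ b ∈ β₁ a, ∑ b' ∈ β₂ a', (1 : ℝ) :=
        norm_sum_le_of_le _ fun b _ => norm_sum_le_of_le _ fun b' _ => by
          rw [AddChar.norm_apply]
    _ = #(β₁ a) * #(β₂ a') := by simp
    _ ≤ M₁ * M₂ := by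
        gcongr
        · exact (Nat.cast_nonneg _).trans (hM₁ a ha)
        · exact hM₁ a ha
        · exact hM₂ a' ha'

end Bilinear

section Classes

open Finset ZMod Filter

lemma eventually_const_mul_rpow_le (C : ℝ) {a b : ℝ} (hab : a < b) :
    ∀ᶠ p : ℕ in atTop, C * (p : ℝ) ^ a ≤ (p : ℝ) ^ b := by
  have h := ((tendsto_rpow_atTop (sub_pos.2 hab)).comp
    (tendsto_natCast_atTop_atTop (R := ℝ))).eventually_ge_atTop C
  filter_upwards [h, eventually_gt_atTop 0] with p hp hp0
  have hp0' : (0 : ℝ) < p := by exact_mod_cast hp0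
  calc C * (p : ℝ) ^ a ≤ (p : ℝ) ^ (b - a) * (p : ℝ) ^ a := by gcongr; exact hp
    _ = (p : ℝ) ^ b := by rw [← Real.rpow_add hp0']; ring_nf

lemma rpow_pow_eq {q : ℝ} (hq : 0 ≤ q) (a : ℝ) (n : ℕ) : (q ^ a) ^ n = q ^ (n * a) := by
  rw [← Real.rpow_natCast, ← Real.rpow_mul hq, mul_comm]

/-- Splitting off the trivial factor in an eighth root estimate. -/
lemma card_mul_card_mul_le_of_pow_eight {n₁ n₂ M₁ M₂ q t ν θ : ℝ} (hn₁ : 0 ≤ n₁) (hn₂ : 0 ≤ n₂)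
    (hM₁ : 0 ≤ M₁) (hM₂ : 0 ≤ M₂) (hq : 0 < q) (hν : 0 ≤ ν)
    (h₁ : n₁ * M₁ ≤ 2 * √q) (h₂ : n₂ * M₂ ≤ 2 * √q)
    (ht : t ^ 8 = q * M₁ ^ 7 * M₂ ^ 7 * ν) (hθ : n₁ * n₂ * ν ≤ q ^ (8 * θ)) :
    n₁ * (n₂ * t) ≤ 4 * q ^ (1 + θ) := by
  refine le_of_pow_le_pow_left₀ (n := 8) (by norm_num) (by positivity) ?_
  have hT : n₁ * M₁ * (n₂ * M₂) ≤ 4 * q := by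
    calc n₁ * M₁ * (n₂ * M₂) ≤ 2 * √q * (2 * √q) := by gcongr
      _ = 4 * (√q * √q) := by ring
      _ = 4 * q := by rw [Real.mul_self_sqrt hq.le]
  calc (n₁ * (n₂ * t)) ^ 8 = n₁ ^ 8 * n₂ ^ 8 * t ^ 8 := by ring
    _ = q * (n₁ * M₁ * (n₂ * M₂)) ^ 7 * (n₁ * n₂ * ν) := by rw [ht]; ring
    _ ≤ q * (4 * q) ^ 7 * q ^ (8 * θ) := by gcongr
    _ ≤ 4 ^ 8 * (q ^ 8 * q ^ (8 * θ)) := by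
        have : 0 ≤ q ^ 8 * q ^ (8 * θ) := by positivity
        nlinarith
    _ = (4 * q ^ (1 + θ)) ^ 8 := by
        rw [mul_pow, rpow_pow_eq hq.le, ← Real.rpow_natCast q 8, ← Real.rpow_add hq]
        norm_num [mul_add]

/-- Saving for many slopes with long fibres. -/
lemma eventually_norm_slopeForm_le_of_many_slopes {k : ℕ} (hk : k ≠ 0)
    {x y α α₁ ε κ σ : ℝ} (hx : 0 ≤ x) (hε : 0 < ε) (hκ0 : 0 ≤ κ) (hα₁ : 0 ≤ α₁)
    (hR : 4 * x + κ < 1 / 2 - α₁) (hp : 14 * κ + 152 * x < 1 / 2)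
    (hn : 18 * κ + 160 * x < 2 * k * y) (hη : κ / 2 < 2 * k * y) (hy : 0 < y)
    (hs : σ ≤ (κ / 8 - α₁ / 4 - 2 * x) / (2 * k)) (ht : σ ≤ x / 8 - α / 4) :
    ∀ᶠ p : ℕ in atTop, ∀ [Fact p.Prime] (A₁ A₂ : Finset (ZMod p))
      (β₁ β₂ : ZMod p → Finset (ZMod p)) (g : ZMod p → ZMod p → ℂ) (κ₀ : ZMod p) (M₁ M₂ : ℝ),
      (∀ a a', ‖g a a'‖ ≤ 1) → (∀ a, g a a = 0) → κ₀ ≠ 0 →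
      (∀ a ∈ A₁, OnlyTrivialSums (A₂.erase a) (fun a' => κ₀ * (a - a')⁻¹) k) →
      (#A₁ : ℝ) ≤ (p : ℝ) ^ α → (#A₂ : ℝ) ≤ (p : ℝ) ^ α → (p : ℝ) ^ y ≤ #A₂ →
      0 ≤ M₁ → 0 ≤ M₂ → M₁ ≤ 2 * √p → #A₁ * M₁ ≤ 2 * √p → #A₂ * M₂ ≤ 2 * √p →
      (∀ a ∈ A₁, (p : ℝ) ^ (1 / 2 - α₁ + 4 / 3 * x + ε / 2) ≤ #(β₁ a)) →
      (∀ a ∈ A₁, (#(β₁ a) : ℝ) ≤ M₁) → (∀ a ∈ A₂, (#(β₂ a) : ℝ) ≤ M₂) →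
      ‖slopeForm κ₀ g β₁ β₂ A₁ A₂‖ ≤ 2 ^ 19 * (p : ℝ) ^ (1 - σ) := by
  have hk' : (0 : ℝ) < k := by exact_mod_cast Nat.pos_of_ne_zero hk
  filter_upwards [eventually_const_mul_rpow_le 64 (show 0 < 3 * ε / 2 by linarith),
    eventually_const_mul_rpow_le (2 ^ 14 + 1) hR,
    eventually_const_mul_rpow_le (32 * (2 ^ 14) ^ 14 * (2 ^ 14) ^ 24 * 2 * 2)
      (show 14 * κ + 152 * x + 1 / 2 < 1 by linarith),
    eventually_const_mul_rpow_le (128 * (2 ^ 14) ^ 16 * (2 ^ 14) ^ 24 * (2 * k).factorial *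
      2 ^ (2 * k)) hn,
    eventually_const_mul_rpow_le ((2 * k).factorial * 2 ^ (2 * k)) hη,
    eventually_const_mul_rpow_le 2 hy, eventually_ge_atTop 3] with p e1 e2 e3 e4 e5 e6 hp3
  intro _ A₁ A₂ β₁ β₂ g κ₀ M₁ M₂ hg hdiag hκ₀ htriv hA₁ hA₂ hyA hM₁0 hM₂0 hM₁p h₁ h₂ hμ hM₁ hM₂
  have hp3' : (3 : ℝ) ≤ p := by exact_mod_cast hp3
  set q : ℝ := (p : ℝ) with hq
  have hq0 : 0 < q := by linarith
  have hq1 : 1 ≤ q := by linarith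
  have h2 : (2 : ZMod p) ≠ 0 := by
    have := (ZMod.natCast_eq_zero_iff 2 p).not.2 (fun h => by
      have := Nat.le_of_dvd two_pos h; omega)
    exact_mod_cast this
  rw [Real.rpow_zero, mul_one] at e1 e6
  have hD : 1 ≤ q ^ x := Real.one_le_rpow hq1 hx
  have hK : 1 ≤ q ^ κ := Real.one_le_rpow hq1 hκ0
  have hDK : (2 ^ 14 * (q ^ x) ^ 4 * q ^ κ : ℝ) = 2 ^ 14 * q ^ (4 * x + κ) := by
    rw [rpow_pow_eq hq0.le, mul_assoc, ← Real.rpow_add hq0]; norm_num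
  have hD4 : (2 ^ 14 * (q ^ x) ^ 4 : ℝ) = 2 ^ 14 * q ^ (4 * x) := by
    rw [rpow_pow_eq hq0.le]; norm_num
  have herase : ∀ a, q ^ y / 2 ≤ #(A₂.erase a) := by
    intro a
    have h3 : (#A₂ : ℝ) ≤ #(A₂.erase a) + 1 := by
      exact_mod_cast tsub_le_iff_right.1 (pred_card_le_card_erase (s := A₂) (a := a))
    linarith
  have herase' : ∀ a, q ^ (2 * k * y) / 2 ^ (2 * k) ≤ (#(A₂.erase a) : ℝ) ^ (2 * k) := by
    intro a
    calc q ^ (2 * k * y) / 2 ^ (2 * k) = (q ^ y / 2) ^ (2 * k) := by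
          rw [div_pow, rpow_pow_eq hq0.le]; push_cast; rfl
      _ ≤ _ := pow_le_pow_left₀ (by positivity) (herase a) _
  set t : ℝ := (q * M₁ ^ 7 * M₂ ^ 7 * (q ^ x)⁻¹) ^ ((8 : ℝ)⁻¹) with ht_def
  have ht8 : t ^ 8 = q * M₁ ^ 7 * M₂ ^ 7 * (q ^ x)⁻¹ := by
    rw [ht_def, ← Real.rpow_natCast, ← Real.rpow_mul (by positivity)]; norm_num
  set s : ℝ := 2 ^ 16 * q ^ ((4 * x + α₁ / 2 - κ / 4) / (4 * k)) with hs_def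
  have key := norm_bilinear_le_of_onlyTrivialSums (N := q ^ (1 / 2 - α₁)) (K := q ^ κ)
    (D := q ^ x) (η := 2 * q ^ ((2 * α₁ - κ) / 4)) (s := s) (t := t) hg hdiag hκ₀ h2 hk htriv hμ hM₁
    hM₂0 hM₂ hD hK (by positivity) (by positivity) (by positivity) (by positivity) ?_
    (by positivity) ?_ ?_ ?_ ?_ ?_ ?_ ?_
  · have hs' : (#A₂ * M₂ * s * M₁) * #A₁ ≤ 2 ^ 18 * q ^ (1 - σ) := by
      calc (#A₂ * M₂ * s * M₁) * #A₁ = (#A₁ * M₁) * (#A₂ * M₂) * s := by ring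
        _ ≤ (2 * √q) * (2 * √q) * s := by gcongr
        _ = 4 * (√q * √q) * s := by ring
        _ = 4 * q * s := by rw [Real.mul_self_sqrt hq0.le]
        _ = 2 ^ 18 * (q ^ (1 : ℝ) * q ^ ((4 * x + α₁ / 2 - κ / 4) / (4 * k))) := by
            rw [hs_def, Real.rpow_one]; ring
        _ ≤ 2 ^ 18 * q ^ (1 - σ) := by
            rw [← Real.rpow_add hq0]
            gcongr
            have : (4 * x + α₁ / 2 - κ / 4) / (4 * k) =
                -((κ / 8 - α₁ / 4 - 2 * x) / (2 * k)) := by field_simp; ring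
            linarith
    have ht' : (#A₁ : ℝ) * (#A₂ * t) ≤ 4 * q ^ (1 - σ) := by
      rw [sub_eq_add_neg]
      refine card_mul_card_mul_le_of_pow_eight (by positivity) (by positivity) hM₁0 hM₂0 hq0
        (by positivity : 0 ≤ (q ^ x)⁻¹) h₁ h₂ ht8 ?_
      calc (#A₁ : ℝ) * #A₂ * (q ^ x)⁻¹ ≤ q ^ α * q ^ α * (q ^ x)⁻¹ := by gcongr
        _ = q ^ (α + α - x) := by
            rw [← Real.rpow_neg hq0.le, ← Real.rpow_add hq0, ← Real.rpow_add hq0, sub_eq_add_neg]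
        _ ≤ _ := Real.rpow_le_rpow_of_exponent_le hq1 (by linarith)
    have hpos : 0 ≤ q ^ (1 - σ) := by positivity
    refine key.trans ?_
    rw [mul_add, mul_comm (#A₁ : ℝ)]
    linarith
  · rw [rpow_pow_eq hq0.le, rpow_pow_eq hq0.le, rpow_pow_eq hq0.le]
    calc _ ≤ q ^ (3 * ε / 2) * q ^ ((4 : ℕ) * x) * q ^ ((3 : ℕ) * (1 / 2 - α₁)) := by gcongr
      _ = _ := by
        rw [← Real.rpow_add hq0, ← Real.rpow_add hq0]
        congr 1
        push_cast
        ring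
  · rw [hDK]
    have : 0 < q ^ (4 * x + κ) := by positivity
    linarith
  · rw [hDK, hD4]
    calc _ ≤ 32 * (2 ^ 14 * q ^ (4 * x + κ)) ^ 4 * ((2 ^ 14 * q ^ (4 * x + κ)) ^ 10 *
          (2 ^ 14 * q ^ (4 * x)) ^ 24) * (2 * √q) := by gcongr
      _ = (32 * (2 ^ 14) ^ 14 * (2 ^ 14) ^ 24 * 2 * 2) *
          ((q ^ (4 * x + κ)) ^ 14 * (q ^ (4 * x)) ^ 24 * √q) / 2 := by ring
      _ = (32 * (2 ^ 14) ^ 14 * (2 ^ 14) ^ 24 * 2 * 2) * q ^ (14 * κ + 152 * x + 1 / 2) / 2 := by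
          rw [rpow_pow_eq hq0.le, rpow_pow_eq hq0.le, Real.sqrt_eq_rpow, ← Real.rpow_add hq0,
            ← Real.rpow_add hq0]
          congr 3
          push_cast
          ring
      _ ≤ q ^ (1 : ℝ) / 2 := by gcongr
      _ ≤ q - 1 := by rw [Real.rpow_one]; linarith
  · intro a _
    refine le_trans ?_ (herase' a)
    rw [le_div_iff₀ (by positivity), hDK, hD4]
    refine le_trans (le_of_eq ?_) e4
    calc _ = (128 * (2 ^ 14) ^ 16 * (2 ^ 14) ^ 24 * (2 * k).factorial * 2 ^ (2 * k)) *
          ((q ^ κ) ^ 2 * (q ^ (4 * x + κ)) ^ 16 * (q ^ (4 * x)) ^ 24) := by ring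
      _ = _ := by
        rw [rpow_pow_eq hq0.le, rpow_pow_eq hq0.le, rpow_pow_eq hq0.le, ← Real.rpow_add hq0,
          ← Real.rpow_add hq0]
        congr 2
        push_cast
        ring
  · intro a _
    refine le_trans ?_ (mul_le_mul_of_nonneg_left (herase' a) (by positivity))
    rw [mul_div_assoc', le_div_iff₀ (by positivity), mul_pow, rpow_pow_eq hq0.le]
    have h3 : q ^ (-(κ / 2)) ≤ 2 ^ 2 * q ^ ((2 : ℕ) * ((2 * α₁ - κ) / 4)) := by
      have : q ^ (-(κ / 2)) ≤ q ^ ((2 : ℕ) * ((2 * α₁ - κ) / 4)) := by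
        apply Real.rpow_le_rpow_of_exponent_le hq1
        push_cast
        linarith
      have h0 : 0 ≤ q ^ ((2 : ℕ) * ((2 * α₁ - κ) / 4)) := by positivity
      linarith
    calc ((2 * k).factorial * 2 ^ (2 * k) : ℝ)
        = q ^ (-(κ / 2)) * ((2 * k).factorial * 2 ^ (2 * k) * q ^ (κ / 2)) := by
          rw [mul_left_comm, ← Real.rpow_add hq0]; simp
      _ ≤ (2 ^ 2 * q ^ ((2 : ℕ) * ((2 * α₁ - κ) / 4))) * q ^ (2 * k * y) := by gcongr
  · rw [mul_pow, rpow_pow_eq hq0.le, rpow_pow_eq hq0.le]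
    calc 2 * q ≤ 2 ^ 4 * q ^ (1 : ℝ) := by rw [Real.rpow_one]; linarith
      _ = 2 ^ 4 * (q ^ κ * q ^ ((4 : ℕ) * ((2 * α₁ - κ) / 4)) * q ^ ((2 : ℕ) * (1 / 2 - α₁))) := by
        rw [← Real.rpow_add hq0, ← Real.rpow_add hq0]
        congr 2
        push_cast
        ring
      _ = _ := by ring
  · rw [hD4, hs_def, mul_pow, rpow_pow_eq hq0.le]
    calc 2 * (2 ^ 14 * q ^ (4 * x)) * (2 * q ^ ((2 * α₁ - κ) / 4))
        = 2 ^ 16 * (q ^ (4 * x) * q ^ ((2 * α₁ - κ) / 4)) := by ring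
      _ = 2 ^ 16 * q ^ (((4 * k : ℕ) : ℝ) * ((4 * x + α₁ / 2 - κ / 4) / (4 * k))) := by
          rw [← Real.rpow_add hq0]
          congr 2
          push_cast
          field_simp
          ring
      _ ≤ _ := by
          gcongr
          exact le_self_pow₀ (by norm_num) (by omega)
  · rw [ht8, mul_one]

end Classes

section WeakFlat

open Finset ZMod Filter

section Field

variable {p : ℕ} [Fact p.Prime]

lemma slopeForm_swap (κ : ZMod p) (g : ZMod p → ZMod p → ℂ) (β₁ β₂ : ZMod p → Finset (ZMod p))
    (A₁ A₂ : Finset (ZMod p)) :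
    slopeForm κ g β₁ β₂ A₁ A₂ = slopeForm (-κ) (fun a a' => g a' a) β₂ β₁ A₂ A₁ := by
  rw [slopeForm, slopeForm, sum_comm]
  refine sum_congr rfl fun a _ => sum_congr rfl fun a' _ => ?_
  rw [sum_comm]
  congr 1
  refine sum_congr rfl fun b _ => sum_congr rfl fun b' _ => ?_
  rw [← neg_sub a a', inv_neg]
  congr 1
  ring

lemma onlyTrivialSums_of_inv {A A' : Finset (ZMod p)} {k : ℕ}
    (h : ∀ a ∈ A, ∀ f g : Fin (k + k) → ZMod p, (∀ j, f j ∈ A ∧ f j ≠ a) →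
      (∀ j, g j ∈ A ∧ g j ≠ a) → ∑ j, (a - f j)⁻¹ = ∑ j, (a - g j)⁻¹ →
        ∃ σ : Equiv.Perm (Fin (k + k)), ∀ j, f j = g (σ j))
    {a κ : ZMod p} (ha : a ∈ A) (hA' : A' ⊆ A) (hκ : κ ≠ 0) :
    OnlyTrivialSums (A'.erase a) (fun a' => κ * (a - a')⁻¹) k := by
  intro F H hF hH hFH
  have hmem : ∀ F : Fin k ⊕ Fin k → ZMod p, (∀ i, F i ∈ A'.erase a) →
      ∀ j, F (finSumFinEquiv.symm j) ∈ A ∧ F (finSumFinEquiv.symm j) ≠ a := fun F hF j =>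
    ⟨hA' (mem_of_mem_erase (hF _)), ne_of_mem_erase (hF _)⟩
  rw [← mul_sum, ← mul_sum] at hFH
  obtain ⟨σ, hσ⟩ := h a ha _ _ (hmem F hF) (hmem H hH) (by
    rw [Equiv.sum_comp finSumFinEquiv.symm fun i => (a - F i)⁻¹,
      Equiv.sum_comp finSumFinEquiv.symm fun i => (a - H i)⁻¹]
    exact mul_left_cancel₀ hκ hFH)
  refine ⟨finSumFinEquiv.trans (σ.trans finSumFinEquiv.symm), funext fun i => ?_⟩
  simpa using hσ (finSumFinEquiv i)

end Field

/-- The bilinear bound for families with fibres of comparable size. -/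
lemma eventually_norm_slopeForm_le_of_comparable_fibres {k : ℕ} (hk : k ≠ 0)
    {ℓ γ α ε₁ α₁ α₂ ε x y c₀ : ℝ} (hα : 0 < α) (hε₁ : 0 < ε₁)
    (hα₁ : 0 < α₁) (hε : 0 < ε) (hx : 0 < x) (hy : 0 < y)
    (hc₀ : c₀ = 1 / 10430)
    (hd1 : ε₁ + ε < α₁ - α - (4 / 3) * x - ε)
    (hd2 : ℓ ≤ 1 / 2 + (4 / 3) * x - α₁ + ε / 2)
    (hd3 : ε₁ + ε < γ / 4 - y / 4 - ε)
    (hd4 : α₂ ≥ 9 * x + ε)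
    (hd5 : c₀ * y / 8 - (α₁ / 4 + 9 * α₂ / 8) / (k + k : ℕ) ≤ x / 8 - α / 4)
    (hd6 : ε₁ + ε < c₀ * y / 8 - (α₁ / 4 + 9 * α₂ / 8) / (k + k : ℕ))
    (hd7 : ((k + k : ℕ) : ℝ) * y ≤ 1 / 2 - α₁) :
    ∀ᶠ p : ℕ in atTop, ∀ [Fact p.Prime] (A B : Finset (ZMod p)),
      (∀ a ∈ A, ∀ f g : Fin (k + k) → ZMod p, (∀ j, f j ∈ A ∧ f j ≠ a) →
        (∀ j, g j ∈ A ∧ g j ≠ a) → ∑ j, (a - f j)⁻¹ = ∑ j, (a - g j)⁻¹ →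
          ∃ σ : Equiv.Perm (Fin (k + k)), ∀ j, f j = g (σ j)) →
      (∀ S ⊆ B, (p : ℝ) ^ ℓ ≤ #S →
        (_root_.addEnergy S S : ℝ) ≤ (p : ℝ) ^ (-γ + ε) * #S ^ 3) →
      (#A : ℝ) ≤ (p : ℝ) ^ α →
      ∀ (A₁ A₂ : Finset (ZMod p)) (β₁ β₂ : ZMod p → Finset (ZMod p)) (g : ZMod p → ZMod p → ℂ)
        (κ₀ : ZMod p) (M₁ M₂ : ℝ), A₁ ⊆ A → A₂ ⊆ A → (∀ a, β₁ a ⊆ B) → (∀ a, β₂ a ⊆ B) →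
        (∀ a a', ‖g a a'‖ ≤ 1) → (∀ a, g a a = 0) → κ₀ ≠ 0 →
        #A₁ * M₁ ≤ 2 * √p → #A₂ * M₂ ≤ 2 * √p →
        (∀ a ∈ A₁, M₁ / 2 ≤ #(β₁ a)) → (∀ a ∈ A₁, (#(β₁ a) : ℝ) ≤ M₁) →
        (∀ a ∈ A₂, M₂ / 2 ≤ #(β₂ a)) → (∀ a ∈ A₂, (#(β₂ a) : ℝ) ≤ M₂) →
        ‖slopeForm κ₀ g β₁ β₂ A₁ A₂‖ ≤ 2 ^ 19 * (p : ℝ) ^ (1 - (ε₁ + ε)) := by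
  have hk' : (0 : ℝ) < k := by exact_mod_cast Nat.pos_of_ne_zero hk
  set Y : ℝ := 2 * k * y with hY
  have hm : ((k + k : ℕ) : ℝ) = 2 * k := by push_cast; ring
  rw [hm] at hd5 hd6 hd7
  have hd6' : (ε₁ + ε) * (2 * k) + (α₁ / 4 + 9 * α₂ / 8) < c₀ * Y / 8 := by
    have h1 := mul_lt_mul_of_pos_right hd6 (by positivity : (0 : ℝ) < 2 * k)
    rw [sub_mul, div_mul_cancel₀ _ (by positivity)] at h1
    linarith [show c₀ * y / 8 * (2 * k) = c₀ * Y / 8 by rw [hY]; ring]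
  have hσ : 0 < (ε₁ + ε) * (2 * k) := by positivity
  subst hc₀
  have hmany := eventually_norm_slopeForm_le_of_many_slopes hk (x := x) (y := y) (α := α) (α₁ := α₁)
    (ε := ε) (κ := Y / 50) (σ := ε₁ + ε) hx.le hε (by positivity) hα₁.le (by linarith) (by linarith)
    (by linarith) (by linarith) hy (by
      rw [le_div_iff₀ (by positivity)]
      linarith) (by linarith)
  filter_upwards [hmany, eventually_ge_atTop 3] with p hmany hp3
  intro _ A B hA hB hAα A₁ A₂ β₁ β₂ g κ₀ M₁ M₂ hA₁ hA₂ hβ₁ hβ₂ hg hdiag hκ₀ h₁ h₂ hl₁ hu₁ hl₂ hu₂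
  have hp3' : (3 : ℝ) ≤ p := by exact_mod_cast hp3
  set q : ℝ := (p : ℝ) with hq
  have hq0 : 0 < q := by linarith
  have hq1 : 1 ≤ q := by linarith
  have h2 : (2 : ZMod p) ≠ 0 := by
    have := (ZMod.natCast_eq_zero_iff 2 p).not.2 (fun h => by
      have := Nat.le_of_dvd two_pos h; omega)
    exact_mod_cast this
  have hcard₁ : (#A₁ : ℝ) ≤ q ^ α := le_trans (by exact_mod_cast card_le_card hA₁) hAα
  have hcard₂ : (#A₂ : ℝ) ≤ q ^ α := le_trans (by exact_mod_cast card_le_card hA₂) hAα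
  have hpos : 0 ≤ q ^ (1 - (ε₁ + ε)) := by positivity
  rcases A₁.eq_empty_or_nonempty with rfl | hne₁
  · simpa [slopeForm] using hpos
  rcases A₂.eq_empty_or_nonempty with rfl | hne₂
  · simpa [slopeForm] using hpos
  have hM₁0 : 0 ≤ M₁ := (Nat.cast_nonneg _).trans (hu₁ _ hne₁.choose_spec)
  have hM₂0 : 0 ≤ M₂ := (Nat.cast_nonneg _).trans (hu₂ _ hne₂.choose_spec)
  have hM₁p : M₁ ≤ 2 * √q := le_trans
    (le_mul_of_one_le_left hM₁0 (by exact_mod_cast hne₁.card_pos)) h₁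
  have hM₂p : M₂ ≤ 2 * √q := le_trans
    (le_mul_of_one_le_left hM₂0 (by exact_mod_cast hne₂.card_pos)) h₂
  set μ : ℝ := q ^ (1 / 2 - α₁ + 4 / 3 * x + ε / 2) with hμ
  have hshort : q ^ α * (2 * μ) * (2 * √q) ≤ 4 * q ^ (1 - (ε₁ + ε)) := by
    calc q ^ α * (2 * μ) * (2 * √q) = 4 * (q ^ α * μ * √q) := by ring
      _ ≤ 4 * q ^ (1 - (ε₁ + ε)) := by
        rw [hμ, Real.sqrt_eq_rpow, ← Real.rpow_add hq0, ← Real.rpow_add hq0]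
        gcongr 4 * ?_
        exact Real.rpow_le_rpow_of_exponent_le hq1 (by linarith)
  by_cases hμ₁ : M₁ < 2 * μ
  · refine (norm_bilinear_le_card hg hu₁ hu₂).trans ?_
    calc #A₁ * (#A₂ * (M₁ * M₂)) = #A₁ * M₁ * (#A₂ * M₂) := by ring
      _ ≤ q ^ α * (2 * μ) * (2 * √q) := by gcongr
      _ ≤ _ := by linarith
  by_cases hμ₂ : M₂ < 2 * μ
  · refine (norm_bilinear_le_card hg hu₁ hu₂).trans ?_
    calc #A₁ * (#A₂ * (M₁ * M₂)) = #A₂ * M₂ * (#A₁ * M₁) := by ring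
      _ ≤ q ^ α * (2 * μ) * (2 * √q) := by gcongr
      _ ≤ _ := by linarith
  rw [not_lt] at hμ₁ hμ₂
  have hlong₁ : ∀ a ∈ A₁, μ ≤ #(β₁ a) := fun a ha => by linarith [hl₁ a ha]
  have hlong₂ : ∀ a ∈ A₂, μ ≤ #(β₂ a) := fun a ha => by linarith [hl₂ a ha]
  by_cases hy₂ : q ^ y ≤ #A₂
  · exact hmany A₁ A₂ β₁ β₂ g κ₀ M₁ M₂ hg hdiag hκ₀
      (fun a ha => onlyTrivialSums_of_inv hA (hA₁ ha) hA₂ hκ₀) hcard₁ hcard₂ hy₂ hM₁0 hM₂0 hM₁p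
      h₁ h₂ hlong₁ hu₁ hu₂
  by_cases hy₁ : q ^ y ≤ #A₁
  · rw [slopeForm_swap]
    exact hmany A₂ A₁ β₂ β₁ _ (-κ₀) M₂ M₁ (fun a a' => hg a' a) hdiag (neg_ne_zero.2 hκ₀)
      (fun a ha => onlyTrivialSums_of_inv hA (hA₂ ha) hA₁ (neg_ne_zero.2 hκ₀)) hcard₂ hcard₁ hy₁
      hM₂0 hM₁0 hM₂p h₂ h₁ hlong₂ hu₂ hu₁
  rw [not_le] at hy₁ hy₂
  have hℓ : q ^ ℓ ≤ μ := Real.rpow_le_rpow_of_exponent_le hq1 (by linarith)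
  set τ : ℝ := q ^ (-γ + ε) with hτ
  have henergy : ∀ {S : Finset (ZMod p)} {M : ℝ}, S ⊆ B → μ ≤ #S → (#S : ℝ) ≤ M →
      (_root_.addEnergy S S : ℝ) ≤ τ * M ^ 3 := fun {S M} hS h3 h4 =>
    (hB S hS (hℓ.trans h3)).trans (by gcongr)
  set t : ℝ := (q * M₁ ^ 7 * M₂ ^ 7 * (τ * τ)) ^ ((8 : ℝ)⁻¹) with ht_def
  have ht8 : t ^ 8 = q * M₁ ^ 7 * M₂ ^ 7 * (τ * τ) := by
    rw [ht_def, ← Real.rpow_natCast, ← Real.rpow_mul (by positivity)]; norm_num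
  refine (norm_bilinear_le_of_energy hg hdiag hκ₀ h2 hu₁ hu₂
    (fun a ha => henergy (hβ₁ a) (hlong₁ a ha) (hu₁ a ha))
    (fun a ha => henergy (hβ₂ a) (hlong₂ a ha) (hu₂ a ha)) (by positivity : 0 ≤ t) ht8.ge).trans ?_
  have h3 := card_mul_card_mul_le_of_pow_eight (n₁ := #A₁) (n₂ := #A₂) (θ := -(ε₁ + ε))
    (by positivity) (by positivity) hM₁0 hM₂0 hq0 (by positivity : 0 ≤ τ * τ) h₁ h₂ ht8 (by
      calc (#A₁ : ℝ) * #A₂ * (τ * τ) ≤ q ^ y * q ^ y * (τ * τ) := by gcongr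
        _ = q ^ (y + y + ((-γ + ε) + (-γ + ε))) := by
            rw [hτ, ← Real.rpow_add hq0, ← Real.rpow_add hq0, ← Real.rpow_add hq0]
        _ ≤ _ := Real.rpow_le_rpow_of_exponent_le hq1 (by linarith))
  rw [← sub_eq_add_neg] at h3
  linarith

end WeakFlat

section Dyadic

open Finset ZMod Filter

/-- The fibre of `Ω` over `a`. -/
def fibre {α β : Type*} [DecidableEq α] [DecidableEq β] (Ω : Finset (α × β)) (a : α) : Finset β :=
  {u ∈ Ω | u.1 = a}.image Prod.snd

lemma mem_fibre {α β : Type*} [DecidableEq α] [DecidableEq β] {Ω : Finset (α × β)} {a : α} {b : β} :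
    b ∈ fibre Ω a ↔ (a, b) ∈ Ω := by
  simp only [fibre, mem_image, mem_filter]
  constructor
  · rintro ⟨u, ⟨hu, rfl⟩, rfl⟩
    exact hu
  · exact fun h => ⟨(a, b), ⟨h, rfl⟩, rfl⟩

lemma mem_iff_fibre {α β : Type*} [DecidableEq α] [DecidableEq β] (Ω : Finset (α × β)) (u : α × β) :
    u ∈ Ω ↔ u.1 ∈ Ω.image Prod.fst ∧ u.2 ∈ fibre Ω u.1 := by
  rw [mem_fibre]
  exact ⟨fun h => ⟨mem_image_of_mem _ h, h⟩, fun h => h.2⟩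

/-- The first coordinates whose fibre has size about `2 ^ j`. -/
def fibreLevel {α β : Type*} [DecidableEq α] [DecidableEq β] (Ω : Finset (α × β)) (j : ℕ) :
    Finset α :=
  {a ∈ Ω.image Prod.fst | Nat.log 2 #(fibre Ω a) = j}

lemma card_fibre_bounds {α β : Type*} [DecidableEq α] [DecidableEq β] {Ω : Finset (α × β)} {j : ℕ}
    {a : α} (ha : a ∈ fibreLevel Ω j) : 2 ^ j ≤ #(fibre Ω a) ∧ #(fibre Ω a) ≤ 2 ^ (j + 1) := by
  obtain ⟨ha1, rfl⟩ := mem_filter.1 ha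
  obtain ⟨u, hu, rfl⟩ := mem_image.1 ha1
  have hne : #(fibre Ω u.1) ≠ 0 := card_ne_zero_of_mem (mem_fibre.2 hu)
  exact ⟨Nat.pow_log_le_self 2 hne, (Nat.lt_pow_succ_log_self one_lt_two _).le⟩

lemma card_fibreLevel_mul_le {α β : Type*} [DecidableEq α] [DecidableEq β] (Ω : Finset (α × β))
    (j : ℕ) : #(fibreLevel Ω j) * 2 ^ j ≤ #Ω := by
  have h : #Ω = ∑ a ∈ Ω.image Prod.fst, #(fibre Ω a) := by
    rw [card_eq_sum_ones, sum_finset_product Ω (Ω.image Prod.fst) (fibre Ω) (mem_iff_fibre Ω)]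
    simp
  rw [h, ← smul_eq_mul]
  calc #(fibreLevel Ω j) • 2 ^ j ≤ ∑ a ∈ fibreLevel Ω j, #(fibre Ω a) :=
        card_nsmul_le_sum _ _ _ fun a ha => (card_fibre_bounds ha).1
    _ ≤ _ := sum_le_sum_of_subset (filter_subset _ _)

variable {p : ℕ}

lemma sum_eq_sum_fibreLevel {M : Type*} [AddCommMonoid M] [NeZero p]
    (Ω : Finset (ZMod p × ZMod p)) (f : ZMod p → M) :
    ∑ a ∈ Ω.image Prod.fst, f a = ∑ j ∈ range (Nat.log 2 p + 1), ∑ a ∈ fibreLevel Ω j, f a := by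
  refine (sum_fiberwise_of_maps_to (fun a _ => ?_) f).symm
  rw [mem_range, Nat.lt_succ_iff]
  refine Nat.log_mono_right ?_
  simpa using card_le_univ (fibre Ω a)

lemma norm_sum_sum_le_of_fibreLevel [Fact p.Prime] (Ω₁ Ω₂ : Finset (ZMod p × ZMod p))
    (g : ZMod p → ZMod p → ℂ) (κ : ZMod p) {X : ℝ}
    (h : ∀ i j, ‖slopeForm κ g (fibre Ω₁) (fibre Ω₂) (fibreLevel Ω₁ i) (fibreLevel Ω₂ j)‖ ≤ X) :
    ‖∑ u ∈ Ω₁, ∑ v ∈ Ω₂, g u.1 v.1 *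
        (stdAddChar (κ * (u.1 - v.1)⁻¹ * (u.2 - v.2) ^ 2) : ℂ)‖ ≤ (Nat.log 2 p + 1) ^ 2 * X := by
  have h1 : ∑ u ∈ Ω₁, ∑ v ∈ Ω₂, g u.1 v.1 *
      (stdAddChar (κ * (u.1 - v.1)⁻¹ * (u.2 - v.2) ^ 2) : ℂ) =
      ∑ i ∈ range (Nat.log 2 p + 1), ∑ j ∈ range (Nat.log 2 p + 1),
        slopeForm κ g (fibre Ω₁) (fibre Ω₂) (fibreLevel Ω₁ i) (fibreLevel Ω₂ j) := by
    rw [sum_finset_product Ω₁ _ _ (mem_iff_fibre Ω₁), sum_eq_sum_fibreLevel]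
    refine sum_congr rfl fun i _ => ?_
    simp only [slopeForm]
    rw [sum_comm (s := range _)]
    refine sum_congr rfl fun a _ => ?_
    rw [← sum_eq_sum_fibreLevel, sum_comm,
      sum_finset_product Ω₂ _ _ (mem_iff_fibre Ω₂)]
    refine sum_congr rfl fun a' _ => ?_
    rw [sum_comm, mul_sum]
    simp only [mul_sum]
  rw [h1]
  calc _ ≤ ∑ _i ∈ range (Nat.log 2 p + 1), ∑ _j ∈ range (Nat.log 2 p + 1), X :=
        norm_sum_le_of_le _ fun i _ => norm_sum_le_of_le _ fun j _ => h i j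
    _ = _ := by
        simp only [sum_const, card_range, nsmul_eq_mul]
        push_cast
        ring

lemma eventually_const_mul_log_sq_le (C : ℝ) {a : ℝ} (ha : 0 < a) :
    ∀ᶠ p : ℕ in atTop, C * (Nat.log 2 p + 1 : ℝ) ^ 2 ≤ (p : ℝ) ^ a := by
  have hlog := (isLittleO_log_rpow_atTop (half_pos (half_pos ha))).comp_tendsto
    (tendsto_natCast_atTop_atTop (R := ℝ))
  have hb := hlog.bound (by positivity : (0 : ℝ) < Real.log 2)
  filter_upwards [hb, eventually_const_mul_rpow_le (4 * |C|) (half_lt_self ha),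
    eventually_ge_atTop 1] with p h1 h2 hp
  have hp' : (1 : ℝ) ≤ p := by exact_mod_cast hp
  have h3 : (Nat.log 2 p : ℝ) ≤ (p : ℝ) ^ (a / 2 / 2) := by
    refine (Real.natLog_le_logb p 2).trans ?_
    rw [Real.logb, Nat.cast_ofNat, div_le_iff₀' (Real.log_pos one_lt_two)]
    refine (le_abs_self _).trans (h1.trans_eq ?_)
    simp [abs_of_nonneg (Real.rpow_nonneg (Nat.cast_nonneg (α := ℝ) p) _)]
  have h4 : (1 : ℝ) ≤ (p : ℝ) ^ (a / 2 / 2) := Real.one_le_rpow hp' (by positivity)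
  calc C * (Nat.log 2 p + 1 : ℝ) ^ 2 ≤ |C| * ((p : ℝ) ^ (a / 2 / 2) + (p : ℝ) ^ (a / 2 / 2)) ^ 2 := by
        gcongr
        exact le_abs_self C
    _ = 4 * |C| * ((p : ℝ) ^ (a / 2 / 2)) ^ 2 := by ring
    _ = 4 * |C| * (p : ℝ) ^ (a / 2) := by
        rw [rpow_pow_eq (by positivity)]
        congr 2
        push_cast
        ring
    _ ≤ _ := h2

/-- A bound for every comparable pair of fibre families gives one for arbitrary index sets. -/
theorem eventually_norm_sum_sum_le_of_slopeForm {σ η : ℝ} (hη : 0 < η) :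
    ∀ᶠ p : ℕ in atTop, ∀ [Fact p.Prime] (A B : Finset (ZMod p)) (g : ZMod p → ZMod p → ℂ)
      (κ : ZMod p),
      (∀ (A₁ A₂ : Finset (ZMod p)) (β₁ β₂ : ZMod p → Finset (ZMod p)) (M₁ M₂ : ℝ),
        A₁ ⊆ A → A₂ ⊆ A → (∀ a, β₁ a ⊆ B) → (∀ a, β₂ a ⊆ B) →
        #A₁ * M₁ ≤ 2 * √p → #A₂ * M₂ ≤ 2 * √p →
        (∀ a ∈ A₁, M₁ / 2 ≤ #(β₁ a)) → (∀ a ∈ A₁, (#(β₁ a) : ℝ) ≤ M₁) →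
        (∀ a ∈ A₂, M₂ / 2 ≤ #(β₂ a)) → (∀ a ∈ A₂, (#(β₂ a) : ℝ) ≤ M₂) →
        ‖slopeForm κ g β₁ β₂ A₁ A₂‖ ≤ 2 ^ 19 * (p : ℝ) ^ (1 - σ)) →
      ∀ Ω₁ ⊆ A ×ˢ B, ∀ Ω₂ ⊆ A ×ˢ B, (#Ω₁ : ℝ) ≤ √p → (#Ω₂ : ℝ) ≤ √p →
        ‖∑ u ∈ Ω₁, ∑ v ∈ Ω₂, g u.1 v.1 *
          (stdAddChar (κ * (u.1 - v.1)⁻¹ * (u.2 - v.2) ^ 2) : ℂ)‖ ≤ (p : ℝ) ^ (1 - σ + η) := by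
  filter_upwards [eventually_const_mul_log_sq_le (2 ^ 19) hη, eventually_gt_atTop 0] with p hp hp0
  intro _ A B g κ h Ω₁ hΩ₁ Ω₂ hΩ₂ h₁ h₂
  have hp0' : (0 : ℝ) < p := by exact_mod_cast hp0
  have hA : ∀ {Ω : Finset (ZMod p × ZMod p)}, Ω ⊆ A ×ˢ B → ∀ j, fibreLevel Ω j ⊆ A := by
    intro Ω hΩ j a ha
    obtain ⟨u, hu, rfl⟩ := mem_image.1 (mem_filter.1 ha).1
    exact (mem_product.1 (hΩ hu)).1
  have hB : ∀ {Ω : Finset (ZMod p × ZMod p)}, Ω ⊆ A ×ˢ B → ∀ a, fibre Ω a ⊆ B :=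
    fun hΩ a b hb => (mem_product.1 (hΩ (mem_fibre.1 hb))).2
  have hcard : ∀ {Ω : Finset (ZMod p × ZMod p)}, (#Ω : ℝ) ≤ √p → ∀ j,
      (#(fibreLevel Ω j) : ℝ) * 2 ^ (j + 1) ≤ 2 * √p := by
    intro Ω hΩ j
    have : (#(fibreLevel Ω j) : ℝ) * 2 ^ j ≤ #Ω := by exact_mod_cast card_fibreLevel_mul_le Ω j
    rw [pow_succ]
    linarith
  have hlow : ∀ {Ω : Finset (ZMod p × ZMod p)} {j : ℕ}, ∀ a ∈ fibreLevel Ω j,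
      (2 : ℝ) ^ (j + 1) / 2 ≤ #(fibre Ω a) := by
    intro Ω j a ha
    rw [pow_succ, mul_div_cancel_right₀ _ two_ne_zero]
    exact_mod_cast (card_fibre_bounds ha).1
  have hup : ∀ {Ω : Finset (ZMod p × ZMod p)} {j : ℕ}, ∀ a ∈ fibreLevel Ω j,
      (#(fibre Ω a) : ℝ) ≤ 2 ^ (j + 1) := fun a ha => by
    exact_mod_cast (card_fibre_bounds ha).2
  refine (norm_sum_sum_le_of_fibreLevel Ω₁ Ω₂ g κ fun i j => h _ _ _ _ (2 ^ (i + 1)) (2 ^ (j + 1))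
    (hA hΩ₁ i) (hA hΩ₂ j) (hB hΩ₁) (hB hΩ₂) (hcard h₁ i) (hcard h₂ j) hlow hup hlow hup).trans ?_
  calc _ = 2 ^ 19 * (Nat.log 2 p + 1 : ℝ) ^ 2 * (p : ℝ) ^ (1 - σ) := by ring
    _ ≤ (p : ℝ) ^ η * (p : ℝ) ^ (1 - σ) := by gcongr
    _ = _ := by rw [← Real.rpow_add hp0', add_comm]

end Dyadic

section FlatToRIP

open Finset

variable {ι : Type*}

/-- A flat bound for short index sets extends to long ones. -/
lemma norm_sum_le_of_short {S : Finset ι} {f : ι → ℂ} {C : ℝ} (hC : 0 ≤ C) {s : ℕ} (hs : s ≠ 0)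
    (h : ∀ I ⊆ S, #I ≤ s → ‖∑ i ∈ I, f i‖ ≤ C * √(#I : ℝ)) {I : Finset ι} (hI : I ⊆ S) {n : ℝ}
    (hn : #I ≤ n) : ‖∑ i ∈ I, f i‖ ≤ C * (1 + 2 * √(n / s)) * √(#I : ℝ) := by
  classical
  have hs0 : (0 : ℝ) < s := by exact_mod_cast Nat.pos_of_ne_zero hs
  have key : ∀ J : Finset ι, J ⊆ S → ‖∑ i ∈ J, f i‖ ≤ C * (#J / √s + √s) := by
    intro J
    induction J using Finset.strongInduction with
    | H J ih =>
      intro hJ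
      rcases le_or_gt #J s with hle | hlt
      · refine (h J hJ hle).trans ?_
        gcongr
        have h1 : √(#J : ℝ) ≤ √s := Real.sqrt_le_sqrt (by exact_mod_cast hle)
        have h2 : (0 : ℝ) ≤ #J / √s := by positivity
        linarith
      · obtain ⟨X, hX, hXs⟩ := exists_subset_card_eq hlt.le
        have hXne : X.Nonempty := card_pos.1 (by omega)
        have h1 := ih (J \ X) (sdiff_ssubset hX hXne) (sdiff_subset.trans hJ)
        have h2 := h X (hX.trans hJ) hXs.le
        have h3 : (#J : ℝ) = #(J \ X) + s := by
          rw [← hXs]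
          exact_mod_cast (card_sdiff_add_card_eq_card hX).symm
        rw [hXs] at h2
        rw [← sum_sdiff hX, h3, add_div, Real.div_sqrt]
        refine (norm_add_le _ _).trans ?_
        linarith
  rcases le_or_gt #I s with hle | hlt
  · refine (h I hI hle).trans ?_
    gcongr
    exact le_mul_of_one_le_right hC (by linarith [Real.sqrt_nonneg (n / s)])
  refine (key I hI).trans ?_
  rw [mul_assoc]
  gcongr
  have hI0 : (0 : ℝ) < #I := by exact_mod_cast (Nat.zero_le s).trans_lt hlt
  have hsI : √(s : ℝ) ≤ √(#I : ℝ) := Real.sqrt_le_sqrt (by exact_mod_cast hlt.le)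
  have hsn : √(s : ℝ) * √(s : ℝ) = s := Real.mul_self_sqrt hs0.le
  have hII : √(#I : ℝ) * √(#I : ℝ) = #I := Real.mul_self_sqrt hI0.le
  have hspos : 0 < √(s : ℝ) := Real.sqrt_pos.2 hs0
  have hnI : √(#I : ℝ) ≤ √n := Real.sqrt_le_sqrt hn
  rw [Real.sqrt_div' _ hs0.le]
  have h4 : (#I : ℝ) / √s ≤ √n / √s * √(#I : ℝ) := by
    rw [div_mul_eq_mul_div]
    gcongr
    calc (#I : ℝ) = √(#I : ℝ) * √(#I : ℝ) := hII.symm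
      _ ≤ √n * √(#I : ℝ) := by gcongr
  linarith [mul_nonneg (div_nonneg (Real.sqrt_nonneg n) hspos.le) (Real.sqrt_nonneg (#I : ℝ))]

lemma norm_sum_mul_le_of_binary {S : Finset ι} {f : ι → ℂ} {C : ℝ} (hC : 0 ≤ C)
    (h : ∀ I ⊆ S, ‖∑ i ∈ I, f i‖ ≤ C * √(#I : ℝ)) (t : ℕ) :
    ∀ (j : ℕ) (v : ι → ℝ), (∀ i ∈ S, 0 ≤ v i) → (∀ i ∈ S, v i ≤ (2 ^ j)⁻¹) →
      ∑ i ∈ S, v i ^ 2 ≤ 1 → ‖∑ i ∈ S, (v i : ℂ) * f i‖ ≤ C * (t + #S * (2 ^ (j + t))⁻¹) := by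
  classical
  induction t with
  | zero =>
    intro j v hv0 hv _
    calc _ ≤ ∑ _i ∈ S, (2 ^ j : ℝ)⁻¹ * C := by
          refine norm_sum_le_of_le _ fun i hi => ?_
          have h1 := h {i} (singleton_subset_iff.2 hi)
          rw [sum_singleton, card_singleton, Nat.cast_one, Real.sqrt_one, mul_one] at h1
          rw [norm_mul, Complex.norm_real, Real.norm_of_nonneg (hv0 i hi)]
          exact mul_le_mul (hv i hi) h1 (norm_nonneg _) (by positivity)
      _ = _ := by
          rw [sum_const, nsmul_eq_mul, Nat.cast_zero, zero_add, add_zero]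
          ring
  | succ t ih =>
    intro j v hv0 hv hsum
    set r : ℝ := (2 ^ (j + 1))⁻¹ with hr
    have hr0 : 0 < r := by positivity
    have hr2 : ((2 : ℝ) ^ j)⁻¹ = 2 * r := by rw [hr, pow_succ]; field_simp
    set D := {i ∈ S | r ≤ v i} with hD
    have hDS : D ⊆ S := filter_subset _ _
    set v' : ι → ℝ := fun i => v i - if i ∈ D then r else 0 with hv'
    have hv'0 : ∀ i ∈ S, 0 ≤ v' i := by
      intro i hi
      simp only [hv']
      split_ifs with hiD
      · linarith [(mem_filter.1 hiD).2]
      · linarith [hv0 i hi]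
    have hv'v : ∀ i ∈ S, v' i ≤ v i := by
      intro i _
      simp only [hv']
      split_ifs <;> linarith
    have hv'r : ∀ i ∈ S, v' i ≤ r := by
      intro i hi
      simp only [hv']
      split_ifs with hiD
      · linarith [hv i hi]
      · have : ¬ r ≤ v i := fun h => hiD (mem_filter.2 ⟨hi, h⟩)
        linarith
    have h1 := ih (j + 1) v' hv'0 hv'r
      ((sum_le_sum fun i hi => pow_le_pow_left₀ (hv'0 i hi) (hv'v i hi) 2).trans hsum)
    have hDcard : r * √(#D : ℝ) ≤ 1 := by
      refine le_of_sq_le_sq ?_ zero_le_one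
      rw [mul_pow, Real.sq_sqrt (by positivity), one_pow, mul_comm, ← nsmul_eq_mul, ← sum_const]
      refine le_trans ?_ ((sum_le_sum_of_subset_of_nonneg hDS fun _ _ _ => by positivity).trans hsum)
      exact sum_le_sum fun i hi => pow_le_pow_left₀ hr0.le (mem_filter.1 hi).2 2
    have h2 : ∑ i ∈ S, (v i : ℂ) * f i = ∑ i ∈ S, (v' i : ℂ) * f i + r * ∑ i ∈ D, f i := by
      have h3 : ∑ i ∈ D, f i = ∑ i ∈ S, if i ∈ D then f i else 0 := by
        rw [← sum_filter, filter_mem_eq_inter, inter_eq_right.2 hDS]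
      rw [h3, mul_sum, ← sum_add_distrib]
      refine sum_congr rfl fun i _ => ?_
      simp only [hv']
      split_ifs
      · push_cast
        ring
      · push_cast
        ring
    rw [h2]
    have h4 : ‖(r : ℂ) * ∑ i ∈ D, f i‖ ≤ C := by
      rw [norm_mul, Complex.norm_real, Real.norm_of_nonneg hr0.le]
      calc r * ‖∑ i ∈ D, f i‖ ≤ r * (C * √(#D : ℝ)) := by gcongr; exact h D hDS
        _ = C * (r * √(#D : ℝ)) := by ring
        _ ≤ C := mul_le_of_le_one_right hC hDcard
    refine (norm_add_le _ _).trans ?_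
    have h5 : j + 1 + t = j + (t + 1) := by ring
    rw [h5] at h1
    push_cast
    linarith

lemma norm_sum_real_mul_le {S : Finset ι} {f : ι → ℂ} {C : ℝ} (hC : 0 ≤ C)
    (h : ∀ I ⊆ S, ‖∑ i ∈ I, f i‖ ≤ C * √(#I : ℝ)) {k : ℕ} (hk : #S ≤ 2 ^ k) {v : ι → ℝ}
    (hv : ∀ i ∈ S, 0 ≤ v i) {N : ℝ} (hN : 0 ≤ N) (hvN : ∑ i ∈ S, v i ^ 2 ≤ N ^ 2) :
    ‖∑ i ∈ S, (v i : ℂ) * f i‖ ≤ C * (k + 1) * N := by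
  rcases hN.eq_or_lt with rfl | hN
  · have h0 : ∀ i ∈ S, v i = 0 := by
      intro i hi
      have h1 := (single_le_sum (f := fun i => v i ^ 2) (fun i _ => sq_nonneg (v i)) hi).trans hvN
      exact pow_eq_zero_iff two_ne_zero |>.1 (le_antisymm (by simpa using h1) (sq_nonneg _))
    rw [sum_eq_zero fun i hi => by rw [h0 i hi]; simp]
    simp
  have hsum : ∑ i ∈ S, (v i / N) ^ 2 ≤ 1 := by
    simp only [div_pow]
    rw [← sum_div, div_le_one (by positivity)]
    exact hvN
  have h1 := norm_sum_mul_le_of_binary hC h k 0 (fun i => v i / N)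
    (fun i hi => div_nonneg (hv i hi) hN.le) (fun i hi => by
      rw [pow_zero, inv_one]
      refine le_of_sq_le_sq ?_ zero_le_one
      rw [one_pow]
      exact (single_le_sum (f := fun i => (v i / N) ^ 2) (fun i _ => sq_nonneg _) hi).trans hsum)
    hsum
  have h2 : ∑ i ∈ S, (v i : ℂ) * f i = N * ∑ i ∈ S, ((v i / N : ℝ) : ℂ) * f i := by
    rw [mul_sum]
    refine sum_congr rfl fun i _ => ?_
    push_cast
    rw [← mul_assoc, mul_div_cancel₀ _ (by exact_mod_cast hN.ne')]
  rw [h2, norm_mul, Complex.norm_real, Real.norm_of_nonneg hN.le, mul_comm]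
  gcongr
  refine h1.trans ?_
  gcongr
  rw [zero_add, ← div_eq_mul_inv, div_le_one (by positivity)]
  exact_mod_cast hk

lemma norm_sum_complex_mul_le {S : Finset ι} {f : ι → ℂ} {C : ℝ} (hC : 0 ≤ C)
    (h : ∀ I ⊆ S, ‖∑ i ∈ I, f i‖ ≤ C * √(#I : ℝ)) {k : ℕ} (hk : #S ≤ 2 ^ k) (z : ι → ℂ) :
    ‖∑ i ∈ S, z i * f i‖ ≤ 4 * C * (k + 1) * √(∑ i ∈ S, ‖z i‖ ^ 2) := by
  set N : ℝ := √(∑ i ∈ S, ‖z i‖ ^ 2) with hN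
  have hNsq : N ^ 2 = ∑ i ∈ S, ‖z i‖ ^ 2 := Real.sq_sqrt (sum_nonneg fun _ _ => by positivity)
  have hpart : ∀ u : ι → ℝ, (∀ i, |u i| ≤ ‖z i‖) →
      ‖∑ i ∈ S, (u i : ℂ) * f i‖ ≤ 2 * (C * (k + 1) * N) := by
    intro u hu
    have hpos : ∀ w : ι → ℝ, (∀ i, 0 ≤ w i) → (∀ i, w i ≤ |u i|) →
        ‖∑ i ∈ S, (w i : ℂ) * f i‖ ≤ C * (k + 1) * N := fun w hw0 hwu =>
      norm_sum_real_mul_le hC h hk (fun i _ => hw0 i) (Real.sqrt_nonneg _) (by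
        rw [hNsq]
        exact sum_le_sum fun i _ => pow_le_pow_left₀ (hw0 i) ((hwu i).trans (hu i)) 2)
    have h1 := hpos (fun i => (u i)⁺) (fun i => posPart_nonneg _)
      (fun i => sup_le (le_abs_self _) (abs_nonneg _))
    have h2 := hpos (fun i => (u i)⁻) (fun i => negPart_nonneg _)
      (fun i => sup_le (neg_le_abs _) (abs_nonneg _))
    have h3 : ∑ i ∈ S, (u i : ℂ) * f i =
        ∑ i ∈ S, (((u i)⁺ : ℝ) : ℂ) * f i - ∑ i ∈ S, (((u i)⁻ : ℝ) : ℂ) * f i := by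
      rw [← sum_sub_distrib]
      refine sum_congr rfl fun i _ => ?_
      rw [← sub_mul, ← Complex.ofReal_sub, posPart_sub_negPart]
    rw [h3]
    refine (norm_sub_le _ _).trans ?_
    linarith
  have h1 := hpart (fun i => (z i).re) fun i => Complex.abs_re_le_norm _
  have h2 := hpart (fun i => (z i).im) fun i => Complex.abs_im_le_norm _
  have h3 : ∑ i ∈ S, z i * f i =
      ∑ i ∈ S, ((z i).re : ℂ) * f i + Complex.I * ∑ i ∈ S, ((z i).im : ℂ) * f i := by
    rw [mul_sum, ← sum_add_distrib]
    refine sum_congr rfl fun i _ => ?_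
    rw [← mul_assoc, ← add_mul, mul_comm Complex.I, Complex.re_add_im]
  rw [h3]
  refine (norm_add_le _ _).trans ?_
  rw [norm_mul, Complex.norm_I, one_mul]
  linarith

/-- Flatness on short index sets controls the bilinear form on sparse vectors. -/
theorem norm_bilinear_sum_le_of_flat {S : Finset ι} {R : ι → ι → ℂ} {θ : ℝ} (hθ : 0 ≤ θ) {s : ℕ}
    (hs : s ≠ 0) (h : ∀ I ⊆ S, ∀ J ⊆ S, #I ≤ s → #J ≤ s →
      ‖∑ i ∈ I, ∑ j ∈ J, R i j‖ ≤ θ * √(#I : ℝ) * √(#J : ℝ))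
    {n : ℝ} (hn : #S ≤ n) {k : ℕ} (hk : #S ≤ 2 ^ k) (z w : ι → ℂ) :
    ‖∑ i ∈ S, ∑ j ∈ S, z i * w j * R i j‖ ≤
      θ * (4 * (1 + 2 * √(n / s)) * (k + 1)) ^ 2 *
        (√(∑ i ∈ S, ‖z i‖ ^ 2) * √(∑ i ∈ S, ‖w i‖ ^ 2)) := by
  set Q : ℝ := 1 + 2 * √(n / s) with hQ
  have hQ0 : 0 ≤ Q := by positivity
  have hlin : ∀ {f : ι → ℂ} {C : ℝ}, 0 ≤ C → (∀ I ⊆ S, #I ≤ s → ‖∑ i ∈ I, f i‖ ≤ C * √(#I : ℝ)) →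
      ∀ z : ι → ℂ, ‖∑ i ∈ S, z i * f i‖ ≤ 4 * (C * Q) * (k + 1) * √(∑ i ∈ S, ‖z i‖ ^ 2) :=
    fun hC hf z => norm_sum_complex_mul_le (by positivity) (fun I hI =>
      norm_sum_le_of_short hC hs hf hI (le_trans (by exact_mod_cast card_le_card hI) hn)) hk z
  have h1 : ∀ J ⊆ S, #J ≤ s → ‖∑ j ∈ J, ∑ i ∈ S, z i * R i j‖ ≤
      (4 * (θ * Q) * (k + 1) * √(∑ i ∈ S, ‖z i‖ ^ 2)) * √(#J : ℝ) := by
    intro J hJ hJs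
    have h2 := hlin (f := fun i => ∑ j ∈ J, R i j) (C := θ * √(#J : ℝ)) (by positivity)
      (fun I hI hIs => (h I hI J hJ hIs hJs).trans_eq (by ring)) z
    rw [sum_comm]
    simp only [← mul_sum]
    exact h2.trans_eq (by ring)
  have h3 := hlin (f := fun j => ∑ i ∈ S, z i * R i j) (by positivity) h1 w
  rw [sum_comm]
  refine le_trans (le_of_eq ?_) (h3.trans_eq (by ring))
  congr 1
  refine sum_congr rfl fun j _ => ?_
  rw [mul_sum]
  refine sum_congr rfl fun i _ => by ring

end FlatToRIP

section Gram

open Finset ZMod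

lemma ep_eq_stdAddChar {p : ℕ} [NeZero p] (t : ZMod p) : ep p t = stdAddChar t := by
  rw [ep, stdAddChar_apply, toCircle_apply]

variable {p : ℕ} [Fact p.Prime]

/-- The quadratic Gauss sum with coefficient `c`. -/
noncomputable def quadGaussSum (c : ZMod p) : ℂ := ∑ z : ZMod p, stdAddChar (c * z ^ 2)

lemma sum_stdAddChar_mul (c : ZMod p) :
    ∑ z : ZMod p, (stdAddChar (c * z) : ℂ) = if c = 0 then (p : ℂ) else 0 := by
  have h := AddChar.sum_mulShift c (isPrimitive_stdAddChar p)
  rw [ZMod.card] at h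
  simp only [mul_comm c]
  rw [h]
  split_ifs <;> simp

lemma conj_stdAddChar (t : ZMod p) :
    (starRingEnd ℂ) (stdAddChar t : ℂ) = stdAddChar (-t) :=
  (AddChar.map_neg_eq_conj _ _).symm

lemma norm_quadGaussSum (hp : p ≠ 2) {c : ZMod p} (hc : c ≠ 0) : ‖quadGaussSum c‖ = √p := by
  have h2 : (2 : ZMod p) ≠ 0 := Ring.two_ne_zero (by rwa [ringChar_zmod_n])
  have h : ((‖quadGaussSum c‖ ^ 2 : ℝ) : ℂ) = p := by
    rw [Complex.ofReal_pow, ← Complex.conj_mul', quadGaussSum, map_sum, sum_mul_sum]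
    calc _ = ∑ w : ZMod p, ∑ h : ZMod p,
          (stdAddChar (c * h ^ 2) : ℂ) * stdAddChar (2 * c * h * w) := by
          refine sum_congr rfl fun w _ => ?_
          rw [← Equiv.sum_comp (Equiv.addLeft w)]
          refine sum_congr rfl fun h _ => ?_
          rw [conj_stdAddChar, ← AddChar.map_add_eq_mul, ← AddChar.map_add_eq_mul]
          congr 1
          simp only [Equiv.coe_addLeft]
          ring
      _ = ∑ h : ZMod p, (stdAddChar (c * h ^ 2) : ℂ) * if h = 0 then (p : ℂ) else 0 := by
          rw [sum_comm]
          refine sum_congr rfl fun h _ => ?_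
          rw [← mul_sum, sum_stdAddChar_mul]
          simp [h2, hc]
      _ = p := by simp
  have h' : ‖quadGaussSum c‖ ^ 2 = p := by exact_mod_cast h
  rw [← h', Real.sqrt_sq (norm_nonneg _)]

lemma sum_stdAddChar_quadratic (hp : p ≠ 2) {c : ZMod p} (hc : c ≠ 0) (d : ZMod p) :
    ∑ z : ZMod p, (stdAddChar (c * z ^ 2 + d * z) : ℂ) =
      quadGaussSum c * stdAddChar (-4⁻¹ * c⁻¹ * d ^ 2) := by
  have h2 : (2 : ZMod p) ≠ 0 := Ring.two_ne_zero (by rwa [ringChar_zmod_n])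
  have h4 : (4 : ZMod p) ≠ 0 := by
    rw [show (4 : ZMod p) = 2 * 2 by norm_num]
    exact mul_ne_zero h2 h2
  rw [quadGaussSum, sum_mul, ← Equiv.sum_comp (Equiv.addRight ((2 * c)⁻¹ * d))
    fun z => (stdAddChar (c * z ^ 2) : ℂ) * _]
  refine sum_congr rfl fun z _ => ?_
  rw [← AddChar.map_add_eq_mul]
  congr 1
  simp only [Equiv.coe_addRight]
  field_simp
  ring

/-- The normalised Gauss sum attached to a pair of slopes, vanishing on the diagonal. -/
noncomputable def slopeWeight (a a' : ZMod p) : ℂ := if a = a' then 0 else (√p : ℂ)⁻¹ * quadGaussSum (a - a')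

lemma slopeWeight_self (a : ZMod p) : slopeWeight a a = 0 := if_pos rfl

lemma norm_slopeWeight_le (hp : p ≠ 2) (a a' : ZMod p) : ‖slopeWeight a a'‖ ≤ 1 := by
  rw [slopeWeight]
  split_ifs with h
  · simp
  · rw [norm_mul, norm_quadGaussSum hp (sub_ne_zero.2 h), norm_inv, Complex.norm_real,
      Real.norm_of_nonneg (Real.sqrt_nonneg _)]
    exact inv_mul_le_one

/-- The off-diagonal part of the Gram matrix of the chirp vectors. -/
noncomputable def chirpCorrelation (u v : ZMod p × ZMod p) : ℂ :=
  (√p : ℂ)⁻¹ * (slopeWeight u.1 v.1 * stdAddChar (-4⁻¹ * (u.1 - v.1)⁻¹ * (u.2 - v.2) ^ 2))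

lemma gram_eq (hp : p ≠ 2) (u v : ZMod p × ZMod p) :
    (p : ℂ)⁻¹ * ∑ z : ZMod p, (stdAddChar (u.1 * z ^ 2 + u.2 * z) : ℂ) *
      (starRingEnd ℂ) (stdAddChar (v.1 * z ^ 2 + v.2 * z) : ℂ) =
    (if u = v then 1 else 0) + chirpCorrelation u v := by
  have hp0 : (p : ℂ) ≠ 0 := by exact_mod_cast (Fact.out : p.Prime).ne_zero
  have h1 : ∀ z : ZMod p, (stdAddChar (u.1 * z ^ 2 + u.2 * z) : ℂ) *
      (starRingEnd ℂ) (stdAddChar (v.1 * z ^ 2 + v.2 * z) : ℂ) =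
      stdAddChar ((u.1 - v.1) * z ^ 2 + (u.2 - v.2) * z) := by
    intro z
    rw [conj_stdAddChar, ← AddChar.map_add_eq_mul]
    congr 1
    ring
  rw [sum_congr rfl fun z _ => h1 z, chirpCorrelation]
  by_cases h : u.1 = v.1
  · simp only [h, sub_self, zero_mul, zero_add, slopeWeight_self, mul_zero, add_zero]
    rw [sum_stdAddChar_mul]
    by_cases h' : u.2 = v.2
    · simp [h', Prod.ext_iff, h, hp0]
    · simp [h', Prod.ext_iff, sub_eq_zero]
  · have h2 : u ≠ v := fun e => h (by rw [e])
    rw [sum_stdAddChar_quadratic hp (sub_ne_zero.2 h), if_neg h2, zero_add, slopeWeight, if_neg h]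
    have h3 : (p : ℂ)⁻¹ = (√p : ℂ)⁻¹ * (√p : ℂ)⁻¹ := by
      rw [← mul_inv, ← Complex.ofReal_mul, Real.mul_self_sqrt (by positivity)]
      simp
    rw [h3]
    ring

lemma norm_sq_mulVec_chirpMatrix (hp : p ≠ 2) (A B : Finset (ZMod p))
    (f : (A ×ˢ B : Finset (ZMod p × ZMod p)) → ℂ) :
    ((∑ z, ‖(chirpMatrix p A B).mulVec f z‖ ^ 2 : ℝ) : ℂ) =
      ((∑ i, ‖f i‖ ^ 2 : ℝ) : ℂ) +
        ∑ i, ∑ j, f i * (starRingEnd ℂ) (f j) * chirpCorrelation i.1 j.1 := by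
  have hp0 : (p : ℂ)⁻¹ = (√p : ℂ)⁻¹ * (√p : ℂ)⁻¹ := by
    rw [← mul_inv, ← Complex.ofReal_mul, Real.mul_self_sqrt (by positivity)]
    simp
  have h1 : ∀ z, ((‖(chirpMatrix p A B).mulVec f z‖ ^ 2 : ℝ) : ℂ) =
      ∑ i, ∑ j, f i * (starRingEnd ℂ) (f j) * ((p : ℂ)⁻¹ *
        ((stdAddChar (i.1.1 * z ^ 2 + i.1.2 * z) : ℂ) *
          (starRingEnd ℂ) (stdAddChar (j.1.1 * z ^ 2 + j.1.2 * z) : ℂ))) := by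
    intro z
    rw [Complex.ofReal_pow, ← Complex.mul_conj', Matrix.mulVec, dotProduct, map_sum, sum_mul_sum]
    refine sum_congr rfl fun i _ => sum_congr rfl fun j _ => ?_
    rw [chirpMatrix, chirpMatrix, ep_eq_stdAddChar, ep_eq_stdAddChar, (starRingEnd ℂ).map_mul,
      (starRingEnd ℂ).map_mul, Complex.conj_ofReal, hp0, Complex.ofReal_inv]
    ring
  rw [Complex.ofReal_sum, sum_congr rfl fun z _ => h1 z, sum_comm]
  have h2 : ∀ i : (A ×ˢ B : Finset (ZMod p × ZMod p)), ∑ z : ZMod p, ∑ j, f i * (starRingEnd ℂ) (f j) * ((p : ℂ)⁻¹ *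
        ((stdAddChar (i.1.1 * z ^ 2 + i.1.2 * z) : ℂ) *
          (starRingEnd ℂ) (stdAddChar (j.1.1 * z ^ 2 + j.1.2 * z) : ℂ))) =
      ((‖f i‖ ^ 2 : ℝ) : ℂ) +
        ∑ j, f i * (starRingEnd ℂ) (f j) * chirpCorrelation i.1 j.1 := by
    intro i
    rw [sum_comm]
    simp only [← mul_sum]
    rw [sum_congr rfl fun j _ => by rw [gram_eq hp i.1 j.1, mul_add], sum_add_distrib]
    congr 1
    rw [sum_eq_single i (fun j _ hj => by
      rw [if_neg fun e => hj (Subtype.ext e).symm, mul_zero]) (by simp), if_pos rfl, mul_one,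
      Complex.mul_conj', Complex.ofReal_pow]
  rw [sum_congr rfl fun i _ => h2 i, sum_add_distrib, Complex.ofReal_sum]

end Gram

section Assembly

open Finset ZMod Filter

/-- Flatness of the correlations on small index sets gives the restricted isometry property. -/
theorem rip_chirpMatrix_of_flat {p : ℕ} [Fact p.Prime] (hp : p ≠ 2) {A B : Finset (ZMod p)}
    {θ n δ : ℝ} (hθ : 0 ≤ θ) {s K k : ℕ} (hs : s ≠ 0)
    (h : ∀ Ω₁ ⊆ A ×ˢ B, ∀ Ω₂ ⊆ A ×ˢ B, #Ω₁ ≤ s → #Ω₂ ≤ s →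
      ‖∑ u ∈ Ω₁, ∑ v ∈ Ω₂, chirpCorrelation u v‖ ≤ θ * √(#Ω₁ : ℝ) * √(#Ω₂ : ℝ))
    (hK : (K : ℝ) ≤ n) (hk : p * p ≤ 2 ^ k)
    (hδ : θ * (4 * (1 + 2 * √(n / s)) * (k + 1)) ^ 2 ≤ δ) :
    RIP (chirpMatrix p A B) K δ := by
  classical
  intro f hf
  set S : Finset (A ×ˢ B : Finset (ZMod p × ZMod p)) := {i | f i ≠ 0} with hS
  have hSK : (#S : ℝ) ≤ n := by
    refine le_trans ?_ hK
    have h1 : {i | f i ≠ 0} = (S : Set (A ×ˢ B : Finset (ZMod p × ZMod p))) := by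
      ext i
      simp [hS]
    rw [h1, Set.ncard_coe_finset] at hf
    exact_mod_cast hf
  have hSk : #S ≤ 2 ^ k := by
    refine le_trans ((card_le_univ S).trans ?_) hk
    rw [Fintype.card_coe, card_product]
    exact Nat.mul_le_mul ((card_le_univ A).trans_eq (ZMod.card p))
      ((card_le_univ B).trans_eq (ZMod.card p))
  have hflat : ∀ I ⊆ S, ∀ J ⊆ S, #I ≤ s → #J ≤ s →
      ‖∑ i ∈ I, ∑ j ∈ J, chirpCorrelation i.1 j.1‖ ≤ θ * √(#I : ℝ) * √(#J : ℝ) := by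
    intro I _ J _ hI hJ
    have hsub : ∀ I : Finset (A ×ˢ B : Finset (ZMod p × ZMod p)),
        I.map (Function.Embedding.subtype _) ⊆ A ×ˢ B := by
      intro I u hu
      obtain ⟨i, _, rfl⟩ := mem_map.1 hu
      exact i.2
    have h1 := h _ (hsub I) _ (hsub J) (by rwa [card_map]) (by rwa [card_map])
    simpa only [sum_map, card_map, Function.Embedding.subtype_apply] using h1
  have hbil := norm_bilinear_sum_le_of_flat hθ hs hflat hSK hSk f fun i => (starRingEnd ℂ) (f i)
  simp only [RCLike.norm_conj] at hbil
  have hzero : ∀ i, i ∉ S → f i = 0 := fun i hi => by simpa [hS] using hi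
  have hnorm : ∑ i ∈ S, ‖f i‖ ^ 2 = ∑ i, ‖f i‖ ^ 2 :=
    sum_subset (subset_univ _) fun i _ hi => by simp [hzero i hi]
  rw [hnorm, Real.mul_self_sqrt (sum_nonneg fun _ _ => by positivity)] at hbil
  have hsum : ∑ i ∈ S, ∑ j ∈ S, f i * (starRingEnd ℂ) (f j) * chirpCorrelation i.1 j.1 =
      ∑ i, ∑ j, f i * (starRingEnd ℂ) (f j) * chirpCorrelation i.1 j.1 := by
    refine (sum_congr rfl fun i _ => sum_subset (subset_univ _) fun j _ hj => ?_).trans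
      (sum_subset (subset_univ _) fun i _ hi => sum_eq_zero fun j _ => ?_)
    · simp [hzero j hj]
    · simp [hzero i hi]
  rw [hsum, ← sub_eq_of_eq_add' (norm_sq_mulVec_chirpMatrix hp A B f), ← Complex.ofReal_sub,
    Complex.norm_real, Real.norm_eq_abs] at hbil
  have hN : 0 ≤ ∑ i, ‖f i‖ ^ 2 := sum_nonneg fun _ _ => by positivity
  have hfin := abs_le.1 (hbil.trans (mul_le_mul_of_nonneg_right hδ hN))
  constructor <;> linarith [hfin.1, hfin.2]

/-- A uniform power saving for the correlations on index sets of size up to `√p` gives the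
restricted isometry property beyond `√p`. -/
theorem eventually_rip_chirpMatrix_of_sum_le {ε₁ ε ε'' δ : ℝ} (hε : 0 < ε) (hε'' : 0 < ε'')
    (hε₁ : 0 < ε₁) (hδ : 0 < δ) :
    ∀ᶠ p : ℕ in atTop, ∀ [Fact p.Prime] (A B : Finset (ZMod p)),
      (∀ Ω₁ ⊆ A ×ˢ B, ∀ Ω₂ ⊆ A ×ˢ B, (#Ω₁ : ℝ) ≤ √p → (#Ω₂ : ℝ) ≤ √p →
        ‖∑ u ∈ Ω₁, ∑ v ∈ Ω₂, slopeWeight u.1 v.1 *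
          (stdAddChar (-4⁻¹ * (u.1 - v.1)⁻¹ * (u.2 - v.2) ^ 2) : ℂ)‖ ≤
            (p : ℝ) ^ (1 - (ε₁ + ε) + ε / 2)) →
      RIP (chirpMatrix p A B) ⌊(p : ℝ) ^ ((1 : ℝ) / 2 + ε₁ / 2 - ε'')⌋₊ δ := by
  filter_upwards [eventually_const_mul_log_sq_le (2304 / δ) (a := ε / 4) (by positivity),
    eventually_gt_atTop 2] with p hlog hp2
  intro _ A B h
  have hp0 : (0 : ℝ) < p := by exact_mod_cast (by omega : 0 < p)
  have hp1 : (1 : ℝ) ≤ p := by exact_mod_cast (by omega : 1 ≤ p)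
  set θ : ℝ := (p : ℝ) ^ (-(ε₁ / 2) - ε / 4) with hθ
  have hs0 : p.sqrt ≠ 0 := (Nat.sqrt_pos.2 (by omega)).ne'
  have hsle : (p.sqrt : ℝ) ≤ √p := Real.nat_sqrt_le_real_sqrt
  have hsge : √(p : ℝ) ≤ 2 * p.sqrt := by
    have h1 : √(p : ℝ) ≤ p.sqrt + 1 := Real.real_sqrt_le_nat_sqrt_succ
    have h2 : (1 : ℝ) ≤ p.sqrt := by exact_mod_cast Nat.pos_of_ne_zero hs0
    linarith
  have hsqrt : √(p : ℝ) = (p : ℝ) ^ (1 / 2 : ℝ) := Real.sqrt_eq_rpow _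
  refine rip_chirpMatrix_of_flat (by omega) (θ := θ)
    (n := (p : ℝ) ^ ((1 : ℝ) / 2 + ε₁ / 2 - ε'')) (k := 2 * (Nat.log 2 p + 1)) (s := p.sqrt)
    (by positivity) hs0 ?_ (Nat.floor_le (by positivity)) ?_ ?_
  · intro Ω₁ hΩ₁ Ω₂ hΩ₂ h₁ h₂
    have hb := h Ω₁ hΩ₁ Ω₂ hΩ₂ (le_trans (by exact_mod_cast h₁) hsle)
      (le_trans (by exact_mod_cast h₂) hsle)
    simp only [chirpCorrelation, ← mul_sum]
    set T := ∑ u ∈ Ω₁, ∑ v ∈ Ω₂, slopeWeight u.1 v.1 *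
      (stdAddChar (-4⁻¹ * (u.1 - v.1)⁻¹ * (u.2 - v.2) ^ 2) : ℂ) with hT
    have htriv : ‖T‖ ≤ #Ω₁ * #Ω₂ := by
      calc ‖T‖ ≤ ∑ _u ∈ Ω₁, ∑ _v ∈ Ω₂, (1 : ℝ) := by
            refine norm_sum_le_of_le _ fun u _ => norm_sum_le_of_le _ fun v _ => ?_
            rw [norm_mul, AddChar.norm_apply, mul_one]
            exact norm_slopeWeight_le (by omega) _ _
        _ = #Ω₁ * #Ω₂ := by simp
    rw [norm_mul, norm_inv, Complex.norm_real, Real.norm_of_nonneg (Real.sqrt_nonneg _),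
      inv_mul_le_iff₀ (Real.sqrt_pos.2 hp0)]
    refine abs_le_of_sq_le_sq' ?_ (by positivity) |>.2
    calc ‖T‖ ^ 2 = ‖T‖ * ‖T‖ := sq _
      _ ≤ (p : ℝ) ^ (1 - (ε₁ + ε) + ε / 2) * (#Ω₁ * #Ω₂) := by gcongr
      _ = (√p * (θ * √(#Ω₁ : ℝ) * √(#Ω₂ : ℝ))) ^ 2 := by
          simp only [mul_pow]
          rw [Real.sq_sqrt (by positivity), Real.sq_sqrt (by positivity),
            Real.sq_sqrt (by positivity), hθ, rpow_pow_eq (by positivity)]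
          nth_rewrite 2 [← Real.rpow_one (p : ℝ)]
          rw [← mul_assoc, ← mul_assoc, ← mul_assoc, ← Real.rpow_add hp0]
          congr 3
          push_cast
          ring
  · have h1 : p ≤ 2 ^ (Nat.log 2 p + 1) := (Nat.lt_pow_succ_log_self one_lt_two p).le
    rw [two_mul, pow_add]
    exact Nat.mul_le_mul h1 h1
  · have hratio : (p : ℝ) ^ ((1 : ℝ) / 2 + ε₁ / 2 - ε'') / p.sqrt ≤ 2 * (p : ℝ) ^ (ε₁ / 2) := by
      rw [div_le_iff₀ (by exact_mod_cast Nat.pos_of_ne_zero hs0)]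
      calc (p : ℝ) ^ ((1 : ℝ) / 2 + ε₁ / 2 - ε'') ≤ (p : ℝ) ^ (ε₁ / 2 + 1 / 2) :=
            Real.rpow_le_rpow_of_exponent_le hp1 (by linarith)
        _ = (p : ℝ) ^ (ε₁ / 2) * √p := by rw [Real.rpow_add hp0, hsqrt]
        _ ≤ (p : ℝ) ^ (ε₁ / 2) * (2 * p.sqrt) := by gcongr
        _ = _ := by ring
    have hone : 1 ≤ (p : ℝ) ^ (ε₁ / 2) := Real.one_le_rpow hp1 (by positivity)
    set X := (p : ℝ) ^ (ε₁ / 2) with hX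
    have hQ : (1 + 2 * √((p : ℝ) ^ ((1 : ℝ) / 2 + ε₁ / 2 - ε'') / p.sqrt)) ^ 2 ≤ 16 * X := by
      have h1 := Real.sqrt_le_sqrt hratio
      set t := √((p : ℝ) ^ ((1 : ℝ) / 2 + ε₁ / 2 - ε'') / p.sqrt)
      have ht : 0 ≤ t := Real.sqrt_nonneg _
      have ht2 : t ^ 2 ≤ 2 * X := by
        rw [← Real.sq_sqrt (by positivity : 0 ≤ 2 * X)]
        gcongr
      nlinarith [sq_nonneg (t - 2)]
    have hL : ((2 * (Nat.log 2 p + 1) : ℕ) + 1 : ℝ) ≤ 3 * (Nat.log 2 p + 1 : ℝ) := by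
      push_cast
      linarith [(Nat.cast_nonneg (Nat.log 2 p) : (0 : ℝ) ≤ _)]
    have hlog' : 2304 * (Nat.log 2 p + 1 : ℝ) ^ 2 ≤ δ * (p : ℝ) ^ (ε / 4) := by
      rw [div_mul_eq_mul_div, div_le_iff₀ hδ] at hlog
      linarith
    calc θ * (4 * (1 + 2 * √((p : ℝ) ^ ((1 : ℝ) / 2 + ε₁ / 2 - ε'') / p.sqrt)) *
          ((2 * (Nat.log 2 p + 1) : ℕ) + 1)) ^ 2
        = θ * (16 * (1 + 2 * √((p : ℝ) ^ ((1 : ℝ) / 2 + ε₁ / 2 - ε'') / p.sqrt)) ^ 2 *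
          ((2 * (Nat.log 2 p + 1) : ℕ) + 1 : ℝ) ^ 2) := by ring
      _ ≤ θ * (16 * (16 * X) * (3 * (Nat.log 2 p + 1 : ℝ)) ^ 2) := by gcongr
      _ = θ * X * (2304 * (Nat.log 2 p + 1 : ℝ) ^ 2) := by ring
      _ ≤ θ * X * (δ * (p : ℝ) ^ (ε / 4)) := by gcongr
      _ = δ * (θ * X * (p : ℝ) ^ (ε / 4)) := by ring
      _ = δ := by
          rw [hθ, hX, ← Real.rpow_add hp0, ← Real.rpow_add hp0,
            show -(ε₁ / 2) - ε / 4 + ε₁ / 2 + ε / 4 = 0 by ring, Real.rpow_zero, mul_one]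

end Assembly

end ChirpRIP

theorem BDFKK_restricted_isometry_machine
    (𝓐 𝓑 : (p : ℕ) → Finset (ZMod p))
    (m : ℕ) (hm_even : Even m) (hm_pos : 0 < m)
    (ℓ γ α ε' ε₁ α₁ α₂ ε x y c₀ : ℝ)
    (hℓ : 0 < ℓ) (hγ : 0 < γ) (hα : 0 < α) (hε' : 0 < ε') (hε₁ : 0 < ε₁)
    (hα₁ : 0 < α₁) (hα₂ : 0 < α₂) (hε : 0 < ε) (hx : 0 < x) (hy : 0 < y)
    (hc₀ : c₀ = 1 / 10430)
    -- (a) the "only trivial solutions" property of 𝓐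
    (hA : ∃ P₀ : ℕ, ∀ p : ℕ, P₀ ≤ p → p.Prime →
      ∀ a ∈ 𝓐 p, ∀ f g : Fin m → ZMod p,
        (∀ j, f j ∈ 𝓐 p ∧ f j ≠ a) → (∀ j, g j ∈ 𝓐 p ∧ g j ≠ a) →
        ∑ j, (a - f j)⁻¹ = ∑ j, (a - g j)⁻¹ →
        ∃ σ : Equiv.Perm (Fin m), ∀ j, f j = g (σ j))
    -- (b) large subsets of 𝓑(p) have small additive energy
    (hB : ∀ εt > (0 : ℝ), ∃ P : ℕ, ∀ p : ℕ, P ≤ p → p.Prime →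
      ∀ S ⊆ 𝓑 p, (p : ℝ) ^ ℓ ≤ (S.card : ℝ) →
        (addEnergy S S : ℝ) ≤ (p : ℝ) ^ (-γ + εt) * (S.card : ℝ) ^ 3)
    -- (c) size conditions on 𝓐(p) and 𝓑(p)
    (hsize : ∃ c > (0 : ℝ), ∃ P : ℕ, ∀ p : ℕ, P ≤ p → p.Prime →
      c * (p : ℝ) ^ α ≤ ((𝓐 p).card : ℝ) ∧ ((𝓐 p).card : ℝ) ≤ (p : ℝ) ^ α ∧
        c * (p : ℝ) ^ (1 - α + ε') ≤ ((𝓑 p).card : ℝ))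
    -- (d) the inequalities
    (hd1 : ε₁ + ε < α₁ - α - (4 / 3) * x - ε)
    (hd2 : ℓ ≤ 1 / 2 + (4 / 3) * x - α₁ + ε / 2)
    (hd3 : ε₁ + ε < γ / 4 - y / 4 - ε)
    (hd4 : α₂ ≥ 9 * x + ε)
    (hd5 : c₀ * y / 8 - (α₁ / 4 + 9 * α₂ / 8) / m ≤ x / 8 - α / 4)
    (hd6 : ε₁ + ε < c₀ * y / 8 - (α₁ / 4 + 9 * α₂ / 8) / m)
    (hd7 : (m : ℝ) * y ≤ min (1 / 2 - α₁) (1 / 2 - α₂))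
    (hd8 : 3 * α₂ - 2 * α₁ ≤ (2 - c₀) * m * y) :
    ∀ ε'' > (0 : ℝ), ∀ δ : ℝ, 0 < δ → δ < Real.sqrt 2 - 1 →
      ∃ P : ℕ, ∀ p : ℕ, P ≤ p → ∀ hp : p.Prime,
        letI : NeZero p := ⟨hp.ne_zero⟩
        RIP (chirpMatrix p (𝓐 p) (𝓑 p))
          (⌊(p : ℝ) ^ ((1 : ℝ) / 2 + ε₁ / 2 - ε'')⌋₊) δ := by
  intro ε'' hε'' δ hδ _
  obtain ⟨k, rfl⟩ := hm_even
  obtain ⟨P₁, hA⟩ := hA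
  obtain ⟨P₂, hB⟩ := hB ε hε
  obtain ⟨c, -, P₃, hsize⟩ := hsize
  rw [← Filter.eventually_atTop (p := fun p : ℕ => ∀ hp : p.Prime,
    letI : NeZero p := ⟨hp.ne_zero⟩
    RIP (chirpMatrix p (𝓐 p) (𝓑 p)) ⌊(p : ℝ) ^ ((1 : ℝ) / 2 + ε₁ / 2 - ε'')⌋₊ δ)]
  filter_upwards [Filter.eventually_ge_atTop P₁, Filter.eventually_ge_atTop P₂,
    Filter.eventually_ge_atTop P₃, Filter.eventually_gt_atTop 2,
    ChirpRIP.eventually_norm_slopeForm_le_of_comparable_fibres (by omega) hα hε₁ hα₁ hε hx hy hc₀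
      hd1 hd2 hd3 hd4 hd5 hd6 (hd7.trans (min_le_left _ _)),
    ChirpRIP.eventually_norm_sum_sum_le_of_slopeForm (σ := ε₁ + ε) (η := ε / 2) (by positivity),
    ChirpRIP.eventually_rip_chirpMatrix_of_sum_le hε hε'' hε₁ hδ]
    with p hp₁ hp₂ hp₃ hp2 hform hsum hrip hp
  have : Fact p.Prime := ⟨hp⟩
  have h4 : (-4⁻¹ : ZMod p) ≠ 0 := by
    have h2 : (2 : ZMod p) ≠ 0 := Ring.two_ne_zero (by rw [ZMod.ringChar_zmod_n]; omega)
    rw [show (4 : ZMod p) = 2 * 2 by norm_num]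
    exact neg_ne_zero.2 (inv_ne_zero (mul_ne_zero h2 h2))
  exact hrip (𝓐 p) (𝓑 p) <| hsum (𝓐 p) (𝓑 p) ChirpRIP.slopeWeight (-4⁻¹)
    fun A₁ A₂ β₁ β₂ M₁ M₂ hA₁ hA₂ hβ₁ hβ₂ => hform (𝓐 p) (𝓑 p) (hA p hp₁ hp) (hB p hp₂ hp)
      (hsize p hp₃ hp).2.1 A₁ A₂ β₁ β₂ ChirpRIP.slopeWeight (-4⁻¹) M₁ M₂ hA₁ hA₂ hβ₁ hβ₂
      (ChirpRIP.norm_slopeWeight_le (by omega)) ChirpRIP.slopeWeight_self h4
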